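/- For every arrangement of topolines 𝓗 in ℝ², there exists an affine arrangement of topolines 𝓐 in ℝ² with the same faces; precisely, ⋃𝓐 = ⋃𝓗 and the set of points lying on at least two distinct members of 𝓐 equals the set of points lying on at least two distinct members of 𝓗. -/

import Mathlib

open Set

/-- The `i`-th coordinate hyperplane in `ℝⁿ` (by convention the whole space if `i ≥ n`). -/
def coordHyp (n i : ℕ) : Set (Fin n → ℝ) := {x | ∀ h : i < n, x ⟨i, h⟩ = 0}

/-- `H` is a topological hyperplane (topoplane) in `ℝⁿ`: some self-homeomorphism of `ℝⁿ`
carries `H` onto the coordinate hyperplane `{x | x₁ = 0}`. -/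
def IsTopoplane {n : ℕ} (H : Set (Fin n → ℝ)) : Prop :=
  ∃ e : (Fin n → ℝ) ≃ₜ (Fin n → ℝ), e '' H = coordHyp n 0

/-- `Z` is a relative topoplane in `Y ⊆ ℝⁿ`: `Z ⊆ Y` and some homeomorphism of `Y`
(with the subspace topology) onto some `ℝᵈ`, `d ≥ 1`, carries `Z` onto `{x | x₁ = 0}`. -/
def IsRelTopoplane {n : ℕ} (Y Z : Set (Fin n → ℝ)) : Prop :=
  Z ⊆ Y ∧ ∃ d : ℕ, 1 ≤ d ∧ ∃ φ : Y ≃ₜ (Fin d → ℝ),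
    φ '' {y : Y | (y : Fin n → ℝ) ∈ Z} = coordHyp d 0

/-- `Y` is a flat of the family `𝓗`: a nonempty intersection of a subfamily of `𝓗`
(the empty intersection being all of `ℝⁿ`). -/
def IsFlat {n : ℕ} (𝓗 : Set (Set (Fin n → ℝ))) (Y : Set (Fin n → ℝ)) : Prop :=
  (∃ 𝓢 ⊆ 𝓗, Y = ⋂₀ 𝓢) ∧ Y.Nonempty

/-- `𝓗` is an arrangement of topoplanes in `ℝⁿ`: a finite set of topoplanes such that for
every `H ∈ 𝓗` and every flat `Y`, either `Y ⊆ H`, or `H ∩ Y = ∅`, or `H ∩ Y` is a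
relative topoplane in `Y`. -/
def IsArrangement {n : ℕ} (𝓗 : Set (Set (Fin n → ℝ))) : Prop :=
  𝓗.Finite ∧ (∀ H ∈ 𝓗, IsTopoplane H) ∧
    ∀ H ∈ 𝓗, ∀ Y : Set (Fin n → ℝ), IsFlat 𝓗 Y →
      Y ⊆ H ∨ H ∩ Y = ∅ ∨ IsRelTopoplane Y (H ∩ Y)

/-- `Y` has dimension `d`: it is homeomorphic, in the subspace topology, to `ℝᵈ`. -/
def HasDim {n : ℕ} (Y : Set (Fin n → ℝ)) (d : ℕ) : Prop :=
  Nonempty (Y ≃ₜ (Fin d → ℝ))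

/-- Topoplanes `H₁`, `H₂` cross: some self-homeomorphism of `ℝⁿ` carries them
simultaneously onto the coordinate hyperplanes `{x | x₁ = 0}` and `{x | x₂ = 0}`. -/
def Crosses {n : ℕ} (H₁ H₂ : Set (Fin n → ℝ)) : Prop :=
  ∃ e : (Fin n → ℝ) ≃ₜ (Fin n → ℝ), e '' H₁ = coordHyp n 0 ∧ e '' H₂ = coordHyp n 1

/-- The pairwise condition for an arrangement to be affine: any two distinct members
are disjoint or cross. -/
def PairwiseAffine {n : ℕ} (𝓗 : Set (Set (Fin n → ℝ))) : Prop :=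
  ∀ H₁ ∈ 𝓗, ∀ H₂ ∈ 𝓗, H₁ ≠ H₂ → H₁ ∩ H₂ = ∅ ∨ Crosses H₁ H₂

section RiemannMapping

open Filter Topology Metric

/-- A family of holomorphic maps into the unit disc that converges pointwise along a filter
converges locally uniformly. -/
theorem tendstoLocallyUniformlyOn_of_mapsTo_closedBall {ι : Type*} {l : Filter ι} [l.NeBot]
    {U : Set ℂ} (hU : IsOpen U) {F : ι → ℂ → ℂ} {g : ℂ → ℂ}
    (hF : ∀ i, DifferentiableOn ℂ (F i) U) (hm : ∀ i, MapsTo (F i) U (closedBall 0 1))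
    (hg : ∀ z ∈ U, Tendsto (fun i => F i z) l (𝓝 (g z))) :
    TendstoLocallyUniformlyOn F g l U := by
  rw [Metric.tendstoLocallyUniformlyOn_iff]
  intro ε hε x hx
  obtain ⟨R, hR, hRU⟩ := Metric.isOpen_iff.1 hU x hx
  have key : ∀ i, ∀ y ∈ ball x R, dist (F i y) (F i x) ≤ 2 / R * dist y x := by
    intro i y hy
    refine Complex.dist_le_div_mul_dist_of_mapsTo_ball ((hF i).mono hRU) ?_ hy
    intro z hz
    have h1 := hm i (hRU hz)
    have h2 := hm i hx
    rw [mem_closedBall, dist_zero_right] at h1 h2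
    rw [mem_closedBall, dist_eq_norm]
    exact (norm_sub_le _ _).trans (by linarith)
  have key' : ∀ y ∈ ball x R, dist (g y) (g x) ≤ 2 / R * dist y x := by
    intro y hy
    exact le_of_tendsto ((hg y (hRU hy)).dist (hg x hx)) (Eventually.of_forall fun i => key i y hy)
  set δ := min R (ε * R / 8) with hδ
  have hδ0 : 0 < δ := by positivity
  refine ⟨ball x δ, mem_nhdsWithin_of_mem_nhds (ball_mem_nhds x hδ0), ?_⟩
  filter_upwards [Metric.tendsto_nhds.1 (hg x hx) (ε / 4) (by positivity)] with i hi y hy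
  have hyR : y ∈ ball x R := ball_subset_ball (min_le_left _ _) hy
  have hyd : dist y x ≤ ε * R / 8 := (mem_ball.1 hy).le.trans (min_le_right _ _)
  have hb : 2 / R * dist y x ≤ ε / 4 := by
    calc 2 / R * dist y x ≤ 2 / R * (ε * R / 8) := by gcongr
      _ = ε / 4 := by field_simp; norm_num
  have h1 := (key i y hyR).trans hb
  have h2 := (key' y hyR).trans hb
  have h3 := dist_triangle4 (g y) (g x) (F i x) (F i y)
  rw [dist_comm (g x), dist_comm (F i x) (F i y)] at h3
  linarith

/-- **Hurwitz's theorem**: a locally uniform limit of injective holomorphic functions which is not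
constant is injective. -/
theorem injOn_of_tendstoLocallyUniformlyOn {ι : Type*} {l : Filter ι} [l.NeBot]
    {U : Set ℂ} (hU : IsOpen U) (hUc : IsPreconnected U) {F : ι → ℂ → ℂ} {g : ℂ → ℂ}
    (hF : ∀ i, DifferentiableOn ℂ (F i) U) (hinj : ∀ i, InjOn (F i) U)
    (hg : TendstoLocallyUniformlyOn F g l U) {z₀ : ℂ} (hz₀ : z₀ ∈ U) (hd : deriv g z₀ ≠ 0) :
    InjOn g U := by
  intro a ha b hb hab
  by_contra hne
  have hgd : DifferentiableOn ℂ g U := hg.differentiableOn (Eventually.of_forall hF) hU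
  have hGa : AnalyticOnNhd ℂ (fun z => g z - g a) U :=
    (hgd.sub_const _).analyticOnNhd hU
  have hev : ∀ᶠ z in 𝓝[≠] b, g z - g a ≠ 0 := by
    rcases (hGa b hb).eventually_eq_zero_or_eventually_ne_zero with h | h
    · exfalso
      have h0 := hGa.eqOn_zero_of_preconnected_of_eventuallyEq_zero hUc hb h
      apply hd
      have : g =ᶠ[𝓝 z₀] fun _ => g a := by
        filter_upwards [hU.mem_nhds hz₀] with z hz
        have := h0 hz
        simpa [sub_eq_zero] using this
      rw [this.deriv_eq]; simp
    · exact h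
  have hev2 : ∀ᶠ z in 𝓝 b, z ≠ b → g z - g a ≠ 0 := by
    rwa [eventually_nhdsWithin_iff] at hev
  have hev3 : ∀ᶠ z in 𝓝 b, (z ≠ b → g z - g a ≠ 0) ∧ z ∈ U ∧ z ≠ a :=
    hev2.and ((hU.eventually_mem hb).and (eventually_ne_nhds (Ne.symm hne)))
  obtain ⟨r, hr, hrs⟩ := Metric.nhds_basis_closedBall.eventually_iff.1 hev3
  have hcU : closedBall b r ⊆ U := fun z hz => (hrs hz).2.1
  have hcs : ContinuousOn (fun z => ‖g z - g a‖) (sphere b r) :=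
    ((hgd.continuousOn.mono (sphere_subset_closedBall.trans hcU)).sub continuousOn_const).norm
  obtain ⟨m, hm, hmin⟩ := (isCompact_sphere b r).exists_isMinOn
    (NormedSpace.sphere_nonempty.2 hr.le) hcs
  set ε := ‖g m - g a‖ with hε
  have hε0 : 0 < ε := by
    rw [hε, norm_pos_iff]
    refine (hrs (sphere_subset_closedBall hm)).1 ?_
    rintro rfl
    simp at hm; linarith
  have hunif : TendstoUniformlyOn F g l (closedBall b r) :=
    (tendstoLocallyUniformlyOn_iff_forall_isCompact hU).1 hg _ hcU (isCompact_closedBall b r)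
  have e1 := Metric.tendstoUniformlyOn_iff.1 hunif (ε / 4) (by positivity)
  have e2 := Metric.tendsto_nhds.1 (hg.tendsto_at ha) (ε / 4) (by positivity)
  obtain ⟨i, hi1, hi2⟩ := (e1.and e2).exists
  have hnz : ∀ z ∈ closedBall b r, F i z - F i a ≠ 0 := by
    intro z hz h
    exact (hrs hz).2.2 (hinj i (hcU hz) ha (sub_eq_zero.1 h))
  have hdiff : DifferentiableOn ℂ (fun z => (F i z - F i a)⁻¹) (closedBall b r) :=
    (((hF i).mono hcU).sub_const _).inv hnz
  have hsph : ∀ z ∈ frontier (ball b r), ‖(F i z - F i a)⁻¹‖ ≤ (ε / 2)⁻¹ := by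
    intro z hz
    rw [frontier_ball b hr.ne'] at hz
    rw [norm_inv]
    refine inv_anti₀ (by positivity) ?_
    have h1 : ε ≤ ‖g z - g a‖ := hmin hz
    have h2 := hi1 z (sphere_subset_closedBall hz)
    rw [dist_eq_norm] at h2 hi2
    have h3 : ‖g z - g a‖ ≤ ‖g z - F i z‖ + ‖F i z - F i a‖ + ‖F i a - g a‖ := by
      have : g z - g a = (g z - F i z) + (F i z - F i a) + (F i a - g a) := by ring
      rw [this]; exact norm_add₃_le
    linarith
  have hdc : DiffContOnCl ℂ (fun z => (F i z - F i a)⁻¹) (ball b r) := by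
    apply DifferentiableOn.diffContOnCl
    rwa [closure_ball b hr.ne']
  have hfin := Complex.norm_le_of_forall_mem_frontier_norm_le isBounded_ball hdc hsph
    (subset_closure (mem_ball_self hr))
  rw [norm_inv] at hfin
  have hpos : 0 < ‖F i b - F i a‖ := norm_pos_iff.2 (hnz b (mem_closedBall_self hr.le))
  have h4 : ε / 2 ≤ ‖F i b - F i a‖ := (inv_le_inv₀ hpos (by positivity)).1 hfin
  have h2 := hi1 b (mem_closedBall_self hr.le)
  rw [dist_eq_norm] at h2 hi2
  have h5 : ‖F i b - F i a‖ ≤ ‖g b - F i b‖ + ‖F i a - g a‖ := by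
    have : F i b - F i a = -(g b - F i b) - (F i a - g a) := by rw [hab]; ring
    rw [this]
    exact (norm_sub_le _ _).trans (by rw [norm_neg])
  linarith

end RiemannMapping

section RiemannMapping

open Filter Topology Metric ComplexConjugate

/-- The disc automorphism moving `w` to `0`. -/
noncomputable def discMobius (w z : ℂ) : ℂ := (z - w) / (1 - conj w * z)

theorem discMobius_denom_ne_zero {w z : ℂ} (hw : ‖w‖ < 1) (hz : ‖z‖ < 1) :
    1 - conj w * z ≠ 0 := by
  intro h
  have h1 : conj w * z = 1 := (sub_eq_zero.1 h).symm
  have h2 : ‖w‖ * ‖z‖ = 1 := by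
    rw [← RCLike.norm_conj w, ← norm_mul, h1, norm_one]
  nlinarith [norm_nonneg w, norm_nonneg z]

theorem norm_discMobius_lt_one {w z : ℂ} (hw : ‖w‖ < 1) (hz : ‖z‖ < 1) :
    ‖discMobius w z‖ < 1 := by
  have hd := discMobius_denom_ne_zero hw hz
  rw [discMobius, norm_div, div_lt_one (norm_pos_iff.2 hd)]
  have key : ‖1 - conj w * z‖ ^ 2 - ‖z - w‖ ^ 2 = (1 - ‖z‖ ^ 2) * (1 - ‖w‖ ^ 2) := by
    simp only [Complex.sq_norm, Complex.normSq_apply, Complex.sub_re, Complex.sub_im,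
      Complex.mul_re, Complex.mul_im, Complex.conj_re, Complex.conj_im, Complex.one_re,
      Complex.one_im]
    ring
  have h1 : 0 < 1 - ‖z‖ ^ 2 := by nlinarith [norm_nonneg z]
  have h2 : 0 < 1 - ‖w‖ ^ 2 := by nlinarith [norm_nonneg w]
  have h3 := mul_pos h1 h2
  exact lt_of_pow_lt_pow_left₀ 2 (norm_nonneg _) (by linarith)

theorem discMobius_self (w : ℂ) : discMobius w w = 0 := by simp [discMobius]

theorem hasDerivAt_discMobius {w z : ℂ} (hw : ‖w‖ < 1) (hz : ‖z‖ < 1) :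
    HasDerivAt (discMobius w) ((1 - conj w * w) / (1 - conj w * z) ^ 2) z := by
  have hd := discMobius_denom_ne_zero hw hz
  have h1 : HasDerivAt (fun z : ℂ => z - w) 1 z := (hasDerivAt_id z).sub_const w
  have h2 : HasDerivAt (fun z : ℂ => 1 - conj w * z) (-(conj w * 1)) z :=
    ((hasDerivAt_id z).const_mul (conj w)).const_sub 1
  exact (h1.div h2 hd).congr_deriv (by congr 1; ring)

theorem discMobius_injOn {w : ℂ} (hw : ‖w‖ < 1) : InjOn (discMobius w) (ball 0 1) := by
  intro z hz u hu h
  rw [mem_ball_zero_iff] at hz hu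
  rw [discMobius, discMobius, div_eq_div_iff (discMobius_denom_ne_zero hw hz)
    (discMobius_denom_ne_zero hw hu)] at h
  have h2 : (z - u) * (1 - conj w * w) = 0 := by linear_combination h
  exact sub_eq_zero.1 ((mul_eq_zero.1 h2).resolve_right (discMobius_denom_ne_zero hw hw))

theorem differentiableOn_sqrt {U : Set ℂ} (hU : IsOpen U) {f g : ℂ → ℂ}
    (hg : DifferentiableOn ℂ g U) (hf : ContinuousOn f U) (hfg : ∀ z, f z ^ 2 = g z)
    (h0 : ∀ z ∈ U, g z ≠ 0) : DifferentiableOn ℂ f U := by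
  intro z hz
  have hz0 : f z ≠ 0 := fun h => h0 z hz (by rw [← hfg, h]; ring)
  have hgd := (hg.differentiableAt (hU.mem_nhds hz)).hasDerivAt
  have hfc := hf.continuousAt (hU.mem_nhds hz)
  have : HasDerivAt f (deriv g z / (f z + f z)) z := by
    rw [hasDerivAt_iff_tendsto_slope] at hgd ⊢
    have hsum : Tendsto (fun y => f y + f z) (𝓝[≠] z) (𝓝 (f z + f z)) :=
      (hfc.tendsto.mono_left nhdsWithin_le_nhds).add_const _
    have hnz : f z + f z ≠ 0 := by rw [← two_mul]; exact mul_ne_zero two_ne_zero hz0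
    refine (hgd.div hsum hnz).congr' ?_
    filter_upwards [hsum.eventually_ne hnz, self_mem_nhdsWithin] with y hy hyz
    have hyz' : y - z ≠ 0 := sub_ne_zero.2 hyz
    simp only [slope_def_field, Pi.div_apply, ← hfg]
    field_simp
    ring
  exact this.differentiableAt.differentiableWithinAt

theorem isOpen_image_of_injOn {U : Set ℂ} (hU : IsOpen U) {f : ℂ → ℂ}
    (hf : DifferentiableOn ℂ f U) (hinj : InjOn f U) : IsOpen (f '' U) := by
  rw [isOpen_iff_mem_nhds]
  rintro _ ⟨z, hz, rfl⟩
  rcases (hf.analyticAt (hU.mem_nhds hz)).eventually_constant_or_nhds_le_map_nhds with h | h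
  · exfalso
    obtain ⟨r, hr, hrs⟩ := Metric.nhds_basis_ball.eventually_iff.1 (h.and (hU.eventually_mem hz))
    have hy : z + ((r / 2 : ℝ) : ℂ) ∈ ball z r := by
      simp [abs_of_pos hr, hr]
    have h2 := hinj (hrs hy).2 hz (hrs hy).1
    simp at h2
    linarith
  · exact h (image_mem_map (hU.mem_nhds hz))

/-- The inverse of an injective holomorphic map is holomorphic. -/
theorem exists_differentiableOn_leftInverse {U : Set ℂ} (hU : IsOpen U) {f : ℂ → ℂ}
    (hf : DifferentiableOn ℂ f U) (hinj : InjOn f U) :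
    ∃ g : ℂ → ℂ, DifferentiableOn ℂ g (f '' U) ∧ LeftInvOn g f U := by
  refine ⟨Function.invFunOn f U, ?_, hinj.leftInvOn_invFunOn⟩
  set g := Function.invFunOn f U with hg
  have hli : LeftInvOn g f U := hinj.leftInvOn_invFunOn
  have hopen : ∀ V ⊆ U, IsOpen V → IsOpen (f '' V) := fun V hVU hV =>
    isOpen_image_of_injOn hV (hf.mono hVU) (hinj.mono hVU)
  have hcont : ∀ z ∈ U, ContinuousAt g (f z) := by
    intro z hz
    rw [ContinuousAt, hli hz]
    intro V hV
    obtain ⟨W, hWV, hWo, hzW⟩ := _root_.mem_nhds_iff.1 (inter_mem hV (hU.mem_nhds hz))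
    refine mem_map.2 (mem_of_superset ((hopen W (fun x hx => (hWV hx).2) hWo).mem_nhds
      (mem_image_of_mem f hzW)) ?_)
    rintro _ ⟨y, hy, rfl⟩
    rw [mem_preimage, hli (hWV hy).2]
    exact (hWV hy).1
  have hright : ∀ z ∈ U, ∀ᶠ y in 𝓝 (f z), f (g y) = y := by
    intro z hz
    filter_upwards [(hopen U subset_rfl hU).mem_nhds (mem_image_of_mem f hz)]
    rintro _ ⟨y, hy, rfl⟩
    rw [hli hy]
  have hreg : ∀ z ∈ U, deriv f z ≠ 0 → DifferentiableAt ℂ g (f z) := by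
    intro z hz h
    refine (HasDerivAt.of_local_left_inverse (hcont z hz) (f := f) (f' := deriv f z) ?_ h
      (hright z hz)).differentiableAt
    rw [hli hz]
    exact (hf.differentiableAt (hU.mem_nhds hz)).hasDerivAt
  rintro _ ⟨z, hz, rfl⟩
  refine DifferentiableAt.differentiableWithinAt ?_
  have hda : AnalyticAt ℂ (deriv f) z := (hf.analyticAt (hU.mem_nhds hz)).deriv
  refine AnalyticAt.differentiableAt ?_
  refine Complex.analyticAt_of_differentiable_on_punctured_nhds_of_continuousAt ?_ (hcont z hz)
  have hne : ∀ᶠ y in 𝓝[≠] z, deriv f y ≠ 0 := by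
    rcases hda.eventually_eq_zero_or_eventually_ne_zero with h | h
    · exfalso
      obtain ⟨r, hr, hrs⟩ := Metric.nhds_basis_ball.eventually_iff.1
        (h.and (hU.eventually_mem hz))
      have hy : z + ((r / 2 : ℝ) : ℂ) ∈ ball z r := by
        simp [abs_of_pos hr, hr]
      have h2 := (convex_ball z r).is_const_of_fderivWithin_eq_zero (𝕜 := ℂ) (f := f)
        (hf.mono fun y hy => (hrs hy).2) ?_ hy (mem_ball_self hr)
      · have h3 := hinj (hrs hy).2 hz h2
        simp at h3
        linarith
      · intro y hy
        rw [fderivWithin_of_isOpen isOpen_ball hy, ← toSpanSingleton_deriv, (hrs hy).1]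
        simp
    · exact h
  have htend : Tendsto g (𝓝[≠] (f z)) (𝓝[≠] z) := by
    refine tendsto_nhdsWithin_iff.2 ⟨?_, ?_⟩
    · have := hcont z hz
      rw [ContinuousAt, hli hz] at this
      exact this.mono_left nhdsWithin_le_nhds
    · have h1 := (hright z hz).filter_mono (nhdsWithin_le_nhds (s := {f z}ᶜ))
      filter_upwards [h1, self_mem_nhdsWithin] with y hy hy2 h
      rw [mem_singleton_iff] at h
      exact hy2 (by rw [mem_singleton_iff, ← hy, h])
  have hU' : ∀ᶠ y in 𝓝[≠] (f z), y ∈ f '' U :=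
    ((hopen U subset_rfl hU).eventually_mem (mem_image_of_mem f hz)).filter_mono
      nhdsWithin_le_nhds
  filter_upwards [htend.eventually hne, hU'] with y hy hyU
  obtain ⟨x, hx, rfl⟩ := hyU
  rw [hli hx] at hy
  exact hreg x hx hy

end RiemannMapping

section RiemannMapping

open Filter Topology Metric ComplexConjugate

/-- Univalent maps of `U` into the unit disc vanishing at `z₀`. -/
structure IsDiscUnivalent (U : Set ℂ) (z₀ : ℂ) (f : ℂ → ℂ) : Prop where
  diff : DifferentiableOn ℂ f U
  inj : InjOn f U
  maps : MapsTo f U (ball 0 1)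
  map_base : f z₀ = 0

theorem exists_isDiscUnivalent_maximal {U : Set ℂ} (hU : IsOpen U) (hUc : IsPreconnected U)
    (hb : U ⊆ ball 0 1) {z₀ : ℂ} (hz₀ : z₀ ∈ U) :
    ∃ φ, IsDiscUnivalent U z₀ φ ∧ deriv φ z₀ ≠ 0 ∧
      ∀ f, IsDiscUnivalent U z₀ f → ‖deriv f z₀‖ ≤ ‖deriv φ z₀‖ := by
  set D : Set ℝ := {t | ∃ f, IsDiscUnivalent U z₀ f ∧ ‖deriv f z₀‖ = t} with hD
  have hbase : (1 / 2 : ℝ) ∈ D := by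
    refine ⟨fun z => (z - z₀) / 2, ⟨by fun_prop, ?_, ?_, by simp⟩, ?_⟩
    · intro x _ y _ h
      simpa using h
    · intro z hz
      have h1 := mem_ball_zero_iff.1 (hb hz)
      have h2 := mem_ball_zero_iff.1 (hb hz₀)
      rw [mem_ball_zero_iff, norm_div]
      have := norm_sub_le z z₀
      simp only [Complex.norm_ofNat]
      linarith
    · have : HasDerivAt (fun z : ℂ => (z - z₀) / 2) (1 / 2) z₀ :=
        ((hasDerivAt_id z₀).sub_const z₀).div_const 2
      rw [this.deriv]; simp
  have hbdd : BddAbove D := by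
    obtain ⟨R, hR, hRU⟩ := Metric.isOpen_iff.1 hU z₀ hz₀
    refine ⟨1 / R, ?_⟩
    rintro _ ⟨f, hf, rfl⟩
    refine Complex.norm_deriv_le_div_of_mapsTo_ball (hf.diff.mono hRU) ?_ hR
    rw [hf.map_base]
    exact fun z hz => ball_subset_closedBall (hf.maps (hRU hz))
  have hpos : 0 < sSup D := lt_of_lt_of_le (by norm_num) (le_csSup hbdd hbase)
  obtain ⟨u, -, hu, huD⟩ := exists_seq_tendsto_sSup ⟨_, hbase⟩ hbdd
  choose F hF hFu using huD
  let l : Ultrafilter ℕ := Filter.hyperfilter ℕ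
  have hl : (l : Filter ℕ) ≤ atTop := by
    rw [← Nat.cofinite_eq_atTop]; exact Filter.hyperfilter_le_cofinite
  have hlim : ∀ z, ∃ w, z ∈ U → Tendsto (fun n => F n z) l (𝓝 w) := by
    intro z
    by_cases hz : z ∈ U
    · have hmem : (l.map fun n => F n z : Filter ℂ) ≤ 𝓟 (closedBall 0 1) := by
        rw [le_principal_iff, Ultrafilter.coe_map, mem_map]
        exact Filter.univ_mem' fun n => ball_subset_closedBall ((hF n).maps hz)
      obtain ⟨w, -, hw⟩ := (isCompact_closedBall (0 : ℂ) 1).ultrafilter_le_nhds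
        (l.map fun n => F n z) hmem
      exact ⟨w, fun _ => hw⟩
    · exact ⟨0, fun h => absurd h hz⟩
  choose g hg using hlim
  have hloc : TendstoLocallyUniformlyOn F g l U :=
    tendstoLocallyUniformlyOn_of_mapsTo_closedBall hU (fun n => (hF n).diff)
      (fun n z hz => ball_subset_closedBall ((hF n).maps hz)) hg
  have hgd : DifferentiableOn ℂ g U :=
    hloc.differentiableOn (Eventually.of_forall fun n => (hF n).diff) hU
  have hder : ‖deriv g z₀‖ = sSup D := by
    have h1 := (hloc.deriv (Eventually.of_forall fun n => (hF n).diff) hU).tendsto_at hz₀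
    have h2 : Tendsto u l (𝓝 ‖deriv g z₀‖) := by
      refine h1.norm.congr fun n => ?_
      simp only [Function.comp]
      exact hFu n
    exact tendsto_nhds_unique h2 (hu.mono_left hl)
  have hne : deriv g z₀ ≠ 0 := by
    rw [← norm_pos_iff, hder]; exact hpos
  have hinj : InjOn g U := injOn_of_tendstoLocallyUniformlyOn hU hUc (fun n => (hF n).diff)
    (fun n => (hF n).inj) hloc hz₀ hne
  have hcl : g '' U ⊆ closedBall 0 1 := by
    rintro _ ⟨z, hz, rfl⟩
    exact isClosed_closedBall.mem_of_tendsto (hg z hz)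
      (Eventually.of_forall fun n => ball_subset_closedBall ((hF n).maps hz))
  have hmaps : MapsTo g U (ball 0 1) := by
    intro z hz
    rw [← interior_closedBall (0 : ℂ) one_ne_zero]
    exact interior_maximal hcl (isOpen_image_of_injOn hU hgd hinj) (mem_image_of_mem g hz)
  refine ⟨g, ⟨hgd, hinj, hmaps, ?_⟩, hne, ?_⟩
  · refine tendsto_nhds_unique (hg z₀ hz₀) ?_
    refine tendsto_const_nhds.congr fun n => (hF n).map_base.symm
  · intro f hf
    rw [hder]
    exact le_csSup hbdd ⟨f, hf, rfl⟩

theorem surjOn_of_isDiscUnivalent_maximal {U : Set ℂ} (hU : IsOpen U)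
    (hUc : IsSimplyConnected U) {z₀ : ℂ} (hz₀ : z₀ ∈ U) {φ : ℂ → ℂ}
    (hφ : IsDiscUnivalent U z₀ φ) (hne : deriv φ z₀ ≠ 0)
    (hmax : ∀ f, IsDiscUnivalent U z₀ f → ‖deriv f z₀‖ ≤ ‖deriv φ z₀‖) :
    SurjOn φ U (ball 0 1) := by
  intro w hw
  by_contra hwn
  have hw1 : ‖w‖ < 1 := mem_ball_zero_iff.1 hw
  have hφ1 : ∀ z ∈ U, ‖φ z‖ < 1 := fun z hz => mem_ball_zero_iff.1 (hφ.maps hz)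
  set k : ℂ → ℂ := fun z => discMobius w (φ z) with hk
  have hkd : DifferentiableOn ℂ k U := fun z hz =>
    ((hasDerivAt_discMobius hw1 (hφ1 z hz)).differentiableAt.comp z
      (hφ.diff.differentiableAt (hU.mem_nhds hz))).differentiableWithinAt
  have hk0 : ∀ z ∈ U, k z ≠ 0 := by
    intro z hz h
    rw [hk] at h
    rcases div_eq_zero_iff.1 h with h | h
    · exact hwn ⟨z, hz, sub_eq_zero.1 h⟩
    · exact discMobius_denom_ne_zero hw1 (hφ1 z hz) h
  obtain ⟨s, hsc, hs⟩ := Complex.exists_continuousOn_pow_eq hUc hU hkd.continuousOn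
    (by rintro ⟨z, hz, h⟩; exact hk0 z hz h) two_ne_zero
  have hsd := differentiableOn_sqrt hU hkd hsc hs hk0
  have hs1 : ∀ z ∈ U, ‖s z‖ < 1 := by
    intro z hz
    have h1 : ‖s z‖ ^ 2 < 1 := by
      rw [← norm_pow, hs]; exact norm_discMobius_lt_one hw1 (hφ1 z hz)
    nlinarith [norm_nonneg (s z)]
  have hsinj : InjOn s U := by
    intro x hx y hy h
    have h2 : k x = k y := by rw [← hs, ← hs, h]
    exact hφ.inj hx hy (discMobius_injOn hw1 (hφ.maps hx) (hφ.maps hy) h2)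
  set b := s z₀ with hb
  have hb1 : ‖b‖ < 1 := hs1 z₀ hz₀
  have hb0 : b ≠ 0 := by
    intro h
    exact hk0 z₀ hz₀ (by rw [← hs, ← hb, h]; ring)
  have hcand : IsDiscUnivalent U z₀ (fun z => discMobius b (s z)) := by
    refine ⟨fun z hz => ?_, ?_, ?_, discMobius_self b⟩
    · exact ((hasDerivAt_discMobius hb1 (hs1 z hz)).differentiableAt.comp z
        (hsd.differentiableAt (hU.mem_nhds hz))).differentiableWithinAt
    · intro x hx y hy h
      exact hsinj hx hy (discMobius_injOn hb1 (mem_ball_zero_iff.2 (hs1 x hx))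
        (mem_ball_zero_iff.2 (hs1 y hy)) h)
    · intro z hz
      exact mem_ball_zero_iff.2 (norm_discMobius_lt_one hb1 (hs1 z hz))
  have hsder := (hsd.differentiableAt (hU.mem_nhds hz₀)).hasDerivAt
  have hφder := (hφ.diff.differentiableAt (hU.mem_nhds hz₀)).hasDerivAt
  have hcder := (hasDerivAt_discMobius hb1 hb1).comp z₀ hsder
  have hkder := (hasDerivAt_discMobius hw1 (hφ1 z₀ hz₀)).comp z₀ hφder
  have hsqder := hsder.pow 2
  have heq : 2 * b * deriv s z₀ = (1 - conj w * w) * deriv φ z₀ := by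
    have h1 : HasDerivAt k (2 * b * deriv s z₀) z₀ := by
      refine (hsqder.congr_of_eventuallyEq (f₁ := k) ?_).congr_deriv (by simp [hb])
      exact Eventually.of_forall fun z => (hs z).symm
    have h2 := h1.unique hkder
    rw [h2, hφ.map_base]; simp
  have hwb : ‖w‖ = ‖b‖ ^ 2 := by
    rw [← norm_pow, hb, hs, hk]
    simp [discMobius, hφ.map_base]
  have hineq := hmax _ hcand
  have hc : deriv (fun z => discMobius b (s z)) z₀ =
      (1 - conj b * b) / (1 - conj b * b) ^ 2 * deriv s z₀ := hcder.deriv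
  rw [hc] at hineq
  have hcb : ∀ c : ℂ, 1 - conj c * c = ((1 - ‖c‖ ^ 2 : ℝ) : ℂ) := by
    intro c; rw [mul_comm, Complex.mul_conj, Complex.normSq_eq_norm_sq]; push_cast; ring
  have hB : 0 < 1 - ‖b‖ ^ 2 := by nlinarith [norm_nonneg b]
  have hW : 0 < 1 - ‖w‖ ^ 2 := by nlinarith [norm_nonneg w]
  rw [hcb, norm_mul, norm_div, norm_pow, Complex.norm_real, Real.norm_of_nonneg hB.le] at hineq
  have heq2 := congrArg norm heq
  rw [hcb, norm_mul, norm_mul, norm_mul, Complex.norm_real, Real.norm_of_nonneg hW.le,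
    Complex.norm_ofNat, hwb] at heq2
  have hbp : 0 < ‖b‖ := norm_pos_iff.2 hb0
  have hφp : 0 < ‖deriv φ z₀‖ := norm_pos_iff.2 hne
  have h5 : ‖deriv s z₀‖ ≤ ‖deriv φ z₀‖ * (1 - ‖b‖ ^ 2) := by
    have : (1 - ‖b‖ ^ 2) / (1 - ‖b‖ ^ 2) ^ 2 * ‖deriv s z₀‖ =
        ‖deriv s z₀‖ / (1 - ‖b‖ ^ 2) := by field_simp
    rw [this, div_le_iff₀ hB] at hineq
    exact hineq
  have h6 : (1 - ‖b‖ ^ 2) * ((1 + ‖b‖ ^ 2) * ‖deriv φ z₀‖) ≤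
      (1 - ‖b‖ ^ 2) * (2 * ‖b‖ * ‖deriv φ z₀‖) := by
    have h7 := mul_le_mul_of_nonneg_left h5 (by positivity : 0 ≤ 2 * ‖b‖)
    nlinarith
  have h8 := le_of_mul_le_mul_left h6 hB
  have h9 := le_of_mul_le_mul_right h8 hφp
  nlinarith [mul_self_pos.2 (sub_ne_zero.2 hb1.ne)]

/-- **Riemann mapping theorem** for subdomains of the unit disc. -/
theorem exists_riemannMap {U : Set ℂ} (hU : IsOpen U) (hUc : IsSimplyConnected U)
    (hb : U ⊆ ball 0 1) :
    ∃ φ ψ : ℂ → ℂ, DifferentiableOn ℂ φ U ∧ DifferentiableOn ℂ ψ (ball 0 1) ∧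
      MapsTo φ U (ball 0 1) ∧ MapsTo ψ (ball 0 1) U ∧ LeftInvOn ψ φ U ∧
      LeftInvOn φ ψ (ball 0 1) := by
  obtain ⟨z₀, hz₀⟩ := hUc.nonempty
  obtain ⟨φ, hφ, hne, hmax⟩ := exists_isDiscUnivalent_maximal hU
    hUc.isPathConnected.isConnected.isPreconnected hb hz₀
  have hsurj := surjOn_of_isDiscUnivalent_maximal hU hUc hz₀ hφ hne hmax
  have himg : φ '' U = ball 0 1 := Subset.antisymm hφ.maps.image_subset hsurj
  obtain ⟨ψ, hψ, hl⟩ := exists_differentiableOn_leftInverse hU hφ.diff hφ.inj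
  rw [himg] at hψ
  refine ⟨φ, ψ, hφ.diff, hψ, hφ.maps, ?_, hl, ?_⟩
  · intro w hw
    obtain ⟨z, hz, rfl⟩ := hsurj hw
    rwa [hl hz]
  · intro w hw
    obtain ⟨z, hz, rfl⟩ := hsurj hw
    rw [hl hz]

end RiemannMapping

section LengthArea

open Filter Topology Metric MeasureTheory ENNReal

theorem lintegral_norm_deriv_sq_eq_volume_image {U : Set ℂ} (hU : IsOpen U) {f : ℂ → ℂ}
    (hf : DifferentiableOn ℂ f U) (hinj : InjOn f U) :
    ∫⁻ z in U, ENNReal.ofReal (‖deriv f z‖ ^ 2) = volume (f '' U) := by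
  have hdet : ∀ c : ℂ, |((ContinuousLinearMap.toSpanSingleton ℂ c).restrictScalars ℝ).det| =
      ‖c‖ ^ 2 := by
    intro c
    have h1 : ((ContinuousLinearMap.toSpanSingleton ℂ c).restrictScalars ℝ).det =
        LinearMap.det (Algebra.lmul ℝ ℂ c) := by
      rw [ContinuousLinearMap.det]
      congr 1
      ext z
      simp [mul_comm]
    rw [h1, ← Algebra.norm_apply, Algebra.norm_complex_apply, Complex.normSq_eq_norm_sq,
      abs_of_nonneg (by positivity)]
  rw [← lintegral_abs_det_fderiv_eq_addHaar_image volume hU.measurableSet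
    (f' := fun z => (ContinuousLinearMap.toSpanSingleton ℂ (deriv f z)).restrictScalars ℝ) ?_ hinj]
  · simp_rw [hdet]
  · intro z hz
    have h := (hf.differentiableAt (hU.mem_nhds hz)).hasDerivAt.hasFDerivAt
    exact (h.restrictScalars ℝ).hasFDerivWithinAt

/-- The length of the image of the circle of radius `r` about `q` under `f`, counting only the
part of the circle in `U`. -/
noncomputable def circleImageLength (U : Set ℂ) (f : ℂ → ℂ) (q : ℂ) (r : ℝ) : ℝ≥0∞ :=
  ∫⁻ θ in Ioo (-Real.pi) Real.pi, ENNReal.ofReal r *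
    U.indicator (fun z => ENNReal.ofReal ‖deriv f z‖) (circleMap q r θ)

theorem lintegral_Ioo_ofReal_div_eq_top {c R : ℝ} (hc : 0 < c) (hR : 0 < R) :
    ∫⁻ r in Ioo 0 R, ENNReal.ofReal (c / r) = ⊤ := by
  by_contra h
  have hcr : IntegrableOn (fun r : ℝ => c / r) (Ioo 0 R) := by
    refine ⟨(by fun_prop : Measurable fun r : ℝ => c / r).aestronglyMeasurable, ?_⟩
    rw [hasFiniteIntegral_iff_ofReal]
    · exact lt_top_iff_ne_top.2 h
    · filter_upwards [ae_restrict_mem measurableSet_Ioo] with r hr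
      exact div_nonneg hc.le hr.1.le
  have h2 : IntervalIntegrable (fun r : ℝ => r⁻¹) volume 0 R := by
    rw [intervalIntegrable_iff_integrableOn_Ioo_of_le hR.le]
    have h3 : IntegrableOn (fun r : ℝ => c⁻¹ * (c / r)) (Ioo 0 R) := hcr.const_mul c⁻¹
    refine h3.congr_fun (fun r _ => ?_) measurableSet_Ioo
    change c⁻¹ * (c / r) = r⁻¹
    field_simp
  rw [intervalIntegrable_inv_iff] at h2
  rcases h2 with h2 | h2
  · exact hR.ne h2
  · exact h2 left_mem_uIcc

theorem exists_circleImageLength_lt {U : Set ℂ} (hU : IsOpen U) {f : ℂ → ℂ}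
    (hf : DifferentiableOn ℂ f U) (hinj : InjOn f U) (hb : f '' U ⊆ closedBall 0 1) (q : ℂ)
    {ε R : ℝ} (hε : 0 < ε) (hR : 0 < R) :
    ∃ r ∈ Ioo 0 R, circleImageLength U f q r < ENNReal.ofReal ε := by
  by_contra hcon
  push Not at hcon
  set G : ℂ → ℝ≥0∞ := U.indicator (fun z => ENNReal.ofReal (‖deriv f z‖ ^ 2)) with hG
  have hGm : Measurable G :=
    (((measurable_deriv f).norm.pow_const 2).ennreal_ofReal).indicator hU.measurableSet
  have hfin : ∫⁻ z, G z < ⊤ := by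
    rw [hG, lintegral_indicator hU.measurableSet,
      lintegral_norm_deriv_sq_eq_volume_image hU hf hinj]
    exact (measure_mono hb).trans_lt measure_closedBall_lt_top
  have hcm : Measurable fun p : ℝ × ℝ => circleMap q p.1 p.2 := by
    have : Continuous fun p : ℝ × ℝ => circleMap q p.1 p.2 := by
      unfold circleMap; fun_prop
    exact this.measurable
  have hpolar : ∫⁻ z, G z = ∫⁻ r in Ioi (0 : ℝ), ∫⁻ θ in Ioo (-Real.pi) Real.pi,
      ENNReal.ofReal r * G (circleMap q r θ) := by
    rw [← lintegral_add_left_eq_self G q, ← Complex.lintegral_comp_polarCoord_symm,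
      polarCoord_target, Measure.volume_eq_prod, ← Measure.prod_restrict]
    have heq : ∀ p : ℝ × ℝ, ENNReal.ofReal p.1 • G (q + Complex.polarCoord.symm p) =
        ENNReal.ofReal p.1 * G (circleMap q p.1 p.2) := by
      intro p
      rw [Complex.polarCoord_symm_apply, smul_eq_mul, circleMap, Complex.exp_mul_I]
      simp
    simp_rw [heq]
    rw [lintegral_prod]
    exact ((measurable_fst.ennreal_ofReal).mul (hGm.comp hcm)).aemeasurable
  have hpi := Real.pi_pos
  set c : ℝ := ε ^ 2 / (4 * Real.pi ^ 2) with hc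
  have hlow : ∀ r ∈ Ioo 0 R, ENNReal.ofReal (c * Real.pi * 2 / r) ≤
      ∫⁻ θ in Ioo (-Real.pi) Real.pi, ENNReal.ofReal r * G (circleMap q r θ) := by
    intro r hr
    have hr0 := hr.1
    have h1 := hcon r hr
    set A := ∫⁻ θ in Ioo (-Real.pi) Real.pi, ENNReal.ofReal r * G (circleMap q r θ) with hA
    have hpt : ∀ θ : ℝ, ENNReal.ofReal r *
        U.indicator (fun z => ENNReal.ofReal ‖deriv f z‖) (circleMap q r θ) ≤
        ENNReal.ofReal (ε / (4 * Real.pi)) + ENNReal.ofReal (Real.pi / ε * r) *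
          (ENNReal.ofReal r * G (circleMap q r θ)) := by
      intro θ
      by_cases hz : circleMap q r θ ∈ U
      · rw [hG, indicator_of_mem hz, indicator_of_mem hz]
        set d := ‖deriv f (circleMap q r θ)‖
        have hd : 0 ≤ d := norm_nonneg _
        rw [← ENNReal.ofReal_mul hr0.le, ← ENNReal.ofReal_mul hr0.le, ← ENNReal.ofReal_mul
          (by positivity), ← ENNReal.ofReal_add (by positivity) (by positivity)]
        apply ENNReal.ofReal_le_ofReal
        have : ε / (4 * Real.pi) + Real.pi / ε * r * (r * d ^ 2) - r * d =
            Real.pi / ε * (r * d - ε / (2 * Real.pi)) ^ 2 := by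
          field_simp; ring
        have h2 : 0 ≤ Real.pi / ε * (r * d - ε / (2 * Real.pi)) ^ 2 := by positivity
        linarith
      · rw [indicator_of_notMem hz]; simp
    have h2 : circleImageLength U f q r ≤
        ENNReal.ofReal (ε / 2) + ENNReal.ofReal (Real.pi / ε * r) * A := by
      refine (lintegral_mono hpt).trans ?_
      rw [lintegral_add_left measurable_const, lintegral_const_mul', lintegral_const]
      · refine add_le_add (le_of_eq ?_) le_rfl
        rw [Measure.restrict_apply MeasurableSet.univ, univ_inter, Real.volume_Ioo,
          ← ENNReal.ofReal_mul (by positivity)]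
        congr 1
        field_simp; ring
      · exact ENNReal.ofReal_ne_top
    rcases eq_or_ne A ⊤ with hAt | hAt
    · rw [hAt]; exact le_top
    have h3 := h1.trans h2
    clear_value A
    lift A to NNReal using hAt
    rw [← ENNReal.ofReal_coe_nnreal] at h3 ⊢
    rw [← ENNReal.ofReal_mul (by positivity), ← ENNReal.ofReal_add (by positivity)
      (by positivity), ENNReal.ofReal_le_ofReal_iff (by positivity)] at h3
    apply ENNReal.ofReal_le_ofReal
    rw [div_le_iff₀ hr0]
    have h4 : ε / 2 ≤ Real.pi / ε * r * (A : ℝ) := by linarith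
    have h5 : ε / 2 * (ε / Real.pi) ≤ Real.pi / ε * r * (A : ℝ) * (ε / Real.pi) := by gcongr
    have h6 : Real.pi / ε * r * (A : ℝ) * (ε / Real.pi) = A * r := by field_simp
    have h7 : ε / 2 * (ε / Real.pi) = c * Real.pi * 2 := by rw [hc]; field_simp; ring
    linarith
  have htop : (⊤ : ℝ≥0∞) ≤ ∫⁻ z, G z := by
    rw [hpolar, ← lintegral_Ioo_ofReal_div_eq_top (c := c * Real.pi * 2) (by positivity) hR]
    calc _ ≤ ∫⁻ r in Ioo 0 R, ∫⁻ θ in Ioo (-Real.pi) Real.pi,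
            ENNReal.ofReal r * G (circleMap q r θ) :=
          setLIntegral_mono' measurableSet_Ioo hlow
      _ ≤ _ := lintegral_mono_set (fun r hr => hr.1)
  exact absurd hfin (not_lt.2 htop)

theorem volume_image_circle_le {U : Set ℂ} (hU : IsOpen U) {f : ℂ → ℂ}
    (hf : DifferentiableOn ℂ f U) (q : ℂ) {r : ℝ} (hr : 0 < r) (ℓ : ℂ →L[ℝ] ℝ)
    (hℓ : ∀ z, |ℓ z| ≤ ‖z‖) :
    volume (ℓ '' (f '' (U ∩ sphere q r))) ≤ circleImageLength U f q r := by
  set s : Set ℝ := Ioo (-Real.pi) Real.pi ∩ (circleMap q r) ⁻¹' U with hs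
  have hsm : MeasurableSet s :=
    measurableSet_Ioo.inter (hU.preimage (continuous_circleMap q r)).measurableSet
  have hsub : ℓ '' (f '' (U ∩ sphere q r)) ⊆
      (fun θ => ℓ (f (circleMap q r θ))) '' s ∪ {ℓ (f (circleMap q r Real.pi))} := by
    rintro _ ⟨_, ⟨z, ⟨hzU, hz⟩, rfl⟩, rfl⟩
    have : z ∈ circleMap q r '' Ioc (-Real.pi) Real.pi := by
      refine ⟨(z - q).arg, Complex.arg_mem_Ioc _, ?_⟩
      have h1 : ‖z - q‖ = r := by rwa [mem_sphere, dist_eq_norm] at hz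
      rw [circleMap, ← h1, Complex.norm_mul_exp_arg_mul_I]; ring
    obtain ⟨θ, hθ, rfl⟩ := this
    rcases eq_or_lt_of_le hθ.2 with h | h
    · right; rw [h]; rfl
    · left; exact ⟨θ, ⟨⟨hθ.1, h⟩, hzU⟩, rfl⟩
  set d : ℝ → ℝ := fun θ => ℓ (circleMap 0 r θ * Complex.I * deriv f (circleMap q r θ)) with hd
  have hder : ∀ θ ∈ s, HasDerivWithinAt (fun θ => ℓ (f (circleMap q r θ))) (d θ) s θ := by
    intro θ hθ
    have h1 := (hf.differentiableAt (hU.mem_nhds hθ.2)).hasDerivAt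
    have h2 := h1.scomp θ (hasDerivAt_circleMap q r θ)
    exact (ℓ.hasFDerivAt.comp_hasDerivAt θ h2).hasDerivWithinAt
  calc volume (ℓ '' (f '' (U ∩ sphere q r)))
      ≤ volume ((fun θ => ℓ (f (circleMap q r θ))) '' s) +
          volume {ℓ (f (circleMap q r Real.pi))} := (measure_mono hsub).trans (measure_union_le _ _)
    _ = volume ((fun θ => ℓ (f (circleMap q r θ))) '' s) := by simp
    _ ≤ ∫⁻ θ in s, ENNReal.ofReal |(ContinuousLinearMap.toSpanSingleton ℝ (d θ)).det| :=
        addHaar_image_le_lintegral_abs_det_fderiv volume hsm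
          (fun θ hθ => (hder θ hθ).hasFDerivWithinAt)
    _ = ∫⁻ θ in s, ENNReal.ofReal |d θ| := by
        simp
    _ ≤ ∫⁻ θ in s, ENNReal.ofReal r *
          U.indicator (fun z => ENNReal.ofReal ‖deriv f z‖) (circleMap q r θ) := by
        refine setLIntegral_mono' hsm fun θ hθ => ?_
        rw [indicator_of_mem (show circleMap q r θ ∈ U from hθ.2), ← ENNReal.ofReal_mul hr.le]
        apply ENNReal.ofReal_le_ofReal
        refine (hℓ _).trans (le_of_eq ?_)
        rw [norm_mul, norm_mul, norm_circleMap_zero, Complex.norm_I, abs_of_pos hr, mul_one]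
    _ ≤ _ := lintegral_mono_set inter_subset_left

/-- The **length–area principle**. -/
theorem exists_volume_image_circle_lt {U : Set ℂ} (hU : IsOpen U) {f : ℂ → ℂ}
    (hf : DifferentiableOn ℂ f U) (hinj : InjOn f U) (hb : f '' U ⊆ closedBall 0 1) (q : ℂ)
    {ε R : ℝ} (hε : 0 < ε) (hR : 0 < R) :
    ∃ r ∈ Ioo 0 R, volume (Complex.re '' (f '' (U ∩ sphere q r))) < ENNReal.ofReal ε ∧
      volume (Complex.im '' (f '' (U ∩ sphere q r))) < ENNReal.ofReal ε := by
  obtain ⟨r, hr, hlt⟩ := exists_circleImageLength_lt hU hf hinj hb q hε hR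
  exact ⟨r, hr, (volume_image_circle_le hU hf q hr.1 Complex.reCLM Complex.abs_re_le_norm).trans_lt
    hlt, (volume_image_circle_le hU hf q hr.1 Complex.imCLM Complex.abs_im_le_norm).trans_lt hlt⟩

end LengthArea

section Caratheodory

open Filter Topology Metric MeasureTheory

theorem IsPreconnected.exists_mem_sphere {X : Type*} [PseudoMetricSpace X] {S : Set X}
    (hS : IsPreconnected S) {q x y : X} {r : ℝ} (hx : x ∈ S) (hy : y ∈ S) (hxr : dist x q ≤ r)
    (hyr : r ≤ dist y q) : ∃ z ∈ S, dist z q = r :=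
  hS.intermediate_value hx hy (f := fun z => dist z q) (by fun_prop) ⟨hxr, hyr⟩

theorem exists_notMem_Ioo_of_volume_lt {S : Set ℝ} {ε : ℝ} (h : volume S < ENNReal.ofReal ε)
    {a b : ℝ} (hab : ε ≤ b - a) : ∃ t ∈ Ioo a b, t ∉ S := by
  by_contra hcon
  push Not at hcon
  have h1 : volume (Ioo a b) ≤ volume S := measure_mono hcon
  rw [Real.volume_Ioo] at h1
  exact absurd ((ENNReal.ofReal_le_ofReal hab).trans h1) (not_le.2 h)

theorem IsPreconnected.sub_lt_of_volume_lt {S : Set ℝ} (hS : IsPreconnected S) {ε : ℝ}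
    (h : volume S < ENNReal.ofReal ε) {a b : ℝ} (ha : a ∈ S) (hb : b ∈ S) : b - a < ε := by
  by_contra hcon
  obtain ⟨t, ht, htS⟩ := exists_notMem_Ioo_of_volume_lt h (not_lt.1 hcon)
  exact htS (hS.Icc_subset ha hb (Ioo_subset_Icc_self ht))

/-- A pair of mutually inverse conformal maps between `U` and the unit disc. -/
structure IsRiemannPair (U : Set ℂ) (φ ψ : ℂ → ℂ) : Prop where
  diff : DifferentiableOn ℂ φ U
  diff_symm : DifferentiableOn ℂ ψ (ball 0 1)
  maps : MapsTo φ U (ball 0 1)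
  maps_symm : MapsTo ψ (ball 0 1) U
  left_inv : LeftInvOn ψ φ U
  right_inv : LeftInvOn φ ψ (ball 0 1)

theorem IsRiemannPair.rotate {U : Set ℂ} {φ ψ : ℂ → ℂ} (h : IsRiemannPair U φ ψ) :
    IsRiemannPair U (fun z => -Complex.I * φ z) (fun w => ψ (Complex.I * w)) := by
  have hI : MapsTo (fun w => Complex.I * w) (ball (0 : ℂ) 1) (ball 0 1) := by
    intro w hw
    simpa using hw
  refine ⟨h.diff.const_mul _, ?_, ?_, ?_, ?_, ?_⟩
  · exact h.diff_symm.comp (by fun_prop) hI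
  · intro z hz
    simpa using h.maps hz
  · exact fun w hw => h.maps_symm (hI hw)
  · intro z hz
    simp only
    rw [← mul_assoc, mul_neg, Complex.I_mul_I, neg_neg, one_mul, h.left_inv hz]
  · intro w hw
    simp only
    rw [h.right_inv (hI hw), ← mul_assoc, neg_mul, Complex.I_mul_I, neg_neg, one_mul]

theorem IsRiemannPair.re_sub_le {U : Set ℂ} {φ ψ : ℂ → ℂ} (h : IsRiemannPair U φ ψ) {q : ℂ}
    {r ε : ℝ} (hε : 0 < ε) (hε2 : ε < 1 / 2)
    (hK : ∀ w ∈ closedBall (0 : ℂ) (1 / 2), r ≤ dist (ψ w) q)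
    (hre : ∀ a b : ℝ, ε ≤ b - a → ∃ t ∈ Ioo a b, t ∉ Complex.re '' (φ '' (U ∩ sphere q r)))
    (him : ∀ a b : ℝ, ε ≤ b - a → ∃ t ∈ Ioo a b, t ∉ Complex.im '' (φ '' (U ∩ sphere q r)))
    {V : Set ℂ} (hV : IsPreconnected V) (hVU : V ⊆ U ∩ ball q r) {x y : ℂ} (hx : x ∈ V)
    (hy : y ∈ V) : (φ y).re - (φ x).re ≤ 4 * ε := by
  by_contra hcon
  push Not at hcon
  have hnorm : ∀ z ∈ V, ‖φ z‖ < 1 := fun z hz => mem_ball_zero_iff.1 (h.maps (hVU hz).1)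
  have hxr := abs_lt.1 ((Complex.abs_re_le_norm _).trans_lt (hnorm x hx))
  have hyr := abs_lt.1 ((Complex.abs_re_le_norm _).trans_lt (hnorm y hy))
  obtain ⟨x₀, hx₀, hx₀E⟩ := hre (max (φ x).re (-1 + ε)) (min (φ y).re (1 - ε)) (by
    rcases max_cases (φ x).re (-1 + ε) with ⟨e1, _⟩ | ⟨e1, _⟩ <;>
    rcases min_cases (φ y).re (1 - ε) with ⟨e2, _⟩ | ⟨e2, _⟩ <;> rw [e1, e2] <;> linarith)
  obtain ⟨y₀, hy₀, hy₀E⟩ := him (-ε) ε (by linarith)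
  have hx1 : (φ x).re < x₀ := (le_max_left _ _).trans_lt hx₀.1
  have hx2 : -1 + ε < x₀ := (le_max_right _ _).trans_lt hx₀.1
  have hx3 : x₀ < (φ y).re := hx₀.2.trans_le (min_le_left _ _)
  have hx4 : x₀ < 1 - ε := hx₀.2.trans_le (min_le_right _ _)
  have hφc : ContinuousOn φ V := h.diff.continuousOn.mono fun z hz => (hVU hz).1
  obtain ⟨v, hv, hvx⟩ := hV.intermediate_value hx hy (f := fun z => (φ z).re)
    (Complex.continuous_re.comp_continuousOn hφc) ⟨hx1.le, hx3.le⟩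
  have c1 : Convex ℝ {w : ℂ | w ∈ ball (0 : ℂ) 1 ∧ w.re = x₀} :=
    (convex_ball 0 1).inter (convex_hyperplane (f := Complex.re) Complex.reLm.isLinear x₀)
  have c2 : Convex ℝ {w : ℂ | w ∈ ball (0 : ℂ) 1 ∧ w.im = y₀} :=
    (convex_ball 0 1).inter (convex_hyperplane (f := Complex.im) Complex.imLm.isLinear y₀)
  have hcorner : (⟨x₀, y₀⟩ : ℂ) ∈ ball (0 : ℂ) 1 := by
    rw [mem_ball_zero_iff]
    have h1 : ‖(⟨x₀, y₀⟩ : ℂ)‖ ^ 2 = x₀ * x₀ + y₀ * y₀ := by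
      rw [Complex.sq_norm, Complex.normSq_mk]
    nlinarith [hy₀.1, hy₀.2, norm_nonneg (⟨x₀, y₀⟩ : ℂ)]
  have hT : IsPreconnected ({w : ℂ | w ∈ ball (0 : ℂ) 1 ∧ w.re = x₀} ∪
      {w : ℂ | w ∈ ball (0 : ℂ) 1 ∧ w.im = y₀}) :=
    c1.isPreconnected.union ⟨x₀, y₀⟩ ⟨hcorner, rfl⟩ ⟨hcorner, rfl⟩ c2.isPreconnected
  set T := {w : ℂ | w ∈ ball (0 : ℂ) 1 ∧ w.re = x₀} ∪ {w : ℂ | w ∈ ball (0 : ℂ) 1 ∧ w.im = y₀}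
  have hTb : T ⊆ ball 0 1 := by rintro w (hw | hw) <;> exact hw.1
  have hψT : IsPreconnected (ψ '' T) := hT.image ψ (h.diff_symm.continuousOn.mono hTb)
  have hvT : v ∈ ψ '' T := ⟨φ v, Or.inl ⟨h.maps (hVU hv).1, hvx⟩, h.left_inv (hVU hv).1⟩
  have hy₀n : ‖(⟨0, y₀⟩ : ℂ)‖ ≤ 1 / 2 := by
    have h1 : ‖(⟨0, y₀⟩ : ℂ)‖ ^ 2 = y₀ * y₀ := by
      rw [Complex.sq_norm, Complex.normSq_mk]; ring
    nlinarith [hy₀.1, hy₀.2, norm_nonneg (⟨0, y₀⟩ : ℂ)]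
  have hwT : ψ ⟨0, y₀⟩ ∈ ψ '' T :=
    ⟨⟨0, y₀⟩, Or.inr ⟨mem_ball_zero_iff.2 (by linarith), rfl⟩, rfl⟩
  obtain ⟨z, ⟨w, hw, rfl⟩, hz⟩ := hψT.exists_mem_sphere hvT hwT (mem_ball.1 (hVU hv).2).le
    (hK _ (mem_closedBall_zero_iff.2 hy₀n))
  have hwE : w ∈ φ '' (U ∩ sphere q r) := ⟨ψ w, ⟨h.maps_symm (hTb hw), hz⟩, h.right_inv (hTb hw)⟩
  rcases hw with hw | hw
  · exact hx₀E ⟨w, hwE, hw.2⟩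
  · exact hy₀E ⟨w, hwE, hw.2⟩

theorem IsRiemannPair.exists_dist_le {U : Set ℂ} (hU : IsOpen U) {φ ψ : ℂ → ℂ}
    (h : IsRiemannPair U φ ψ) {q : ℂ} (hq : q ∉ U) {ε : ℝ} (hε : 0 < ε) :
    ∃ r > 0, ∀ V, IsPreconnected V → V ⊆ U ∩ ball q r → ∀ x ∈ V, ∀ y ∈ V,
      dist (φ x) (φ y) ≤ ε := by
  set δ := min (ε / 8) (1 / 4) with hδ
  have hδ0 : 0 < δ := by positivity
  have hδ1 : δ ≤ ε / 8 := min_le_left _ _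
  have hδ2 : δ < 1 / 2 := (min_le_right _ _).trans_lt (by norm_num)
  have hsub : closedBall (0 : ℂ) (1 / 2) ⊆ ball 0 1 := closedBall_subset_ball (by norm_num)
  have hKc : IsCompact (ψ '' closedBall (0 : ℂ) (1 / 2)) :=
    (isCompact_closedBall 0 _).image_of_continuousOn (h.diff_symm.continuousOn.mono hsub)
  have hqK : q ∉ ψ '' closedBall (0 : ℂ) (1 / 2) := by
    rintro ⟨w, hw, rfl⟩
    exact hq (h.maps_symm (hsub hw))
  obtain ⟨R, hR, hRK⟩ := Metric.isOpen_iff.1 hKc.isClosed.isOpen_compl q hqK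
  obtain ⟨r, hr, hre, him⟩ := exists_volume_image_circle_lt hU h.diff h.left_inv.injOn
    (h.maps.image_subset.trans ball_subset_closedBall) q hδ0 hR
  have hK : ∀ w ∈ closedBall (0 : ℂ) (1 / 2), r ≤ dist (ψ w) q := by
    intro w hw
    by_contra hc
    exact hRK (mem_ball.2 ((not_le.1 hc).trans hr.2)) (mem_image_of_mem ψ hw)
  have hre' : ∀ a b : ℝ, δ ≤ b - a →
      ∃ t ∈ Ioo a b, t ∉ Complex.re '' (φ '' (U ∩ sphere q r)) := fun a b hab =>
    exists_notMem_Ioo_of_volume_lt hre hab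
  have him' : ∀ a b : ℝ, δ ≤ b - a →
      ∃ t ∈ Ioo a b, t ∉ Complex.im '' (φ '' (U ∩ sphere q r)) := fun a b hab =>
    exists_notMem_Ioo_of_volume_lt him hab
  refine ⟨r, hr.1, fun V hV hVU => ?_⟩
  have A : ∀ x ∈ V, ∀ y ∈ V, (φ y).re - (φ x).re ≤ 4 * δ := fun x hx y hy =>
    h.re_sub_le hδ0 hδ2 hK hre' him' hV hVU hx hy
  have B : ∀ x ∈ V, ∀ y ∈ V, (φ y).im - (φ x).im ≤ 4 * δ := by
    intro x hx y hy
    have := h.rotate.re_sub_le (q := q) (r := r) hδ0 hδ2 ?_ ?_ ?_ hV hVU hx hy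
    · simpa using this
    · intro w hw
      exact hK _ (by simpa using hw)
    · intro a b hab
      obtain ⟨t, ht, htE⟩ := him' a b hab
      refine ⟨t, ht, ?_⟩
      rintro ⟨_, ⟨z, hz, rfl⟩, rfl⟩
      exact htE ⟨φ z, mem_image_of_mem φ hz, by simp⟩
    · intro a b hab
      obtain ⟨t, ht, htE⟩ := hre' (-b) (-a) (by linarith)
      refine ⟨-t, ⟨by linarith [ht.2], by linarith [ht.1]⟩, ?_⟩
      rintro ⟨_, ⟨z, hz, rfl⟩, hzt⟩
      refine htE ⟨φ z, mem_image_of_mem φ hz, ?_⟩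
      simpa using hzt
  intro x hx y hy
  have h1 := A x hx y hy
  have h2 := A y hy x hx
  have h3 := B x hx y hy
  have h4 := B y hy x hx
  rw [dist_eq_norm]
  refine (Complex.norm_le_abs_re_add_abs_im _).trans ?_
  have h5 : |(φ x - φ y).re| ≤ 4 * δ := by rw [Complex.sub_re, abs_le]; constructor <;> linarith
  have h6 : |(φ x - φ y).im| ≤ 4 * δ := by rw [Complex.sub_im, abs_le]; constructor <;> linarith
  linarith

theorem isPreconnected_ball_inter_sphere {ζ : ℂ} (hζ : ‖ζ‖ = 1) {r : ℝ} (hr : 0 < r)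
    (hr2 : r < 2) :
    IsPreconnected (ball (0 : ℂ) 1 ∩ sphere ζ r) := by
  set α := Real.arccos (r / 2)
  have hcosα : Real.cos α = r / 2 := Real.cos_arccos (by linarith) (by linarith)
  have hnorm : ∀ u : ℂ, ‖u‖ = 1 → (‖ζ - r * ζ * u‖ < 1 ↔ r / 2 < u.re) := by
    intro u hu
    have h1 : ζ - r * ζ * u = ζ * (1 - r * u) := by ring
    rw [h1, norm_mul, hζ, one_mul]
    have h2 : ‖1 - r * u‖ ^ 2 = 1 - 2 * r * u.re + r ^ 2 := by
      have h3 : u.re * u.re + u.im * u.im = 1 := by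
        rw [← Complex.normSq_apply, Complex.normSq_eq_norm_sq, hu]; norm_num
      rw [Complex.sq_norm, Complex.normSq_apply]
      simp
      linear_combination r ^ 2 * h3
    constructor
    · intro h
      have : ‖1 - r * u‖ ^ 2 < 1 := by nlinarith [norm_nonneg (1 - r * u)]
      nlinarith
    · intro h
      have : ‖1 - r * u‖ ^ 2 < 1 := by nlinarith
      nlinarith [norm_nonneg (1 - r * u)]
  have himg : ball (0 : ℂ) 1 ∩ sphere ζ r =
      (fun θ : ℝ => ζ - r * ζ * Complex.exp (θ * Complex.I)) '' Ioo (-α) α := by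
    ext w
    constructor
    · rintro ⟨hw, hws⟩
      have hζ0 : ζ ≠ 0 := by rw [← norm_pos_iff, hζ]; norm_num
      have hr0 : (r : ℂ) ≠ 0 := Complex.ofReal_ne_zero.2 hr.ne'
      set u := (ζ - w) / (r * ζ) with hu
      have hw' : w = ζ - r * ζ * u := by rw [hu]; field_simp; ring
      have hu1 : ‖u‖ = 1 := by
        rw [mem_sphere', dist_eq_norm] at hws
        rw [hu, norm_div, norm_mul, hws, hζ, Complex.norm_real, Real.norm_of_nonneg hr.le]
        field_simp
      have hexp : Complex.exp (u.arg * Complex.I) = u := by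
        have := Complex.norm_mul_exp_arg_mul_I u
        rwa [hu1, Complex.ofReal_one, one_mul] at this
      refine ⟨u.arg, ?_, ?_⟩
      · rw [mem_Ioo, ← abs_lt]
        by_contra hcon
        have h1 := Real.cos_le_cos_of_nonneg_of_le_pi (Real.arccos_nonneg _)
          (Complex.abs_arg_le_pi u) (not_lt.1 hcon)
        rw [Real.cos_abs, hcosα] at h1
        have h2 : Real.cos u.arg = u.re := by
          rw [← hexp, Complex.exp_ofReal_mul_I_re, hexp]
        rw [mem_ball_zero_iff, hw', hnorm u hu1] at hw
        linarith
      · simp only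
        rw [hexp]; exact hw'.symm
    · rintro ⟨θ, hθ, rfl⟩
      refine ⟨?_, ?_⟩
      · rw [mem_ball_zero_iff, hnorm _ (Complex.norm_exp_ofReal_mul_I θ),
          Complex.exp_ofReal_mul_I_re, ← hcosα, ← Real.cos_abs θ]
        exact Real.cos_lt_cos_of_nonneg_of_le_pi (abs_nonneg _) (Real.arccos_le_pi _)
          (abs_lt.2 hθ)
      · rw [mem_sphere, dist_eq_norm]
        simp [hζ, abs_of_pos hr, Complex.norm_exp_ofReal_mul_I]
  rw [himg]
  exact isPreconnected_Ioo.image _ (by fun_prop)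

/-- Uniform local connectedness of `U` at its frontier points. -/
def LocallyConnectedAtFrontier (U : Set ℂ) : Prop :=
  ∀ q ∈ closure U \ U, ∀ r > 0, ∃ s > 0, ∃ V, IsPreconnected V ∧ V ⊆ U ∩ ball q r ∧
    U ∩ ball q s ⊆ V

theorem IsRiemannPair.exists_tendsto {U : Set ℂ} (hU : IsOpen U) {φ ψ : ℂ → ℂ}
    (h : IsRiemannPair U φ ψ) (hlc : LocallyConnectedAtFrontier U) {q : ℂ} (hq : q ∈ closure U) :
    ∃ y, Tendsto φ (𝓝[U] q) (𝓝 y) := by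
  by_cases hqU : q ∈ U
  · exact ⟨φ q, h.diff.continuousOn q hqU⟩
  have hne : (𝓝[U] q).NeBot := mem_closure_iff_nhdsWithin_neBot.1 hq
  refine cauchy_map_iff_exists_tendsto.1 ?_
  rw [Metric.cauchy_iff]
  refine ⟨hne.map φ, fun ε hε => ?_⟩
  obtain ⟨r, hr, hV⟩ := h.exists_dist_le hU hqU (half_pos hε)
  obtain ⟨s, hs, V, hVc, hVr, hVs⟩ := hlc q ⟨hq, hqU⟩ r hr
  refine ⟨φ '' V, image_mem_map (mem_of_superset ?_ hVs), ?_⟩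
  · exact inter_mem self_mem_nhdsWithin (mem_nhdsWithin_of_mem_nhds (ball_mem_nhds q hs))
  · rintro _ ⟨x, hx, rfl⟩ _ ⟨y, hy, rfl⟩
    exact (hV V hVc hVr x hx y hy).trans_lt (half_lt_self hε)

theorem IsRiemannPair.eq_of_tendsto {U : Set ℂ} (hb : U ⊆ closedBall 0 1)
    {φ ψ : ℂ → ℂ} (h : IsRiemannPair U φ ψ) (hlc : LocallyConnectedAtFrontier U) {a b ζ : ℂ}
    (ha : a ∈ closure U \ U) (hbU : b ∈ closure U \ U) (hζ : ‖ζ‖ = 1)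
    (hta : Tendsto φ (𝓝[U] a) (𝓝 ζ)) (htb : Tendsto φ (𝓝[U] b) (𝓝 ζ)) : a = b := by
  by_contra hab
  set d := dist a b with hd
  have hd0 : 0 < d := dist_pos.2 hab
  obtain ⟨s, hs, V, hVc, hVr, hVs⟩ := hlc a ha (d / 4) (by positivity)
  obtain ⟨s', hs', W, hWc, hWr, hWs⟩ := hlc b hbU (d / 4) (by positivity)
  have near : ∀ c ∈ closure U \ U, Tendsto φ (𝓝[U] c) (𝓝 ζ) → ∀ s > 0, ∀ ρ > 0,
      ∃ z ∈ U ∩ ball c s, dist (φ z) ζ < ρ := by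
    intro c hc htc s hs ρ hρ
    have hne : (𝓝[U] c).NeBot := mem_closure_iff_nhdsWithin_neBot.1 hc.1
    have h1 : ∀ᶠ z in 𝓝[U] c, z ∈ ball c s :=
      mem_nhdsWithin_of_mem_nhds (ball_mem_nhds c hs)
    obtain ⟨z, hz1, hz2, hz3⟩ := ((eventually_mem_nhdsWithin (a := c) (s := U)).and
      (h1.and (htc.eventually (ball_mem_nhds ζ hρ)))).exists
    exact ⟨z, ⟨hz1, hz2⟩, hz3⟩
  obtain ⟨za, hza, -⟩ := near a ha hta s hs 1 one_pos
  obtain ⟨zb, hzb, -⟩ := near b hbU htb s' hs' 1 one_pos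
  have hpos : ∀ z ∈ U, 0 < dist (φ z) ζ := by
    intro z hz
    refine dist_pos.2 fun heq => ?_
    have := mem_ball_zero_iff.1 (h.maps hz)
    rw [heq, hζ] at this
    exact lt_irrefl _ this
  set ρ := min (min (dist (φ za) ζ) (dist (φ zb) ζ)) 2 with hρ
  have hρ0 : 0 < ρ := lt_min (lt_min (hpos _ hza.1) (hpos _ hzb.1)) two_pos
  obtain ⟨r, hr, hre, him⟩ := exists_volume_image_circle_lt isOpen_ball h.diff_symm
    h.right_inv.injOn (h.maps_symm.image_subset.trans hb) ζ (ε := d / 8) (by positivity) hρ0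
  set Γ := ψ '' (ball 0 1 ∩ sphere ζ r) with hΓ
  have hΓc : IsPreconnected Γ :=
    (isPreconnected_ball_inter_sphere hζ hr.1 (hr.2.trans_le (min_le_right _ _))).image _
      (h.diff_symm.continuousOn.mono inter_subset_left)
  have hdiam : ∀ x ∈ Γ, ∀ y ∈ Γ, dist x y ≤ d / 4 := by
    intro x hx y hy
    have hrc := hΓc.image Complex.re Complex.continuous_re.continuousOn
    have hic := hΓc.image Complex.im Complex.continuous_im.continuousOn
    have h1 := hrc.sub_lt_of_volume_lt hre (mem_image_of_mem _ hx) (mem_image_of_mem _ hy)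
    have h2 := hrc.sub_lt_of_volume_lt hre (mem_image_of_mem _ hy) (mem_image_of_mem _ hx)
    have h3 := hic.sub_lt_of_volume_lt him (mem_image_of_mem _ hx) (mem_image_of_mem _ hy)
    have h4 := hic.sub_lt_of_volume_lt him (mem_image_of_mem _ hy) (mem_image_of_mem _ hx)
    rw [dist_eq_norm]
    refine (Complex.norm_le_abs_re_add_abs_im _).trans ?_
    have h5 : |(x - y).re| ≤ d / 8 := by rw [Complex.sub_re, abs_le]; constructor <;> linarith
    have h6 : |(x - y).im| ≤ d / 8 := by rw [Complex.sub_im, abs_le]; constructor <;> linarith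
    linarith
  have meet : ∀ c ∈ closure U \ U, Tendsto φ (𝓝[U] c) (𝓝 ζ) → ∀ s > 0, ∀ V, IsPreconnected V →
      V ⊆ U → U ∩ ball c s ⊆ V → ∀ z ∈ V, r < dist (φ z) ζ → ∃ x ∈ V, x ∈ Γ := by
    intro c hc htc s hs V hVc hVU hVs z hz hzr
    obtain ⟨z', hz', hzr'⟩ := near c hc htc s hs r hr.1
    have hφV : IsPreconnected (φ '' V) := hVc.image φ (h.diff.continuousOn.mono hVU)
    obtain ⟨_, ⟨v, hv, rfl⟩, hvr⟩ := hφV.exists_mem_sphere (mem_image_of_mem φ (hVs hz'))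
      (mem_image_of_mem φ hz) hzr'.le hzr.le
    exact ⟨v, hv, φ v, ⟨h.maps (hVU hv), hvr⟩, h.left_inv (hVU hv)⟩
  obtain ⟨x, hxV, hxΓ⟩ := meet a ha hta s hs V hVc (fun z hz => (hVr hz).1) hVs za (hVs hza)
    (hr.2.trans_le ((min_le_left _ _).trans (min_le_left _ _)))
  obtain ⟨y, hyW, hyΓ⟩ := meet b hbU htb s' hs' W hWc (fun z hz => (hWr hz).1) hWs zb (hWs hzb)
    (hr.2.trans_le ((min_le_left _ _).trans (min_le_right _ _)))
  have h1 := hdiam x hxΓ y hyΓ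
  have h2 := mem_ball'.1 (hVr hxV).2
  have h3 := mem_ball.1 (hWr hyW).2
  have h4 := dist_triangle4 a x y b
  linarith

/-- **Carathéodory's theorem**: a simply connected domain that is uniformly locally connected at
its frontier has closure homeomorphic to the closed disc. -/
theorem exists_bijOn_closure_closedBall {U : Set ℂ} (hU : IsOpen U) (hUc : IsSimplyConnected U)
    (hb : U ⊆ ball 0 1) (hlc : LocallyConnectedAtFrontier U) :
    ∃ Φ : ℂ → ℂ, ContinuousOn Φ (closure U) ∧ BijOn Φ (closure U) (closedBall 0 1) ∧
      ∀ z ∈ closure U, (‖Φ z‖ < 1 ↔ z ∈ U) := by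
  obtain ⟨φ, ψ, h1, h2, h3, h4, h5, h6⟩ := exists_riemannMap hU hUc hb
  have h : IsRiemannPair U φ ψ := ⟨h1, h2, h3, h4, h5, h6⟩
  set Φ := extendFrom U φ with hΦ
  have hlim : ∀ q ∈ closure U, Tendsto φ (𝓝[U] q) (𝓝 (Φ q)) := fun q hq =>
    tendsto_extendFrom (h.exists_tendsto hU hlc hq)
  have hcont : ContinuousOn Φ (closure U) :=
    continuousOn_extendFrom subset_rfl fun q hq => h.exists_tendsto hU hlc hq
  have heq : ∀ z ∈ U, Φ z = φ z := by
    intro z hz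
    have hne : (𝓝[U] z).NeBot := mem_closure_iff_nhdsWithin_neBot.1 (subset_closure hz)
    exact tendsto_nhds_unique (hlim z (subset_closure hz)) (h1.continuousOn z hz)
  have hle : ∀ z ∈ closure U, ‖Φ z‖ ≤ 1 := by
    intro z hz
    have hne : (𝓝[U] z).NeBot := mem_closure_iff_nhdsWithin_neBot.1 hz
    refine le_of_tendsto (hlim z hz).norm ?_
    filter_upwards [self_mem_nhdsWithin] with x hx
    exact (mem_ball_zero_iff.1 (h3 hx)).le
  have hiff : ∀ z ∈ closure U, (‖Φ z‖ < 1 ↔ z ∈ U) := by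
    intro z hz
    constructor
    · intro hlt
      have hne : (𝓝[U] z).NeBot := mem_closure_iff_nhdsWithin_neBot.1 hz
      have hmem : Φ z ∈ ball (0 : ℂ) 1 := mem_ball_zero_iff.2 hlt
      have hc : ContinuousAt ψ (Φ z) := h2.continuousOn.continuousAt (isOpen_ball.mem_nhds hmem)
      have ht : Tendsto (fun x => ψ (φ x)) (𝓝[U] z) (𝓝 (ψ (Φ z))) := hc.tendsto.comp (hlim z hz)
      have ht2 : Tendsto (fun x => ψ (φ x)) (𝓝[U] z) (𝓝 z) := by
        refine (tendsto_nhdsWithin_of_tendsto_nhds tendsto_id).congr' ?_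
        filter_upwards [self_mem_nhdsWithin] with x hx
        exact (h5 hx).symm
      rw [tendsto_nhds_unique ht2 ht]
      exact h4 hmem
    · intro hzU
      rw [heq z hzU]
      exact mem_ball_zero_iff.1 (h3 hzU)
  refine ⟨Φ, hcont, ⟨fun z hz => mem_closedBall_zero_iff.2 (hle z hz), ?_, ?_⟩, hiff⟩
  · intro a ha b hbc hab
    by_cases haU : a ∈ U
    · have hbU : b ∈ U := (hiff b hbc).1 (hab ▸ (hiff a ha).2 haU)
      rw [heq a haU, heq b hbU] at hab
      exact h5.injOn haU hbU hab
    · have hbU : b ∉ U := fun hbU => haU ((hiff a ha).1 (hab ▸ (hiff b hbc).2 hbU))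
      refine h.eq_of_tendsto (hb.trans ball_subset_closedBall) hlc ⟨ha, haU⟩ ⟨hbc, hbU⟩
        (ζ := Φ a) ?_ (hlim a ha) (hab ▸ hlim b hbc)
      exact le_antisymm (hle a ha) (not_lt.1 fun hlt => haU ((hiff a ha).1 hlt))
  · have hcpt : IsCompact (closure U) :=
      (isBounded_ball.subset hb).isCompact_closure
    have hcl : IsClosed (Φ '' closure U) := (hcpt.image_of_continuousOn hcont).isClosed
    rw [SurjOn, ← closure_ball (0 : ℂ) one_ne_zero]
    refine closure_minimal ?_ hcl
    intro w hw
    exact ⟨ψ w, subset_closure (h4 hw), by rw [heq _ (h4 hw), h6 hw]⟩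

end Caratheodory

section RaySides

open Filter Topology Metric

theorem Complex.not_exists_continuousOn_sqrt :
    ¬ ∃ s : ℂ → ℂ, ContinuousOn s {0}ᶜ ∧ ∀ z ≠ 0, s z ^ 2 = z := by
  rintro ⟨s, hs, hsq⟩
  have hne : ∀ θ : ℝ, Complex.exp (θ * Complex.I) ∈ ({0}ᶜ : Set ℂ) := fun θ => Complex.exp_ne_zero _
  have h1 : Continuous fun θ : ℝ => s (Complex.exp (θ * Complex.I)) :=
    hs.comp_continuous (by fun_prop) hne
  have h2 : Continuous fun θ : ℝ => Complex.exp (θ / 2 * Complex.I) := by fun_prop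
  have h0 : s 1 ≠ 0 := fun h => by simpa [h] using hsq 1 one_ne_zero
  have h3 := isPreconnected_univ.eq_or_eq_neg_of_sq_eq h1.continuousOn h2.continuousOn
    (fun θ _ => by
      simp only [Pi.pow_apply]
      rw [hsq _ (hne θ), ← Complex.exp_nat_mul]
      congr 1; push_cast; ring) (fun _ => Complex.exp_ne_zero _)
  have hπ : Complex.exp ((2 * Real.pi : ℝ) / 2 * Complex.I) = -1 := by
    rw [← Complex.exp_pi_mul_I]; congr 1; push_cast; ring
  have h2π : Complex.exp ((2 * Real.pi : ℝ) * Complex.I) = 1 := by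
    rw [← Complex.exp_two_pi_mul_I]; push_cast; rfl
  rcases h3 with h3 | h3
  · have ha := h3 (mem_univ 0)
    have hb := h3 (mem_univ (2 * Real.pi))
    simp only [hπ, h2π] at hb
    simp [hb] at ha
    norm_num at ha
  · have ha := h3 (mem_univ 0)
    have hb := h3 (mem_univ (2 * Real.pi))
    simp only [Pi.neg_apply, hπ, h2π] at hb
    simp [hb] at ha
    norm_num at ha

theorem Complex.isSimplyConnected_slitPlane : IsSimplyConnected Complex.slitPlane := by
  have : ContractibleSpace Complex.slitPlane :=
    Complex.starConvex_one_slitPlane.contractibleSpace ⟨1, Complex.one_mem_slitPlane⟩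
  exact (SimplyConnectedSpace.ofContractible _ : SimplyConnectedSpace Complex.slitPlane)

/-- A continuous branch of the square root off a tame ray. -/
theorem exists_continuousOn_sqrt_compl_ray (e : ℂ ≃ₜ ℂ) (he : e 0 = 0) :
    ∃ s : ℂ → ℂ, ContinuousOn s {z | -e z ∈ Complex.slitPlane} ∧
      ∀ z, -e z ∈ Complex.slitPlane → s z ^ 2 = z := by
  obtain ⟨L, hLc, hL⟩ := Complex.exists_continuousOn_eqOn_exp_comp
    Complex.isSimplyConnected_slitPlane Complex.isOpen_slitPlane
    (g := fun w => e.symm (-w)) (by fun_prop) (by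
      rintro ⟨w, hw, h0⟩
      have : -w = 0 := by rw [← he, ← h0]; simp
      exact Complex.slitPlane_ne_zero hw (neg_eq_zero.1 this))
  refine ⟨fun z => Complex.exp (L (-e z) / 2), ?_, fun z hz => ?_⟩
  · refine Complex.continuous_exp.comp_continuousOn (ContinuousOn.div_const ?_ _)
    exact hLc.comp (by fun_prop) (fun z hz => hz)
  · have := hL hz
    simp only [Function.comp, neg_neg, Homeomorph.symm_apply_apply] at this
    rw [← Complex.exp_nat_mul]
    push_cast
    rw [mul_div_cancel₀ _ (two_ne_zero), this]

/-- A continuous branch of the square root off the positive imaginary axis. -/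
theorem exists_continuousOn_sqrt_lower :
    ∃ s : ℂ → ℂ, ContinuousOn s {z | Complex.I * z ∈ Complex.slitPlane} ∧
      ∀ z, Complex.I * z ∈ Complex.slitPlane → s z ^ 2 = z := by
  refine ⟨fun z => Complex.exp ((Complex.log (Complex.I * z) - Real.pi / 2 * Complex.I) / 2), ?_,
    fun z hz => ?_⟩
  · refine Complex.continuous_exp.comp_continuousOn (ContinuousOn.div_const ?_ _)
    have : ContinuousOn (fun z => Complex.log (Complex.I * z))
        {z | Complex.I * z ∈ Complex.slitPlane} :=
      ContinuousOn.clog (by fun_prop) fun z hz => hz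
    exact this.sub continuousOn_const
  · rw [← Complex.exp_nat_mul]
    push_cast
    rw [mul_div_cancel₀ _ (two_ne_zero), Complex.exp_sub,
      Complex.exp_log (Complex.slitPlane_ne_zero hz), Complex.exp_pi_div_two_mul_I]
    field_simp

/-- The open lower half plane. -/
def lowerHalf : Set ℂ := {z | z.im < 0}

theorem isOpen_lowerHalf : IsOpen lowerHalf := isOpen_lt Complex.continuous_im continuous_const

theorem convex_lowerHalf : Convex ℝ lowerHalf := convex_halfSpace_im_lt 0

/-- `e` straightens a ray that runs from the origin inside the open lower half plane. -/
structure IsLowerRay (e : ℂ ≃ₜ ℂ) : Prop where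
  zero : e 0 = 0
  mem : ∀ x : ℝ, 0 < x → e.symm x ∈ lowerHalf

/-- `D` and `E` are the two sides in the lower half plane of the ray straightened by `e`. -/
structure IsRaySides (e : ℂ ≃ₜ ℂ) (D E : Set ℂ) : Prop where
  isOpen_left : IsOpen D
  isOpen_right : IsOpen E
  disjoint : Disjoint D E
  left_subset : D ⊆ lowerHalf
  right_subset : E ⊆ lowerHalf
  notMem : ∀ x : ℝ, 0 < x → e.symm x ∉ D ∪ E
  cover : ∀ z ∈ lowerHalf, z ∈ D ∨ z ∈ E ∨ ∃ x : ℝ, 0 < x ∧ e.symm x = z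
  eventually_left : ∀ x : ℝ, 0 < x → ∀ᶠ w in 𝓝 (x : ℂ), 0 < w.im → e.symm w ∈ D
  eventually_right : ∀ x : ℝ, 0 < x → ∀ᶠ w in 𝓝 (x : ℂ), w.im < 0 → e.symm w ∈ E

/-- Follow a homeomorphism by complex conjugation. -/
noncomputable def Homeomorph.conj (e : ℂ ≃ₜ ℂ) : ℂ ≃ₜ ℂ :=
  e.trans Complex.conjCLE.toHomeomorph

@[simp] theorem Homeomorph.conj_apply (e : ℂ ≃ₜ ℂ) (z : ℂ) :
    e.conj z = (starRingEnd ℂ) (e z) := rfl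

@[simp] theorem Homeomorph.conj_symm_apply (e : ℂ ≃ₜ ℂ) (z : ℂ) :
    e.conj.symm z = e.symm ((starRingEnd ℂ) z) := rfl

theorem IsLowerRay.conj {e : ℂ ≃ₜ ℂ} (h : IsLowerRay e) : IsLowerRay e.conj :=
  ⟨by simp [h.zero], fun x hx => by simpa using h.mem x hx⟩

theorem IsRaySides.conj {e : ℂ ≃ₜ ℂ} {D E : Set ℂ} (h : IsRaySides e D E) :
    IsRaySides e.conj E D where
  isOpen_left := h.isOpen_right
  isOpen_right := h.isOpen_left
  disjoint := h.disjoint.symm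
  left_subset := h.right_subset
  right_subset := h.left_subset
  notMem x hx := by simpa [or_comm] using h.notMem x hx
  cover z hz := by
    rcases h.cover z hz with h | h | ⟨x, hx, h⟩
    exacts [Or.inr (Or.inl h), Or.inl h, Or.inr (Or.inr ⟨x, hx, by simpa using h⟩)]
  eventually_left x hx := by
    have ht : Tendsto (starRingEnd ℂ) (𝓝 (x : ℂ)) (𝓝 (x : ℂ)) := by
      simpa using Complex.continuous_conj.tendsto (x : ℂ)
    filter_upwards [ht.eventually (h.eventually_right x hx)] with w hw hp
    exact hw (by simpa using hp)
  eventually_right x hx := by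
    have ht : Tendsto (starRingEnd ℂ) (𝓝 (x : ℂ)) (𝓝 (x : ℂ)) := by
      simpa using Complex.continuous_conj.tendsto (x : ℂ)
    filter_upwards [ht.eventually (h.eventually_left x hx)] with w hw hp
    exact hw (by simpa using hp)

end RaySides

section RaySidesExist

open Filter Topology Metric

theorem isPreconnected_setOf_im_lt {δ : ℝ → ℝ} (hδ : Continuous δ) {J : Set ℝ}
    (hJ : J.OrdConnected) (hpos : ∀ x ∈ J, 0 < δ x) :
    IsPreconnected {w : ℂ | w.re ∈ J ∧ 0 < w.im ∧ w.im < δ w.re} := by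
  have h1 : IsPreconnected (J ×ˢ Ioo (0 : ℝ) 1) := hJ.isPreconnected.prod isPreconnected_Ioo
  have h2 := h1.image (fun p : ℝ × ℝ => (p.1 : ℂ) + (p.2 * δ p.1 : ℝ) * Complex.I)
    (by fun_prop)
  convert h2 using 1
  ext w
  simp only [mem_ofPred_eq, mem_image, Prod.exists, mem_prod, mem_Ioo]
  constructor
  · rintro ⟨hJw, h0, h1⟩
    have hp := hpos _ hJw
    refine ⟨w.re, w.im / δ w.re, ⟨hJw, div_pos h0 hp, (div_lt_one hp).2 h1⟩, ?_⟩
    rw [div_mul_cancel₀ _ hp.ne', Complex.re_add_im]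
  · rintro ⟨x, t, ⟨hx, h0, h1⟩, rfl⟩
    have hp := hpos _ hx
    simp only [Complex.add_re, Complex.ofReal_re, Complex.re_ofReal_mul, Complex.I_re, mul_zero,
      add_zero, Complex.add_im, Complex.ofReal_im, Complex.im_ofReal_mul, Complex.I_im, mul_one,
      zero_add]
    exact ⟨hx, by positivity, by nlinarith⟩

theorem neg_mem_slitPlane_iff {w : ℂ} :
    -w ∈ Complex.slitPlane ↔ ¬ ∃ x : ℝ, 0 ≤ x ∧ (x : ℂ) = w := by
  rw [Complex.mem_slitPlane_iff]
  simp only [Complex.neg_re, Complex.neg_im, ne_eq, neg_eq_zero, neg_pos]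
  constructor
  · rintro h ⟨x, hx, rfl⟩
    simp only [Complex.ofReal_re, Complex.ofReal_im, not_true_eq_false, or_false] at h
    linarith
  · intro h
    by_contra! hc
    exact h ⟨w.re, hc.1, Complex.ext rfl (by simp [hc.2])⟩

theorem IsLowerRay.neg_mem_slitPlane {e : ℂ ≃ₜ ℂ} (h : IsLowerRay e) {z : ℂ} (h0 : z ≠ 0)
    (hz : 0 ≤ z.im) : -e z ∈ Complex.slitPlane := by
  rw [neg_mem_slitPlane_iff]
  rintro ⟨x, hx, hxz⟩
  have hz' : e.symm x = z := by rw [hxz]; simp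
  rcases hx.eq_or_lt with rfl | hx
  · apply h0
    rw [← hz', e.symm_apply_eq, h.zero, Complex.ofReal_zero]
  · have := h.mem x hx
    rw [hz'] at this
    exact absurd hz (not_le.2 this)

theorem I_mul_mem_slitPlane {z : ℂ} (h0 : z ≠ 0) (hz : z.im ≤ 0) :
    Complex.I * z ∈ Complex.slitPlane := by
  rw [Complex.mem_slitPlane_iff]
  simp only [Complex.mul_re, Complex.I_re, zero_mul, Complex.I_im, one_mul, zero_sub,
    Complex.mul_im, zero_add]
  by_contra! hc
  exact h0 (Complex.ext hc.2 (le_antisymm hz (by simpa using hc.1)))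

theorem IsLowerRay.exists_sign {e : ℂ ≃ₜ ℂ} (h : IsLowerRay e) {s₁ s₂ : ℂ → ℂ}
    (hs₁ : ContinuousOn s₁ {z | -e z ∈ Complex.slitPlane})
    (hq₁ : ∀ z, -e z ∈ Complex.slitPlane → s₁ z ^ 2 = z)
    (hs₂ : ContinuousOn s₂ {z | Complex.I * z ∈ Complex.slitPlane})
    (hq₂ : ∀ z, Complex.I * z ∈ Complex.slitPlane → s₂ z ^ 2 = z) :
    ∃ ε : ℂ, (ε = 1 ∨ ε = -1) ∧ ∀ x : ℝ, 0 < x → ∀ᶠ w in 𝓝 (x : ℂ), 0 < w.im →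
      s₁ (e.symm w) = ε * s₂ (e.symm w) := by
  have hes : e.symm 0 = 0 := by rw [e.symm_apply_eq, h.zero]
  set O : Set ℂ := e.symm ⁻¹' lowerHalf with hO
  have hOo : IsOpen O := isOpen_lowerHalf.preimage e.symm.continuous
  have hne : (Oᶜ).Nonempty := ⟨0, by simp [hO, hes, lowerHalf]⟩
  set δ : ℝ → ℝ := fun x => infDist (x : ℂ) Oᶜ with hδdef
  have hδ : Continuous δ := (continuous_infDist_pt _).comp Complex.continuous_ofReal
  have hpos : ∀ x ∈ Ioi (0 : ℝ), 0 < δ x := fun x hx =>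
    (hOo.isClosed_compl.notMem_iff_infDist_pos hne).1 (fun hc => hc (h.mem x hx))
  have hN := isPreconnected_setOf_im_lt hδ ordConnected_Ioi hpos
  set N := {w : ℂ | w.re ∈ Ioi (0 : ℝ) ∧ 0 < w.im ∧ w.im < δ w.re} with hNdef
  have hNO : ∀ w ∈ N, e.symm w ∈ lowerHalf := by
    rintro w ⟨-, h0, h1⟩
    by_contra hc
    have := infDist_le_dist_of_mem (x := ((w.re : ℝ) : ℂ)) (show w ∈ Oᶜ from hc)
    have hd : dist ((w.re : ℝ) : ℂ) w = w.im := by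
      rw [Complex.dist_of_re_eq (by simp)]
      simp [Real.dist_eq, abs_of_pos h0]
    rw [hd] at this
    exact absurd h1 (not_lt.2 this)
  have hNs : ∀ w ∈ N, -e (e.symm w) ∈ Complex.slitPlane := by
    rintro w ⟨-, h0, -⟩
    rw [e.apply_symm_apply, Complex.mem_slitPlane_iff]
    right
    simpa using h0.ne'
  have hNi : ∀ w ∈ N, Complex.I * e.symm w ∈ Complex.slitPlane := fun w hw =>
    I_mul_mem_slitPlane (by rintro hc; simpa [hc, lowerHalf] using hNO w hw) (hNO w hw).le
  have hsign : ∃ ε : ℂ, (ε = 1 ∨ ε = -1) ∧ ∀ w ∈ N, s₁ (e.symm w) = ε * s₂ (e.symm w) := by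
    rcases hN.eq_or_eq_neg_of_sq_eq (f := s₁ ∘ e.symm) (g := s₂ ∘ e.symm)
      (hs₁.comp e.symm.continuous.continuousOn hNs) (hs₂.comp e.symm.continuous.continuousOn hNi)
      (fun w hw => by simp [hq₁ _ (hNs w hw), hq₂ _ (hNi w hw)])
      (fun {w} hw hc => by
        have h2 := hq₂ _ (hNi w hw)
        simp only [Function.comp] at hc
        rw [hc] at h2
        have h3 := hNO w hw
        rw [← h2] at h3
        simp [lowerHalf] at h3) with hh | hh
    · exact ⟨1, Or.inl rfl, fun w hw => by simpa using hh hw⟩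
    · exact ⟨-1, Or.inr rfl, fun w hw => by simpa using hh hw⟩
  obtain ⟨ε, hε, hs⟩ := hsign
  refine ⟨ε, hε, fun x hx => ?_⟩
  have hopen : IsOpen {w : ℂ | 0 < w.re ∧ w.im < δ w.re} :=
    (isOpen_lt continuous_const Complex.continuous_re).inter
      (isOpen_lt Complex.continuous_im (hδ.comp Complex.continuous_re))
  filter_upwards [hopen.mem_nhds (x := (x : ℂ)) (by simpa [hx] using hpos x hx)] with w hw h0
  exact hs w ⟨hw.1, h0, hw.2⟩

theorem eventually_eq_of_sq_eq {s₁ s₂ : ℂ → ℂ} {a : ℂ} (h₁ : ContinuousAt s₁ a)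
    (h₂ : ContinuousAt s₂ a) (h0 : s₁ a ≠ 0) (ha : s₁ a = s₂ a)
    (hsq : ∀ᶠ z in 𝓝 a, s₁ z ^ 2 = s₂ z ^ 2) : ∀ᶠ z in 𝓝 a, s₁ z = s₂ z := by
  have h3 : ∀ᶠ z in 𝓝 a, s₁ z + s₂ z ≠ 0 := by
    refine (h₁.add h₂).eventually_ne ?_
    change s₁ a + s₂ a ≠ 0
    rw [← ha, ← two_mul]
    exact mul_ne_zero two_ne_zero h0
  filter_upwards [h3, hsq] with z hz hz2
  rcases sq_eq_sq_iff_eq_or_eq_neg.1 hz2 with h | h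
  · exact h
  · exact absurd (by rw [h]; ring) hz

/-- A tame ray in the lower half plane has two sides, one along each half of the boundary. -/
theorem IsLowerRay.exists_isRaySides {e : ℂ ≃ₜ ℂ} (h : IsLowerRay e) :
    ∃ e' : ℂ ≃ₜ ℂ, (∀ x : ℝ, e'.symm x = e.symm x) ∧ IsLowerRay e' ∧ ∃ D E : Set ℂ,
      IsRaySides e' D E ∧
      (∀ a : ℝ, 0 < a → ∀ᶠ z in 𝓝 (a : ℂ), z ∈ lowerHalf → z ∈ D) ∧
      ∀ a : ℝ, a < 0 → ∀ᶠ z in 𝓝 (a : ℂ), z ∈ lowerHalf → z ∈ E := by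
  obtain ⟨s₁, hs₁, hq₁⟩ := exists_continuousOn_sqrt_compl_ray e h.zero
  obtain ⟨s₂, hs₂, hq₂⟩ := exists_continuousOn_sqrt_lower
  have hes : e.symm 0 = 0 := by rw [e.symm_apply_eq, h.zero]
  have hS₁ : IsOpen {z | -e z ∈ Complex.slitPlane} :=
    Complex.isOpen_slitPlane.preimage (by fun_prop : Continuous fun z => -e z)
  have hS₂ : IsOpen {z : ℂ | Complex.I * z ∈ Complex.slitPlane} :=
    Complex.isOpen_slitPlane.preimage (by fun_prop : Continuous fun z => Complex.I * z)
  have hlow0 : ∀ z ∈ lowerHalf, z ≠ 0 := by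
    rintro z hz rfl
    simp [lowerHalf] at hz
  have hlow : ∀ z ∈ lowerHalf, Complex.I * z ∈ Complex.slitPlane := fun z hz =>
    I_mul_mem_slitPlane (hlow0 z hz) (le_of_lt hz)
  have hsq : ∀ ε : ℂ, (ε = 1 ∨ ε = -1) → ε ^ 2 = 1 := by rintro ε (rfl | rfl) <;> norm_num
  have hray : ∀ z, z ≠ 0 → -e z ∉ Complex.slitPlane → ∃ x : ℝ, 0 < x ∧ e.symm x = z := by
    intro z hz hn
    rw [neg_mem_slitPlane_iff, not_not] at hn
    obtain ⟨x, hx, hxz⟩ := hn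
    refine ⟨x, lt_of_le_of_ne hx ?_, by rw [hxz, e.symm_apply_apply]⟩
    rintro rfl
    rw [Complex.ofReal_zero] at hxz
    exact hz (by rw [← e.symm_apply_apply z, ← hxz, hes])
  have hrayS : ∀ x : ℝ, 0 < x → -e (e.symm x) ∉ Complex.slitPlane := fun x hx => by
    rw [neg_mem_slitPlane_iff, not_not]
    exact ⟨x, hx.le, by simp⟩
  -- the two sides of the ray have different signs
  obtain ⟨ε, hε, hup⟩ := h.exists_sign hs₁ hq₁ hs₂ hq₂
  have hconj : ∀ z, -e.conj z ∈ Complex.slitPlane ↔ -e z ∈ Complex.slitPlane := fun z => by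
    simp [Complex.mem_slitPlane_iff]
  obtain ⟨ε', hε', hdown'⟩ := h.conj.exists_sign (by simpa only [hconj] using hs₁)
    (fun z hz => hq₁ z ((hconj z).1 hz)) hs₂ hq₂
  have hdown : ∀ x : ℝ, 0 < x → ∀ᶠ w in 𝓝 (x : ℂ), w.im < 0 →
      s₁ (e.symm w) = ε' * s₂ (e.symm w) := by
    intro x hx
    have ht : Tendsto (starRingEnd ℂ) (𝓝 (x : ℂ)) (𝓝 (x : ℂ)) := by
      simpa using Complex.continuous_conj.tendsto (x : ℂ)
    filter_upwards [ht.eventually (hdown' x hx)] with w hw hp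
    simpa using hw (by simpa using hp)
  have hεε' : ε' = -ε := by
    by_contra hne
    have hεε : ε' = ε := by rcases hε with rfl | rfl <;> rcases hε' with rfl | rfl <;> simp_all
    subst hεε
    classical
    refine Complex.not_exists_continuousOn_sqrt
      ⟨fun z => if -e z ∈ Complex.slitPlane then s₁ z else ε' * s₂ z, fun z hz => ?_,
        fun z hz => ?_⟩
    · refine ContinuousAt.continuousWithinAt ?_
      by_cases hzS : -e z ∈ Complex.slitPlane
      · refine (hs₁.continuousAt (hS₁.mem_nhds hzS)).congr ?_
        filter_upwards [hS₁.mem_nhds hzS] with y hy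
        exact (if_pos hy).symm
      · obtain ⟨x, hx, rfl⟩ := hray z hz hzS
        have hc := (hs₂.continuousAt (hS₂.mem_nhds (hlow _ (h.mem x hx)))).const_mul ε'
        refine hc.congr ?_
        have ht : Tendsto e (𝓝 (e.symm x)) (𝓝 (x : ℂ)) := by
          simpa using e.continuous.tendsto (e.symm x)
        have hre : {w : ℂ | 0 < w.re} ∈ 𝓝 (x : ℂ) :=
          (isOpen_lt continuous_const Complex.continuous_re).mem_nhds (by simpa using hx)
        filter_upwards [ht.eventually (hup x hx), ht.eventually (hdown x hx), ht hre]
          with y h1 h2 h4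
        split_ifs with hy
        · rcases lt_trichotomy (e y).im 0 with h3 | h3 | h3
          · simpa using (h2 h3).symm
          · rw [Complex.mem_slitPlane_iff] at hy
            rcases hy with hy | hy
            · rw [Complex.neg_re, neg_pos] at hy
              exact absurd h4 (not_lt.2 hy.le)
            · rw [Complex.neg_im, h3] at hy
              simp at hy
          · simpa using (h1 h3).symm
        · rfl
    · dsimp only
      split_ifs with hzS
      · exact hq₁ z hzS
      · obtain ⟨x, hx, rfl⟩ := hray z hz hzS
        rw [mul_pow, hsq _ hε', hq₂ _ (hlow _ (h.mem x hx)), one_mul]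
  -- the two halves of the boundary have different signs
  have hbd : ∀ J : Set ℝ, IsPreconnected J → (∀ x ∈ J, x ≠ 0) →
      ∃ η : ℂ, (η = 1 ∨ η = -1) ∧ ∀ x ∈ J, ∀ᶠ z in 𝓝 (x : ℂ), s₁ z = η * s₂ z := by
    intro J hJ h0
    have hm₁ : ∀ x ∈ J, -e (x : ℂ) ∈ Complex.slitPlane := fun x hx =>
      h.neg_mem_slitPlane (by simpa using h0 x hx) (by simp)
    have hm₂ : ∀ x ∈ J, Complex.I * (x : ℂ) ∈ Complex.slitPlane := fun x hx =>
      I_mul_mem_slitPlane (by simpa using h0 x hx) (by simp)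
    have hn₁ : ∀ x ∈ J, s₁ x ≠ 0 := fun x hx hc => by
      have := hq₁ _ (hm₁ x hx)
      simp [hc] at this
      exact h0 x hx (by exact_mod_cast this.symm)
    have hn₂ : ∀ x ∈ J, s₂ x ≠ 0 := fun x hx hc => by
      have := hq₂ _ (hm₂ x hx)
      simp [hc] at this
      exact h0 x hx (by exact_mod_cast this.symm)
    have key : ∃ η : ℂ, (η = 1 ∨ η = -1) ∧ ∀ x ∈ J, s₁ x = η * s₂ x := by
      rcases hJ.eq_or_eq_neg_of_sq_eq (f := fun x : ℝ => s₁ x) (g := fun x : ℝ => s₂ x)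
        (hs₁.comp Complex.continuous_ofReal.continuousOn hm₁)
        (hs₂.comp Complex.continuous_ofReal.continuousOn hm₂)
        (fun x hx => by simp [hq₁ _ (hm₁ x hx), hq₂ _ (hm₂ x hx)])
        (fun {x} hx => hn₂ x hx) with hh | hh
      · exact ⟨1, Or.inl rfl, fun w hw => by simpa using hh hw⟩
      · exact ⟨-1, Or.inr rfl, fun w hw => by simpa using hh hw⟩
    obtain ⟨η, hη, hηJ⟩ := key
    refine ⟨η, hη, fun x hx => eventually_eq_of_sq_eq (hs₁.continuousAt (hS₁.mem_nhds (hm₁ x hx)))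
      ((hs₂.continuousAt (hS₂.mem_nhds (hm₂ x hx))).const_mul η) (hn₁ x hx) (hηJ x hx) ?_⟩
    filter_upwards [hS₁.mem_nhds (hm₁ x hx), hS₂.mem_nhds (hm₂ x hx)] with z h1 h2
    rw [mul_pow, hsq _ hη, hq₁ z h1, hq₂ z h2, one_mul]
  obtain ⟨η, hη, hpos⟩ := hbd (Ioi 0) isPreconnected_Ioi fun x hx => ne_of_gt hx
  obtain ⟨η', hη', hneg⟩ := hbd (Iio 0) isPreconnected_Iio fun x hx => ne_of_lt hx
  have hηη' : η' = -η := by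
    by_contra hne
    have hηη : η' = η := by rcases hη with rfl | rfl <;> rcases hη' with rfl | rfl <;> simp_all
    subst hηη
    classical
    refine Complex.not_exists_continuousOn_sqrt
      ⟨fun z => if 0 ≤ z.im then s₁ z else η' * s₂ z, fun z hz => ?_, fun z hz => ?_⟩
    · refine ContinuousAt.continuousWithinAt ?_
      rcases lt_or_ge z.im 0 with hz0 | hz0
      · refine ((hs₂.continuousAt (hS₂.mem_nhds (hlow z hz0))).const_mul η').congr ?_
        filter_upwards [isOpen_lowerHalf.mem_nhds hz0] with y hy
        exact (if_neg (not_le.2 hy)).symm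
      · refine (hs₁.continuousAt (hS₁.mem_nhds (h.neg_mem_slitPlane hz hz0))).congr ?_
        rcases hz0.eq_or_lt with hz0 | hz0
        · have hzr : z = (z.re : ℂ) := Complex.ext rfl (by simp [hz0])
          have hev : ∀ᶠ y in 𝓝 z, s₁ y = η' * s₂ y := by
            rw [hzr]
            rcases lt_or_gt_of_ne (show z.re ≠ 0 from fun hc => hz (by rw [hzr, hc]; simp))
              with hr | hr
            · exact hneg _ hr
            · exact hpos _ hr
          filter_upwards [hev] with y hy
          split_ifs
          · rfl
          · exact hy
        · filter_upwards [(isOpen_lt continuous_const Complex.continuous_im).mem_nhds hz0] with y hy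
          exact (if_pos (le_of_lt hy)).symm
    · dsimp only
      split_ifs with hz0
      · exact hq₁ z (h.neg_mem_slitPlane hz hz0)
      · rw [mul_pow, hsq _ hη', hq₂ _ (hlow _ (not_le.1 hz0)), one_mul]
  subst hηη' hεε'
  set side : ℂ → Set ℂ := fun ε => {z ∈ lowerHalf | -e z ∈ Complex.slitPlane ∧ s₁ z = ε * s₂ z}
    with hside
  have hn₂ : ∀ z ∈ lowerHalf, s₂ z ≠ 0 := fun z hz hc => by
    have := hq₂ z (hlow z hz)
    simp [hc] at this
    exact hlow0 z hz this.symm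
  have hopen : ∀ ε : ℂ, (ε = 1 ∨ ε = -1) → IsOpen (side ε) := by
    intro ε hε
    rw [isOpen_iff_mem_nhds]
    rintro z ⟨hz, hzS, hs⟩
    have h1 := eventually_eq_of_sq_eq (hs₁.continuousAt (hS₁.mem_nhds hzS))
      ((hs₂.continuousAt (hS₂.mem_nhds (hlow z hz))).const_mul ε) (by
        rw [hs]
        exact mul_ne_zero (by rcases hε with rfl | rfl <;> norm_num) (hn₂ z hz)) hs (by
        filter_upwards [hS₁.mem_nhds hzS, hS₂.mem_nhds (hlow z hz)] with y h1 h2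
        rw [mul_pow, hsq _ hε, hq₁ y h1, hq₂ y h2, one_mul])
    filter_upwards [h1, hS₁.mem_nhds hzS, isOpen_lowerHalf.mem_nhds hz] with y h1 h2 h3
    exact ⟨h3, h2, h1⟩
  have hside_iff : ∀ w : ℂ, w.im ≠ 0 → -e (e.symm w) ∈ Complex.slitPlane := fun w hw => by
    rw [e.apply_symm_apply, Complex.mem_slitPlane_iff]
    exact Or.inr (by simpa using hw)
  have hlowev : ∀ x : ℝ, 0 < x → ∀ᶠ w in 𝓝 (x : ℂ), e.symm w ∈ lowerHalf := fun x hx =>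
    e.symm.continuous.continuousAt (isOpen_lowerHalf.mem_nhds (h.mem x hx))
  have hsides : IsRaySides e (side ε) (side (-ε)) := by
    refine ⟨hopen ε hε, hopen _ hε', ?_, fun z hz => hz.1, fun z hz => hz.1, ?_, ?_, ?_, ?_⟩
    · rw [Set.disjoint_left]
      rintro z ⟨hz, -, h1⟩ ⟨-, -, h2⟩
      rw [h1] at h2
      have h3 := hn₂ z hz
      rcases hε with rfl | rfl
      · rw [← sub_eq_zero] at h2
        ring_nf at h2
        simp [h3] at h2
      · rw [← sub_eq_zero] at h2
        ring_nf at h2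
        simp [h3] at h2
    · rintro x hx (hc | hc) <;> exact hrayS x hx hc.2.1
    · intro z hz
      by_cases hzS : -e z ∈ Complex.slitPlane
      · have h2 : s₁ z ^ 2 = (ε * s₂ z) ^ 2 := by
          rw [mul_pow, hsq _ hε, hq₁ z hzS, hq₂ z (hlow z hz), one_mul]
        rcases sq_eq_sq_iff_eq_or_eq_neg.1 h2 with h2 | h2
        · exact Or.inl ⟨hz, hzS, h2⟩
        · exact Or.inr (Or.inl ⟨hz, hzS, by rw [h2]; ring⟩)
      · exact Or.inr (Or.inr (hray z (hlow0 z hz) hzS))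
    · intro x hx
      filter_upwards [hup x hx, hlowev x hx] with w h1 h2 h3
      exact ⟨h2, hside_iff w h3.ne', h1 h3⟩
    · intro x hx
      filter_upwards [hdown x hx, hlowev x hx] with w h1 h2 h3
      exact ⟨h2, hside_iff w h3.ne, h1 h3⟩
  have hbdev : ∀ a : ℝ, a ≠ 0 → ∀ᶠ z in 𝓝 (a : ℂ), -e z ∈ Complex.slitPlane := fun a ha =>
    hS₁.mem_nhds (h.neg_mem_slitPlane (by simpa using ha) (by simp))
  have hL : ∀ a : ℝ, 0 < a → ∀ᶠ z in 𝓝 (a : ℂ), z ∈ lowerHalf → z ∈ side η := fun a ha => by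
    filter_upwards [hpos a ha, hbdev a ha.ne'] with z h1 h2 h3
    exact ⟨h3, h2, h1⟩
  have hR : ∀ a : ℝ, a < 0 → ∀ᶠ z in 𝓝 (a : ℂ), z ∈ lowerHalf → z ∈ side (-η) := fun a ha => by
    filter_upwards [hneg a ha, hbdev a ha.ne] with z h1 h2 h3
    exact ⟨h3, h2, h1⟩
  by_cases hηε : η = ε
  · subst hηε
    exact ⟨e, fun _ => rfl, h, _, _, hsides, hL, hR⟩
  · have : η = -ε := by rcases hε with rfl | rfl <;> rcases hη with rfl | rfl <;> simp_all
    subst this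
    rw [neg_neg] at hR
    exact ⟨e.conj, fun x => by simp, h.conj, _, _, hsides.conj, hL, hR⟩

end RaySidesExist

section RaySidesLocal

open Filter Topology Metric

variable {e : ℂ ≃ₜ ℂ} {D E : Set ℂ}

theorem connectedComponentIn_eq_of_not_disjoint {X : Type*} [TopologicalSpace X] {F : Set X}
    {x y : X} (h : ¬ Disjoint (connectedComponentIn F x) (connectedComponentIn F y)) :
    connectedComponentIn F x = connectedComponentIn F y := by
  obtain ⟨z, h1, h2⟩ := Set.not_disjoint_iff.1 h
  rw [connectedComponentIn_eq h1, connectedComponentIn_eq h2]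

theorem IsRaySides.notMem_left (hs : IsRaySides e D E) {z : ℂ} (h0 : (e z).im = 0)
    (h1 : 0 < (e z).re) : z ∉ D := fun hz =>
  hs.notMem _ h1 (Or.inl (by
    rwa [show (((e z).re : ℝ) : ℂ) = e z from Complex.ext rfl (by simp [h0]),
      e.symm_apply_apply]))

theorem symm_mem_of_im_lt_infDist {O : Set ℂ} {w : ℂ}
    (h : |w.im| < infDist (w.re : ℂ) (e.symm ⁻¹' O)ᶜ) : e.symm w ∈ O := by
  by_contra hc
  have h1 := infDist_le_dist_of_mem (x := ((w.re : ℝ) : ℂ)) (show w ∈ (e.symm ⁻¹' O)ᶜ from hc)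
  have hd : dist ((w.re : ℝ) : ℂ) w = |w.im| := by
    rw [Complex.dist_of_re_eq (by simp)]
    simp [Real.dist_eq]
  rw [hd] at h1
  exact absurd h (not_lt.2 h1)

theorem continuous_infDist_ofReal (S : Set ℂ) : Continuous fun x : ℝ => infDist (x : ℂ) S :=
  (continuous_infDist_pt _).comp Complex.continuous_ofReal

theorem IsLowerRay.symm_zero (h : IsLowerRay e) : e.symm 0 = 0 := by
  rw [e.symm_apply_eq, h.zero]

theorem IsLowerRay.compl_preimage_nonempty (h : IsLowerRay e) {O : Set ℂ} (hO : O ⊆ lowerHalf) :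
    (e.symm ⁻¹' O)ᶜ.Nonempty := ⟨0, fun hc => by
  have := hO (show e.symm 0 ∈ O from hc)
  simp [h.symm_zero, lowerHalf] at this⟩

theorem IsLowerRay.infDist_pos (h : IsLowerRay e) {O : Set ℂ} (hO : IsOpen O)
    (hOl : O ⊆ lowerHalf) {x : ℝ} (hx : e.symm x ∈ O) :
    0 < infDist (x : ℂ) (e.symm ⁻¹' O)ᶜ :=
  ((hO.preimage e.symm.continuous).isClosed_compl.notMem_iff_infDist_pos
    (h.compl_preimage_nonempty hOl)).1 (fun hc => hc hx)

theorem IsRaySides.symm_mem_left (h : IsLowerRay e) (hs : IsRaySides e D E) {w : ℂ}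
    (h0 : 0 < w.re) (h1 : 0 < w.im)
    (h2 : w.im < infDist (w.re : ℂ) (e.symm ⁻¹' lowerHalf)ᶜ) : e.symm w ∈ D := by
  set δ : ℝ → ℝ := fun x => infDist (x : ℂ) (e.symm ⁻¹' lowerHalf)ᶜ with hδdef
  have hδ : Continuous δ := continuous_infDist_ofReal _
  have hN := (isPreconnected_setOf_im_lt hδ ordConnected_Ioi fun x hx =>
    h.infDist_pos isOpen_lowerHalf Subset.rfl (h.mem x hx)).image _ e.symm.continuous.continuousOn
  refine hN.subset_left_of_subset_union hs.isOpen_left hs.isOpen_right hs.disjoint ?_ ?_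
    ⟨w, ⟨h0, h1, h2⟩, rfl⟩
  · rintro _ ⟨w, ⟨-, h0, h1⟩, rfl⟩
    rcases hs.cover _ (symm_mem_of_im_lt_infDist (by rwa [abs_of_pos h0])) with h1 | h1 | ⟨x, -, h1⟩
    · exact Or.inl h1
    · exact Or.inr h1
    · rw [← e.symm.injective h1] at h0
      simp at h0
  · obtain ⟨ε, hε, hb⟩ := Metric.eventually_nhds_iff_ball.1 (hs.eventually_left _ h0)
    have hp := h.infDist_pos isOpen_lowerHalf Subset.rfl (h.mem _ h0)
    have h3 : 0 < min ε (δ w.re) := lt_min hε hp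
    have h4 := min_le_left ε (δ w.re)
    have h5 := min_le_right ε (δ w.re)
    refine ⟨_, ⟨(w.re : ℂ) + (min ε (δ w.re) / 2 : ℝ) * Complex.I, ⟨?_, ?_, ?_⟩, rfl⟩,
      hb _ ?_ ?_⟩
    · simpa using h0
    · simpa using h3
    · simp only [Complex.add_re, Complex.ofReal_re, Complex.re_ofReal_mul,
        Complex.I_re, mul_zero, add_zero, Complex.add_im, Complex.ofReal_im,
        Complex.im_ofReal_mul, Complex.I_im, mul_one, zero_add]
      linarith
    · rw [mem_ball, dist_eq_norm, add_sub_cancel_left, norm_mul, Complex.norm_I, mul_one,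
        Complex.norm_real, Real.norm_of_nonneg (by positivity)]
      linarith
    · simpa using h3

/-- On one side of a tame ray, the points near an arc of the ray can be joined near the arc. -/
theorem IsRaySides.exists_isPreconnected (h : IsLowerRay e) (hs : IsRaySides e D E)
    {O O' : Set ℂ} (hO : IsOpen O) (hOl : O ⊆ lowerHalf) (hO'c : IsPreconnected O')
    (hO'O : O' ⊆ O) {J : Set ℝ} (hJ : J.OrdConnected) (hJ0 : ∀ x ∈ J, 0 < x)
    (hJO : ∀ x ∈ J, e.symm x ∈ O) (hO'J : ∀ x : ℝ, 0 < x → e.symm x ∈ O' → x ∈ J)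
    (hne : ∃ x : ℝ, 0 < x ∧ e.symm x ∈ O') :
    ∃ V, IsPreconnected V ∧ V ⊆ D ∩ O ∧ D ∩ O' ⊆ V := by
  obtain ⟨x₀, hx₀, hx₀O'⟩ := hne
  have hx₀J := hO'J x₀ hx₀ hx₀O'
  set W : Set ℂ := e.symm ⁻¹' O with hW
  have hWo : IsOpen W := hO.preimage e.symm.continuous
  set δ : ℝ → ℝ := fun x => infDist (x : ℂ) Wᶜ with hδdef
  have hpos : ∀ x ∈ J, 0 < δ x := fun x hx => h.infDist_pos hO hOl (hJO x hx)
  have hN := isPreconnected_setOf_im_lt (continuous_infDist_ofReal _) hJ hpos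
  set N := {w : ℂ | w.re ∈ J ∧ 0 < w.im ∧ w.im < δ w.re} with hNdef
  have hNO : ∀ w ∈ N, e.symm w ∈ O := fun w hw =>
    symm_mem_of_im_lt_infDist (by rw [abs_of_pos hw.2.1]; exact hw.2.2)
  have hvert : ∀ x ∈ J, ∀ ε > 0, ∃ t : ℝ, 0 < t ∧ t < ε ∧ (x : ℂ) + t * Complex.I ∈ N := by
    intro x hx ε hε
    have hp := hpos x hx
    refine ⟨min ε (δ x) / 2, by positivity, ?_, ?_⟩
    · linarith [min_le_left ε (δ x), lt_min hε hp]
    · have : min ε (δ x) / 2 < δ x := by linarith [min_le_right ε (δ x), lt_min hε hp]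
      have h0 : 0 < min ε (δ x) / 2 := by positivity
      simp only [hNdef, mem_ofPred_eq, Complex.add_re, Complex.ofReal_re, Complex.re_ofReal_mul,
        Complex.I_re, mul_zero, add_zero, Complex.add_im, Complex.ofReal_im,
        Complex.im_ofReal_mul, Complex.I_im, mul_one, zero_add]
      exact ⟨hx, h0, this⟩
  have hNc : IsPreconnected (e.symm '' N) := hN.image _ e.symm.continuous.continuousOn
  have hball : ∀ x ∈ J, ∃ ε > 0, ∀ w ∈ ball (x : ℂ) ε, 0 < w.im → e.symm w ∈ D ∩ O := by
    intro x hx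
    obtain ⟨ε, hε, hb⟩ := Metric.eventually_nhds_iff_ball.1
      ((hs.eventually_left x (hJ0 x hx)).and (hWo.mem_nhds (hJO x hx)))
    exact ⟨ε, hε, fun w hw h0 => ⟨(hb w hw).1 h0, (hb w hw).2⟩⟩
  have hvball : ∀ x t ε : ℝ, 0 < t → t < ε → (x : ℂ) + t * Complex.I ∈ ball (x : ℂ) ε := by
    intro x t ε h0 h1
    simpa [abs_of_pos h0] using h1
  have hND : e.symm '' N ⊆ D := by
    rintro _ ⟨w, ⟨h0, h1, h2⟩, rfl⟩
    exact hs.symm_mem_left h (hJ0 _ h0) h1 (h2.trans_le (infDist_le_infDist_of_subset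
      (compl_subset_compl.2 (preimage_mono hOl)) (h.compl_preimage_nonempty Subset.rfl)))
  obtain ⟨t₀, -, -, ht₀⟩ := hvert x₀ hx₀J 1 one_pos
  set p := e.symm ((x₀ : ℂ) + t₀ * Complex.I) with hp
  have hpN : p ∈ e.symm '' N := ⟨_, ht₀, rfl⟩
  have hNDO : e.symm '' N ⊆ D ∩ O := fun z hz => ⟨hND hz, by
    obtain ⟨w, hw, rfl⟩ := hz
    exact hNO w hw⟩
  set V := connectedComponentIn (D ∩ O) p with hV
  have hNV : e.symm '' N ⊆ V := hNc.subset_connectedComponentIn hpN hNDO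
  have hVev : ∀ x ∈ J, ∀ᶠ w in 𝓝 (x : ℂ), 0 < w.im → e.symm w ∈ V := by
    intro x hx
    obtain ⟨ε, hε, hb⟩ := hball x hx
    obtain ⟨t, h0, h1, h2⟩ := hvert x hx ε hε
    filter_upwards [ball_mem_nhds (x : ℂ) hε] with w hw hw0
    have hc : IsPreconnected (e.symm '' (ball (x : ℂ) ε ∩ {w | 0 < w.im})) :=
      ((convex_ball _ _).inter (convex_halfSpace_im_gt 0)).isPreconnected.image _
        e.symm.continuous.continuousOn
    have hsub := hc.subset_connectedComponentIn (F := D ∩ O)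
      ⟨_, ⟨hvball x t ε h0 h1, by simpa using h0⟩, rfl⟩ (by
        rintro _ ⟨w, hw, rfl⟩
        exact hb w hw.1 hw.2)
    rw [hV, connectedComponentIn_eq (hNV ⟨_, h2, rfl⟩)]
    exact hsub ⟨w, ⟨hw, hw0⟩, rfl⟩
  refine ⟨V, isPreconnected_connectedComponentIn, connectedComponentIn_subset _ _, ?_⟩
  rintro z ⟨hzD, hzO'⟩
  by_contra hzV
  have hzDO : z ∈ D ∩ O := ⟨hzD, hO'O hzO'⟩
  set C := connectedComponentIn (D ∩ O) z with hC
  have hDO : IsOpen (D ∩ O) := hs.isOpen_left.inter hO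
  have hzC : z ∈ C := mem_connectedComponentIn hzDO
  have hCV : Disjoint C V := by
    by_contra hc
    exact hzV (by rw [hV, ← connectedComponentIn_eq_of_not_disjoint hc]; exact hzC)
  have hCD : C ⊆ D ∩ O := connectedComponentIn_subset _ _
  have hsub : O' ⊆ C := by
    refine hO'c.subset_of_closure_inter_subset hDO.connectedComponentIn ⟨z, hzO', hzC⟩ ?_
    rintro y ⟨hyC, hyO'⟩
    rcases hs.cover y (hOl (hO'O hyO')) with hy | hy | ⟨x, hx, rfl⟩
    · have hyDO : y ∈ D ∩ O := ⟨hy, hO'O hyO'⟩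
      obtain ⟨y', hy'1, hy'2⟩ := mem_closure_iff.1 hyC _ (hDO.connectedComponentIn (x := y))
        (mem_connectedComponentIn hyDO)
      rw [hC, connectedComponentIn_eq_of_not_disjoint
        (Set.not_disjoint_iff.2 ⟨y', hy'2, hy'1⟩)]
      exact mem_connectedComponentIn hyDO
    · obtain ⟨y', hy'1, hy'2⟩ := mem_closure_iff.1 hyC _ hs.isOpen_right hy
      exact (Set.disjoint_left.1 hs.disjoint (hCD hy'2).1 hy'1).elim
    · exfalso
      have ht : Tendsto e (𝓝 (e.symm x)) (𝓝 (x : ℂ)) := by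
        simpa using e.continuous.tendsto (e.symm x)
      have hre : {w : ℂ | 0 < w.re} ∈ 𝓝 (x : ℂ) :=
        (isOpen_lt continuous_const Complex.continuous_re).mem_nhds (by simpa using hx)
      obtain ⟨y, ⟨hy1, hy2, hy3⟩, hyC'⟩ := mem_closure_iff_nhds.1 hyC _
        ((ht.eventually (hVev x (hO'J x hx hyO'))).and
          ((ht.eventually (hs.eventually_right x hx)).and (ht hre)))
      simp only [e.symm_apply_apply] at hy1 hy2
      rcases lt_trichotomy (e y).im 0 with h3 | h3 | h3
      · exact Set.disjoint_left.1 hs.disjoint (hCD hyC').1 (hy2 h3)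
      · exact hs.notMem_left h3 hy3 (hCD hyC').1
      · exact Set.disjoint_left.1 hCV hyC' (hy1 h3)
  exact hs.notMem x₀ hx₀ (Or.inl (hCD (hsub hx₀O')).1)

/-- Push the points near the ray off the ray, towards its left side. -/
noncomputable def rayPush (e : ℂ ≃ₜ ℂ) (t : ℝ) (z : ℂ) : ℂ :=
  e.symm (e z + (t * (max 0 (infDist ((e z).re : ℂ)
    (e.symm ⁻¹' lowerHalf ∩ {w | 0 < w.re})ᶜ - |(e z).im|) / 2) : ℝ) * Complex.I)

theorem continuous_rayPush (e : ℂ ≃ₜ ℂ) : Continuous fun p : ℝ × ℂ => rayPush e p.1 p.2 := by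
  have h1 : Continuous fun p : ℝ × ℂ => infDist ((e p.2).re : ℂ)
    (e.symm ⁻¹' lowerHalf ∩ {w | 0 < w.re})ᶜ := (continuous_infDist_pt _).comp (by fun_prop)
  unfold rayPush
  fun_prop

theorem rayPush_zero (e : ℂ ≃ₜ ℂ) (z : ℂ) : rayPush e 0 z = z := by simp [rayPush]

theorem IsRaySides.rayPush_mem (h : IsLowerRay e) (hs : IsRaySides e D E) {t : ℝ} {z : ℂ}
    (ht : 0 ≤ t) (ht1 : t ≤ 1)
    (hz : z ∈ D ∨ 0 < t ∧ ∃ x : ℝ, 0 < x ∧ e.symm x = z) : rayPush e t z ∈ D := by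
  set S : Set ℂ := e.symm ⁻¹' lowerHalf ∩ {w | 0 < w.re} with hS
  have hSo : IsOpen S := (isOpen_lowerHalf.preimage e.symm.continuous).inter
    (isOpen_lt continuous_const Complex.continuous_re)
  have hSne : (Sᶜ).Nonempty := (h.compl_preimage_nonempty Subset.rfl).mono
    (compl_subset_compl.2 inter_subset_left)
  have hpos : ∀ w : ℂ, w ∈ S ↔ 0 < infDist w Sᶜ := fun w => by
    rw [← hSo.isClosed_compl.notMem_iff_infDist_pos hSne]; simp
  set d := infDist ((e z).re : ℂ) Sᶜ with hd
  have hpush : rayPush e t z = e.symm (e z + (t * (max 0 (d - |(e z).im|) / 2) : ℝ) *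
    Complex.I) := rfl
  rcases le_or_gt d |(e z).im| with hle | hlt
  · rcases hz with hz | ⟨-, x, hx, rfl⟩
    · rw [hpush, max_eq_left (by linarith)]
      simpa using hz
    · have : (x : ℂ) ∈ S := ⟨h.mem x hx, by simpa using hx⟩
      rw [hpos] at this
      simp [hd] at hle
      linarith
  · have hmem : ((e z).re : ℂ) ∈ S := (hpos _).2 ((abs_nonneg _).trans_lt hlt)
    have hre : 0 < (e z).re := by simpa using hmem.2
    have hdle : d ≤ infDist ((e z).re : ℂ) (e.symm ⁻¹' lowerHalf)ᶜ :=
      infDist_le_infDist_of_subset (compl_subset_compl.2 inter_subset_left)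
        (h.compl_preimage_nonempty Subset.rfl)
    have him : 0 < (e z).im ∨ 0 < t ∧ (e z).im = 0 := by
      rcases hz with hz | ⟨h0, x, hx, rfl⟩
      · left
        by_contra! hc
        rcases hc.eq_or_lt with hc | hc
        · exact hs.notMem_left hc hre hz
        · have := hs.conj.symm_mem_left h.conj (w := (starRingEnd ℂ) (e z)) (by simpa using hre)
            (by simpa using hc) (by
              have h1 : e.conj.symm ⁻¹' lowerHalf = (starRingEnd ℂ) ⁻¹' (e.symm ⁻¹' lowerHalf) := rfl
              have h2 : infDist ((e z).re : ℂ) (e.conj.symm ⁻¹' lowerHalf)ᶜ =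
                  infDist ((e z).re : ℂ) (e.symm ⁻¹' lowerHalf)ᶜ := by
                have := infDist_image (Φ := starRingEnd ℂ) Complex.isometry_conj
                  (x := ((e z).re : ℂ)) (t := (e.symm ⁻¹' lowerHalf)ᶜ)
                rw [Complex.conj_ofReal] at this
                rw [← this]
                congr 1
                ext w
                simp only [mem_compl_iff, mem_preimage, Homeomorph.conj_symm_apply, mem_image]
                exact ⟨fun hw => ⟨_, hw, by simp⟩, by rintro ⟨w, hw, rfl⟩; simpa using hw⟩
              simp only [Complex.conj_re, Complex.conj_im]
              rw [h2]
              rw [abs_of_neg hc] at hlt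
              exact hlt.trans_le hdle)
          simp at this
          exact Set.disjoint_left.1 hs.disjoint hz this
      · exact Or.inr ⟨h0, by simp⟩
    have hnn : 0 ≤ (e z).im := him.elim le_of_lt fun hh => hh.2.ge
    rw [abs_of_nonneg hnn] at hlt hpush
    rw [hpush, max_eq_right (by linarith)]
    have hadd : (e z).im + t * ((d - (e z).im) / 2) < d := by nlinarith
    have hadd0 : 0 < (e z).im + t * ((d - (e z).im) / 2) := by
      rcases him with him | ⟨h0, him⟩
      · have : 0 ≤ t * ((d - (e z).im) / 2) := mul_nonneg ht (by linarith)
        linarith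
      · have : 0 < t * ((d - (e z).im) / 2) := mul_pos h0 (by linarith)
        linarith
    refine hs.symm_mem_left h ?_ ?_ ?_ <;>
      simp only [Complex.add_re, Complex.ofReal_re, Complex.re_ofReal_mul,
        Complex.I_re, mul_zero, add_zero, Complex.add_im, Complex.ofReal_im,
        Complex.im_ofReal_mul, Complex.I_im, mul_one, zero_add]
    exacts [hre, hadd0, hadd.trans_le hdle]

end RaySidesLocal

section RaySidesContractible

open Filter Topology Metric unitInterval

variable {e : ℂ ≃ₜ ℂ} {D E : Set ℂ}

theorem IsRaySides.contractibleSpace (h : IsLowerRay e) (hs : IsRaySides e D E) :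
    ContractibleSpace D := by
  classical
  set r : ℂ → ℂ := fun z => if z ∈ E then e.symm (‖e z‖ : ℝ) else z with hr
  have hrc : ContinuousOn r lowerHalf := by
    intro z hz
    refine ContinuousAt.continuousWithinAt ?_
    have hc : Continuous fun z => e.symm (‖e z‖ : ℝ) := by fun_prop
    rcases hs.cover z hz with hz | hz | ⟨x, hx, rfl⟩
    · refine continuousAt_id.congr ?_
      filter_upwards [hs.isOpen_left.mem_nhds hz] with y hy
      exact (if_neg (Set.disjoint_left.1 hs.disjoint hy)).symm
    · refine hc.continuousAt.congr ?_
      filter_upwards [hs.isOpen_right.mem_nhds hz] with y hy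
      exact (if_pos hy).symm
    · have hrx : r (e.symm x) = e.symm x := if_neg fun hc => hs.notMem x hx (Or.inr hc)
      unfold ContinuousAt
      rw [hrx]
      refine Tendsto.if' ?_ tendsto_id
      have := hc.tendsto (e.symm x)
      simpa [abs_of_pos hx] using this
  have hrm : ∀ z ∈ lowerHalf, rayPush e 1 (r z) ∈ D := by
    intro z hz
    refine hs.rayPush_mem h zero_le_one le_rfl ?_
    by_cases hzE : z ∈ E
    · right
      refine ⟨one_pos, ‖e z‖, norm_pos_iff.2 fun hc => ?_, by simp [hr, hzE]⟩
      rw [← e.apply_symm_apply 0, e.injective.eq_iff, h.symm_zero] at hc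
      simp [hc, lowerHalf] at hz
    · rcases hs.cover z hz with hz' | hz' | ⟨x, hx, hxz⟩
      · exact Or.inl (by simpa [hr, hzE] using hz')
      · exact absurd hz' hzE
      · exact Or.inr ⟨one_pos, x, hx, by simp [hr, hzE, hxz]⟩
  have hRc : ContinuousOn (fun z => rayPush e 1 (r z)) lowerHalf :=
    ((continuous_rayPush e).comp (Continuous.prodMk_right (1 : ℝ))).comp_continuousOn hrc
  have hrD : ∀ z ∈ D, r z = z := fun z hz => if_neg (Set.disjoint_left.1 hs.disjoint hz)
  set z₀ : ℂ := e.symm (1 : ℝ) with hz₀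
  have hz₀l : z₀ ∈ lowerHalf := h.mem 1 one_pos
  have hseg : ∀ (t : I) (z : D), (1 - (t : ℝ)) • (z : ℂ) + (t : ℝ) • z₀ ∈ lowerHalf := fun t z =>
    convex_lowerHalf (hs.left_subset z.2) hz₀l (by linarith [t.2.2]) t.2.1 (by ring)
  rw [contractible_iff_id_nullhomotopic]
  refine ⟨⟨_, hrm z₀ hz₀l⟩, ?_⟩
  have hmid : Continuous fun z : D => (⟨rayPush e 1 z,
      hs.rayPush_mem h zero_le_one le_rfl (Or.inl z.2)⟩ : D) :=
    ((continuous_rayPush e).comp (by fun_prop : Continuous fun z : D => ((1 : ℝ), (z : ℂ)))).subtype_mk _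
  have H1 : (ContinuousMap.id D).Homotopic ⟨_, hmid⟩ := ⟨{
    toFun := fun p => ⟨rayPush e p.1 p.2, hs.rayPush_mem h p.1.2.1 p.1.2.2 (Or.inl p.2.2)⟩
    continuous_toFun := ((continuous_rayPush e).comp
      (by fun_prop : Continuous fun p : I × D => ((p.1 : ℝ), (p.2 : ℂ)))).subtype_mk _
    map_zero_left := fun z => Subtype.ext (by simp [rayPush_zero])
    map_one_left := fun z => Subtype.ext (by simp) }⟩
  refine H1.trans ⟨{
    toFun := fun p => ⟨rayPush e 1 (r ((1 - (p.1 : ℝ)) • (p.2 : ℂ) + (p.1 : ℝ) • z₀)),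
      hrm _ (hseg p.1 p.2)⟩
    continuous_toFun := (hRc.comp_continuous (by fun_prop)
      fun p : I × D => hseg p.1 p.2).subtype_mk _
    map_zero_left := fun z => Subtype.ext (by simp [hrD z z.2])
    map_one_left := fun z => Subtype.ext (by simp) }⟩

end RaySidesContractible

section Cayley

open Filter Topology Metric

/-- The Cayley transform of the lower half plane onto the unit disc. -/
noncomputable def cayley (z : ℂ) : ℂ := (z + Complex.I) / (z - Complex.I)

/-- The inverse of the Cayley transform. -/
noncomputable def cayleyInv (w : ℂ) : ℂ := Complex.I * (1 + w) / (w - 1)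

theorem cayleyInv_cayley {z : ℂ} (hz : z ≠ Complex.I) : cayleyInv (cayley z) = z := by
  have h1 : z - Complex.I ≠ 0 := sub_ne_zero.2 hz
  have h2 : Complex.I ≠ 0 := Complex.I_ne_zero
  unfold cayleyInv cayley
  have h3 : (z + Complex.I) / (z - Complex.I) - 1 = 2 * Complex.I / (z - Complex.I) := by
    field_simp; ring
  rw [h3]
  field_simp
  ring

theorem cayley_cayleyInv {w : ℂ} (hw : w ≠ 1) : cayley (cayleyInv w) = w := by
  have h1 : w - 1 ≠ 0 := sub_ne_zero.2 hw
  have h2 : Complex.I ≠ 0 := Complex.I_ne_zero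
  unfold cayleyInv cayley
  have h3 : Complex.I * (1 + w) / (w - 1) - Complex.I = 2 * Complex.I / (w - 1) := by
    field_simp; ring
  rw [h3]
  field_simp
  ring

theorem cayley_zero : cayley 0 = -1 := by
  have h2 : Complex.I ≠ 0 := Complex.I_ne_zero
  unfold cayley
  field_simp
  simp

theorem cayley_ne_one {z : ℂ} (hz : z ≠ Complex.I) : cayley z ≠ 1 := by
  have h1 : z - Complex.I ≠ 0 := sub_ne_zero.2 hz
  unfold cayley
  rw [ne_eq, div_eq_one_iff_eq h1]
  intro h
  have : (2 : ℂ) * Complex.I = 0 := by linear_combination h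
  simp at this

theorem ne_I_of_im_nonpos {z : ℂ} (hz : z.im ≤ 0) : z ≠ Complex.I := by
  rintro rfl
  norm_num at hz

theorem cayleyInv_im (w : ℂ) : (cayleyInv w).im = (‖w‖ ^ 2 - 1) / ‖w - 1‖ ^ 2 := by
  unfold cayleyInv
  rw [Complex.div_im, ← Complex.normSq_eq_norm_sq, ← Complex.normSq_eq_norm_sq]
  rw [← sub_div]
  congr 1
  simp [Complex.normSq_apply]
  ring

theorem cayleyInv_re (w : ℂ) : (cayleyInv w).re = 2 * w.im / ‖w - 1‖ ^ 2 := by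
  unfold cayleyInv
  rw [Complex.div_re, ← Complex.normSq_eq_norm_sq]
  rw [← add_div]
  congr 1
  simp
  ring

theorem cayleyInv_mem_lowerHalf {w : ℂ} (hw : w ∈ ball (0 : ℂ) 1) :
    cayleyInv w ∈ lowerHalf := by
  rw [mem_ball_zero_iff] at hw
  have h1 : w ≠ 1 := by rintro rfl; simp at hw
  have h2 : 0 < ‖w - 1‖ := norm_pos_iff.2 (sub_ne_zero.2 h1)
  change (cayleyInv w).im < 0
  rw [cayleyInv_im]
  exact div_neg_of_neg_of_pos (by nlinarith [norm_nonneg w]) (by positivity)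

theorem cayleyInv_im_nonpos {w : ℂ} (hw : ‖w‖ ≤ 1) : (cayleyInv w).im ≤ 0 := by
  rw [cayleyInv_im]
  exact div_nonpos_of_nonpos_of_nonneg (by nlinarith [norm_nonneg w]) (by positivity)

theorem norm_cayley_lt_one_iff {z : ℂ} (hz : z ≠ Complex.I) : ‖cayley z‖ < 1 ↔ z ∈ lowerHalf := by
  constructor
  · intro h
    rw [← cayleyInv_cayley hz]
    exact cayleyInv_mem_lowerHalf (mem_ball_zero_iff.2 h)
  · intro h
    by_contra hc
    have h1 := cayleyInv_im (cayley z)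
    rw [cayleyInv_cayley hz] at h1
    have h2 : 0 ≤ z.im := by
      rw [h1]
      exact div_nonneg (by nlinarith [not_lt.1 hc]) (by positivity)
    exact absurd h (not_lt.2 h2)

theorem cayley_mem_ball {z : ℂ} (hz : z ∈ lowerHalf) : cayley z ∈ ball (0 : ℂ) 1 :=
  mem_ball_zero_iff.2 ((norm_cayley_lt_one_iff (ne_I_of_im_nonpos (le_of_lt hz))).2 hz)

theorem norm_cayley_le_one {z : ℂ} (hz : z.im ≤ 0) : ‖cayley z‖ ≤ 1 := by
  by_contra hc
  have h1 := cayleyInv_im (cayley z)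
  have hI := ne_I_of_im_nonpos hz
  rw [cayleyInv_cayley hI] at h1
  have h3 : 0 < ‖cayley z - 1‖ := norm_pos_iff.2 (sub_ne_zero.2 (cayley_ne_one hI))
  have h2 : 0 < z.im := by
    rw [h1]
    exact div_pos (by nlinarith [not_le.1 hc]) (by positivity)
  linarith

theorem continuousAt_cayley {z : ℂ} (hz : z ≠ Complex.I) : ContinuousAt cayley z :=
  ContinuousAt.div (by fun_prop) (by fun_prop) (sub_ne_zero.2 hz)

theorem continuousAt_cayleyInv {w : ℂ} (hw : w ≠ 1) : ContinuousAt cayleyInv w :=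
  ContinuousAt.div (by fun_prop) (by fun_prop) (sub_ne_zero.2 hw)

theorem tendsto_cayley_cocompact : Tendsto cayley (cocompact ℂ) (𝓝 1) := by
  have h1 : Tendsto (fun z : ℂ => 1 + 2 * Complex.I * (z - Complex.I)⁻¹) (cocompact ℂ)
      (𝓝 (1 + 2 * Complex.I * 0)) := by
    refine tendsto_const_nhds.add (tendsto_const_nhds.mul ?_)
    exact tendsto_inv₀_cobounded.comp (by
      rw [← Metric.cobounded_eq_cocompact]
      exact tendsto_sub_const_cobounded _)
  rw [mul_zero, add_zero] at h1
  refine h1.congr' ?_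
  have : {Complex.I}ᶜ ∈ cocompact ℂ := isCompact_singleton.compl_mem_cocompact
  filter_upwards [this] with z hz
  have : z - Complex.I ≠ 0 := sub_ne_zero.2 hz
  unfold cayley
  field_simp
  ring

/-- The image in the disc of the ray straightened by `e`, parametrised by the unit interval. -/
noncomputable def rayCurve (e : ℂ ≃ₜ ℂ) (s : ℝ) : ℂ :=
  if s < 1 then cayley (e.symm (s / (1 - s) : ℝ)) else 1

theorem rayCurve_congr {e e' : ℂ ≃ₜ ℂ} (h : ∀ x : ℝ, e.symm x = e'.symm x) :
    rayCurve e = rayCurve e' := by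
  ext s; simp only [rayCurve, h]

variable {e : ℂ ≃ₜ ℂ}

theorem IsLowerRay.im_nonpos (h : IsLowerRay e) {x : ℝ} (hx : 0 ≤ x) : (e.symm x).im ≤ 0 := by
  rcases hx.eq_or_lt with rfl | hx
  · simp [h.symm_zero]
  · exact le_of_lt (h.mem x hx)

theorem rayCurve_zero (h : IsLowerRay e) : rayCurve e 0 = -1 := by
  simp [rayCurve, h.symm_zero, cayley_zero]

theorem rayCurve_one : rayCurve e 1 = 1 := by simp [rayCurve]

theorem rayCurve_div {x : ℝ} (hx : 0 ≤ x) : rayCurve e (x / (1 + x)) = cayley (e.symm x) := by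
  have h1 : x / (1 + x) < 1 := by rw [div_lt_one (by linarith)]; linarith
  rw [rayCurve, if_pos h1]
  congr 4
  field_simp
  ring

theorem rayCurve_mem_ball (h : IsLowerRay e) {s : ℝ} (hs : s ∈ Ioo (0 : ℝ) 1) :
    rayCurve e s ∈ ball (0 : ℂ) 1 := by
  rw [rayCurve, if_pos hs.2]
  exact cayley_mem_ball (h.mem _ (div_pos hs.1 (by linarith [hs.2])))

theorem continuousOn_rayCurve (h : IsLowerRay e) : ContinuousOn (rayCurve e) (Icc 0 1) := by
  intro s hs
  rcases hs.2.lt_or_eq with h1 | rfl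
  · refine ContinuousAt.continuousWithinAt ?_
    have hc : ContinuousAt (fun s : ℝ => cayley (e.symm (s / (1 - s) : ℝ))) s := by
      refine ContinuousAt.comp (g := cayley) (f := fun s : ℝ => e.symm (s / (1 - s) : ℝ))
        (continuousAt_cayley (ne_I_of_im_nonpos
          (h.im_nonpos (div_nonneg hs.1 (by linarith))))) ?_
      refine e.symm.continuous.continuousAt.comp (Complex.continuous_ofReal.continuousAt.comp ?_)
      exact ContinuousAt.div (by fun_prop) (by fun_prop) (by linarith)
    refine hc.congr ?_
    filter_upwards [Iio_mem_nhds h1] with t ht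
    exact (if_pos ht).symm
  · unfold ContinuousWithinAt
    rw [rayCurve_one]
    have hev : 𝓝[Icc (0 : ℝ) 1] 1 = 𝓝[Icc (0 : ℝ) 1 \ {1}] 1 ⊔ pure 1 := by
      rw [← nhdsWithin_singleton, ← nhdsWithin_union, sdiff_union_of_subset (by simp)]
    rw [hev, tendsto_sup]
    refine ⟨?_, tendsto_pure_left.2 fun u hu => by rw [rayCurve_one]; exact mem_of_mem_nhds hu⟩
    have h2 : Tendsto (fun s : ℝ => s / (1 - s)) (𝓝[<] 1) atTop := by
      have h3 : Tendsto (fun s : ℝ => 1 - s) (𝓝[<] 1) (𝓝[>] 0) := by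
        refine tendsto_nhdsWithin_iff.2 ⟨Tendsto.mono_left ?_ nhdsWithin_le_nhds, ?_⟩
        · have : Continuous fun s : ℝ => 1 - s := by fun_prop
          simpa using this.tendsto 1
        · filter_upwards [self_mem_nhdsWithin] with s hs
          simpa using hs
      have h4 : Tendsto (fun s : ℝ => s) (𝓝[<] 1) (𝓝 1) := nhdsWithin_le_nhds
      exact h4.pos_mul_atTop one_pos (tendsto_inv_nhdsGT_zero.comp h3)
    have h5 : Tendsto (fun s : ℝ => cayley (e.symm (s / (1 - s) : ℝ))) (𝓝[<] 1) (𝓝 1) := by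
      refine tendsto_cayley_cocompact.comp (e.symm.isClosedEmbedding.tendsto_cocompact.comp ?_)
      exact Complex.isometry_ofReal.isClosedEmbedding.tendsto_cocompact.comp
        (h2.mono_right atTop_le_cocompact)
    refine (h5.mono_left (nhdsWithin_mono _ fun s hs => lt_of_le_of_ne hs.1.2 hs.2)).congr' ?_
    filter_upwards [self_mem_nhdsWithin] with s hs
    exact (if_pos (lt_of_le_of_ne hs.1.2 hs.2)).symm

theorem injOn_rayCurve (h : IsLowerRay e) : InjOn (rayCurve e) (Icc 0 1) := by
  have h1 : ∀ s, 0 ≤ s → s < 1 → e.symm (s / (1 - s) : ℝ) ≠ Complex.I := fun s h0 h1 =>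
    ne_I_of_im_nonpos (h.im_nonpos (div_nonneg h0 (by linarith)))
  intro s hs t ht hst
  simp only [rayCurve] at hst
  split_ifs at hst with hs1 ht1 ht1
  · have := congrArg cayleyInv hst
    rw [cayleyInv_cayley (h1 s hs.1 hs1), cayleyInv_cayley (h1 t ht.1 ht1)] at this
    have := Complex.ofReal_injective (e.symm.injective this)
    rw [div_eq_div_iff (by linarith) (by linarith)] at this
    linarith
  · exact absurd hst (cayley_ne_one (h1 s hs.1 hs1))
  · exact absurd hst.symm (cayley_ne_one (h1 t ht.1 ht1))
  · linarith [hs.2, ht.2]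

end Cayley

section DiscSides

open Filter Topology Metric

/-- The image in the unit disc of a subset of the lower half plane. -/
def discSide (D : Set ℂ) : Set ℂ := {w ∈ ball (0 : ℂ) 1 | cayleyInv w ∈ D}

theorem ne_one_of_mem_ball {w : ℂ} (hw : w ∈ ball (0 : ℂ) 1) : w ≠ 1 := by
  rintro rfl; simp at hw

theorem discSide_subset (D : Set ℂ) : discSide D ⊆ ball 0 1 := fun _ h => h.1

theorem continuousOn_cayleyInv : ContinuousOn cayleyInv (ball 0 1) := fun _ hw =>
  (continuousAt_cayleyInv (ne_one_of_mem_ball hw)).continuousWithinAt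

theorem continuousOn_cayley : ContinuousOn cayley lowerHalf := fun _ hz =>
  (continuousAt_cayley (ne_I_of_im_nonpos (le_of_lt hz))).continuousWithinAt

theorem isOpen_discSide {D : Set ℂ} (hD : IsOpen D) : IsOpen (discSide D) :=
  continuousOn_cayleyInv.isOpen_inter_preimage isOpen_ball hD

theorem cayley_mem_discSide {D : Set ℂ} (hD : D ⊆ lowerHalf) {z : ℂ} (hz : z ∈ D) :
    cayley z ∈ discSide D :=
  ⟨cayley_mem_ball (hD hz), by
    rwa [cayleyInv_cayley (ne_I_of_im_nonpos (le_of_lt (hD hz)))]⟩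

theorem isSimplyConnected_discSide {D : Set ℂ} (hD : D ⊆ lowerHalf) [ContractibleSpace D] :
    IsSimplyConnected (discSide D) := by
  have f : D ≃ₜ discSide D := {
    toFun := fun z => ⟨cayley z, cayley_mem_discSide hD z.2⟩
    invFun := fun w => ⟨cayleyInv w, w.2.2⟩
    left_inv := fun z => Subtype.ext
      (cayleyInv_cayley (ne_I_of_im_nonpos (le_of_lt (hD z.2))))
    right_inv := fun w => Subtype.ext (cayley_cayleyInv (ne_one_of_mem_ball w.2.1))
    continuous_toFun := (continuousOn_cayley.comp_continuous continuous_subtype_val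
      fun z => hD z.2).subtype_mk _
    continuous_invFun := (continuousOn_cayleyInv.comp_continuous continuous_subtype_val
      fun w => w.2.1).subtype_mk _ }
  have : ContractibleSpace (discSide D) := f.symm.contractibleSpace
  exact (SimplyConnectedSpace.ofContractible _ : SimplyConnectedSpace (discSide D))

variable {e : ℂ ≃ₜ ℂ} {D E : Set ℂ} {σ : ℝ}

theorem disjoint_discSide (hs : IsRaySides e D E) : Disjoint (discSide D) (discSide E) :=
  Set.disjoint_left.2 fun _ h1 h2 => Set.disjoint_left.1 hs.disjoint h1.2 h2.2

theorem IsRaySides.mem_discSide_or (hs : IsRaySides e D E) {q : ℂ} (hq : q ∈ ball (0 : ℂ) 1) :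
    q ∈ discSide D ∨ q ∈ discSide E ∨ ∃ s ∈ Ioo (0 : ℝ) 1, rayCurve e s = q := by
  rcases hs.cover _ (cayleyInv_mem_lowerHalf hq) with h | h | ⟨x, hx, h⟩
  · exact Or.inl ⟨hq, h⟩
  · exact Or.inr (Or.inl ⟨hq, h⟩)
  · refine Or.inr (Or.inr ⟨x / (1 + x), ⟨by positivity, ?_⟩, ?_⟩)
    · rw [div_lt_one (by linarith)]; linarith
    · rw [rayCurve_div hx.le, h, cayley_cayleyInv (ne_one_of_mem_ball hq)]

theorem IsRaySides.rayCurve_notMem (h : IsLowerRay e) (hs : IsRaySides e D E) {s : ℝ}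
    (hs01 : s ∈ Icc (0 : ℝ) 1) : rayCurve e s ∉ discSide D := by
  rintro ⟨hb, hD⟩
  rcases hs01.1.eq_or_lt with rfl | h0
  · simp [rayCurve_zero h] at hb
  rcases hs01.2.eq_or_lt with rfl | h1
  · simp [rayCurve_one] at hb
  rw [rayCurve, if_pos h1] at hD
  have hx : 0 < s / (1 - s) := div_pos h0 (by linarith)
  rw [cayleyInv_cayley (ne_I_of_im_nonpos (h.im_nonpos hx.le))] at hD
  exact hs.notMem _ hx (Or.inl hD)

theorem cayleyInv_ofReal_of_norm_eq_one {q : ℂ} (hq : ‖q‖ = 1) :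
    cayleyInv q = ((2 * q.im / ‖q - 1‖ ^ 2 : ℝ) : ℂ) :=
  Complex.ext (by rw [cayleyInv_re, Complex.ofReal_re]) (by rw [cayleyInv_im, hq, Complex.ofReal_im]; simp)

theorem eventually_mem_discSide {q : ℂ} (hq : ‖q‖ = 1) (him : 0 < σ * q.im)
    (hD : ∀ a : ℝ, 0 < σ * a → ∀ᶠ z in 𝓝 (a : ℂ), z ∈ lowerHalf → z ∈ D) :
    ∀ᶠ w in 𝓝 q, w ∈ ball (0 : ℂ) 1 → w ∈ discSide D := by
  have h1 : q ≠ 1 := by rintro rfl; simp at him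
  have h2 : 0 < ‖q - 1‖ := norm_pos_iff.2 (sub_ne_zero.2 h1)
  have h3 := hD (2 * q.im / ‖q - 1‖ ^ 2) (by
    rw [show σ * (2 * q.im / ‖q - 1‖ ^ 2) = 2 * (σ * q.im) / ‖q - 1‖ ^ 2 by ring]
    positivity)
  rw [← cayleyInv_ofReal_of_norm_eq_one hq] at h3
  filter_upwards [(continuousAt_cayleyInv h1).eventually h3] with w hw hb
  exact ⟨hb, hw (cayleyInv_mem_lowerHalf hb)⟩

theorem eq_one_or_neg_one {q : ℂ} (hq : ‖q‖ = 1) (him : q.im = 0) : q = -1 ∨ q = 1 := by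
  have h := Complex.normSq_eq_norm_sq q
  rw [Complex.normSq_apply, hq, him] at h
  have h2 : (q.re - 1) * (q.re + 1) = 0 := by linarith
  rcases mul_eq_zero.1 h2 with h3 | h3
  · exact Or.inr (Complex.ext (by simp; linarith) (by simp [him]))
  · exact Or.inl (Complex.ext (by simp; linarith) (by simp [him]))

theorem closure_discSide_subset (D : Set ℂ) : closure (discSide D) ⊆ closedBall 0 1 :=
  closure_minimal ((discSide_subset D).trans ball_subset_closedBall) isClosed_closedBall

/-- The frontier of a side of the ray in the disc. -/
theorem IsRaySides.closure_diff (h : IsLowerRay e) (hs : IsRaySides e D E) (hσ : σ ≠ 0)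
    (hD : ∀ a : ℝ, 0 < σ * a → ∀ᶠ z in 𝓝 (a : ℂ), z ∈ lowerHalf → z ∈ D)
    (hE : ∀ a : ℝ, σ * a < 0 → ∀ᶠ z in 𝓝 (a : ℂ), z ∈ lowerHalf → z ∈ E) :
    closure (discSide D) \ discSide D =
      rayCurve e '' Icc 0 1 ∪ {q | ‖q‖ = 1 ∧ 0 ≤ σ * q.im} := by
  have hE' : ∀ a : ℝ, 0 < -σ * a → ∀ᶠ z in 𝓝 (a : ℂ), z ∈ lowerHalf → z ∈ E := fun a ha =>
    hE a (by linarith)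
  ext q
  constructor
  · rintro ⟨hqc, hqn⟩
    have hq1 := closure_discSide_subset D hqc
    rw [mem_closedBall_zero_iff] at hq1
    rcases hq1.lt_or_eq with hq1 | hq1
    · rcases hs.mem_discSide_or (mem_ball_zero_iff.2 hq1) with hh | hh | ⟨s, hs', rfl⟩
      · exact absurd hh hqn
      · obtain ⟨y, hy1, hy2⟩ := mem_closure_iff.1 hqc _ (isOpen_discSide hs.isOpen_right) hh
        exact (Set.disjoint_left.1 (disjoint_discSide hs) hy2 hy1).elim
      · exact Or.inl ⟨s, Ioo_subset_Icc_self hs', rfl⟩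
    · right
      refine ⟨hq1, ?_⟩
      by_contra! hc
      have := eventually_mem_discSide (σ := -σ) hq1 (by linarith) hE'
      obtain ⟨y, hy1, hy2⟩ := mem_closure_iff_nhds.1 hqc _ this
      exact Set.disjoint_left.1 (disjoint_discSide hs) hy2 (hy1 hy2.1)
  · have hcurve : rayCurve e '' Icc 0 1 ⊆ closure (discSide D) := by
      have h1 : rayCurve e '' Ioo 0 1 ⊆ closure (discSide D) := by
        rintro _ ⟨s, hs', rfl⟩
        rw [mem_closure_iff_nhds]
        intro u hu
        have hx : 0 < s / (1 - s) := div_pos hs'.1 (by linarith [hs'.2])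
        rw [rayCurve, if_pos hs'.2] at hu
        have hc : ContinuousAt (fun w => cayley (e.symm w)) ((s / (1 - s) : ℝ) : ℂ) :=
          ContinuousAt.comp (g := cayley) (f := e.symm)
            (continuousAt_cayley (ne_I_of_im_nonpos (h.im_nonpos hx.le)))
            e.symm.continuous.continuousAt
        obtain ⟨ε, hε, hb⟩ := Metric.eventually_nhds_iff_ball.1
          ((hc.eventually_mem hu).and (hs.eventually_left _ hx))
        have hmem : ((s / (1 - s) : ℝ) : ℂ) + (ε / 2 : ℝ) * Complex.I ∈
            ball ((s / (1 - s) : ℝ) : ℂ) ε := by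
          rw [mem_ball, dist_eq_norm, add_sub_cancel_left, norm_mul, Complex.norm_I, mul_one,
            Complex.norm_real, Real.norm_of_nonneg (by positivity)]
          linarith
        obtain ⟨h2, h3⟩ := hb _ hmem
        exact ⟨_, h2, cayley_mem_discSide hs.left_subset (h3 (by
          simp only [Complex.add_im, Complex.ofReal_im, Complex.im_ofReal_mul, Complex.I_im]
          linarith))⟩
      calc rayCurve e '' Icc 0 1 = rayCurve e '' closure (Ioo 0 1) := by
            rw [closure_Ioo zero_ne_one]
        _ ⊆ closure (rayCurve e '' Ioo 0 1) := by
            refine ContinuousOn.image_closure ?_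
            rw [closure_Ioo zero_ne_one]
            exact continuousOn_rayCurve h
        _ ⊆ closure (discSide D) := closure_minimal h1 isClosed_closure
    rintro (⟨s, hs', rfl⟩ | ⟨hq1, hq2⟩)
    · exact ⟨hcurve ⟨s, hs', rfl⟩, hs.rayCurve_notMem h hs'⟩
    · refine ⟨?_, fun hc => by simpa [hq1] using hc.1⟩
      rcases hq2.eq_or_lt with hq2 | hq2
      · have him : q.im = 0 := by simpa [hσ] using hq2.symm
        rcases eq_one_or_neg_one hq1 him with rfl | rfl
        · exact hcurve ⟨0, by simp, rayCurve_zero h⟩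
        · exact hcurve ⟨1, by simp, rayCurve_one⟩
      · have := eventually_mem_discSide hq1 hq2 hD
        have hqc : q ∈ closure (ball (0 : ℂ) 1) := by
          rw [closure_ball _ one_ne_zero, mem_closedBall_zero_iff, hq1]
        rw [mem_closure_iff_nhds] at hqc ⊢
        intro u hu
        obtain ⟨y, ⟨hy1, hy2⟩, hy3⟩ := hqc _ (inter_mem hu this)
        exact ⟨y, hy1, hy2 hy3⟩

theorem IsRaySides.locallyConnectedAtFrontier (h : IsLowerRay e) (hs : IsRaySides e D E)
    (hσ : σ ≠ 0)
    (hD : ∀ a : ℝ, 0 < σ * a → ∀ᶠ z in 𝓝 (a : ℂ), z ∈ lowerHalf → z ∈ D)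
    (hE : ∀ a : ℝ, σ * a < 0 → ∀ᶠ z in 𝓝 (a : ℂ), z ∈ lowerHalf → z ∈ E) :
    LocallyConnectedAtFrontier (discSide D) := by
  intro q hq r hr
  rw [hs.closure_diff h hσ hD hE] at hq
  have hcurve : ∀ t ∈ Icc (0 : ℝ) 1, rayCurve e t = q → ∃ s > 0, ∃ V, IsPreconnected V ∧
      V ⊆ discSide D ∩ ball q r ∧ discSide D ∩ ball q s ⊆ V := by
    rintro t ht rfl
    set q := rayCurve e t with hqdef
    have hc := continuousOn_rayCurve h
    obtain ⟨η, hη, hηb⟩ := Metric.mem_nhdsWithin_iff.1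
      (hc t ht (ball_mem_nhds (rayCurve e t) hr))
    have hcpt : IsCompact (rayCurve e '' (Icc 0 1 \ ball t η)) :=
      (isCompact_Icc.diff isOpen_ball).image_of_continuousOn (hc.mono sdiff_subset)
    have hnot : q ∉ rayCurve e '' (Icc 0 1 \ ball t η) := by
      rintro ⟨t', ht', heq⟩
      have := injOn_rayCurve h ht'.1 ht heq
      subst this
      exact ht'.2 (mem_ball_self hη)
    obtain ⟨s₀, hs₀, hs₀b⟩ := Metric.mem_nhds_iff.1 (hcpt.isClosed.isOpen_compl.mem_nhds hnot)
    set s := min s₀ r with hsdef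
    have hspos : 0 < s := lt_min hs₀ hr
    set O : Set ℂ := {z ∈ lowerHalf | cayley z ∈ ball q r} with hO
    set O' : Set ℂ := cayleyInv '' (ball q s ∩ ball 0 1) with hO'
    have hOopen : IsOpen O := continuousOn_cayley.isOpen_inter_preimage isOpen_lowerHalf isOpen_ball
    have hmono : ∀ x y : ℝ, 0 < x → x ≤ y → x / (1 + x) ≤ y / (1 + y) := fun x y hx hxy => by
      rw [div_le_div_iff₀ (by linarith) (by linarith)]; nlinarith
    have hIcc : ∀ x : ℝ, 0 < x → x / (1 + x) ∈ Icc (0 : ℝ) 1 := fun x hx =>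
      ⟨by positivity, by rw [div_le_one (by linarith)]; linarith⟩
    obtain ⟨V, hVc, hVs, hVsup⟩ := hs.exists_isPreconnected h hOopen (O' := O')
      (fun z hz => hz.1)
      (((convex_ball _ _).inter (convex_ball _ _)).isPreconnected.image _
        (continuousOn_cayleyInv.mono inter_subset_right))
      (by
        rintro _ ⟨w, ⟨hw1, hw2⟩, rfl⟩
        refine ⟨cayleyInv_mem_lowerHalf hw2, ?_⟩
        rw [cayley_cayleyInv (ne_one_of_mem_ball hw2)]
        exact ball_subset_ball (min_le_right _ _) hw1)
      (J := {x | 0 < x ∧ x / (1 + x) ∈ ball t η})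
      ⟨by
        rintro x ⟨hx, hxt⟩ y ⟨hy, hyt⟩ z ⟨hxz, hzy⟩
        have hz : 0 < z := hx.trans_le hxz
        rw [Real.ball_eq_Ioo] at hxt hyt ⊢
        exact ⟨hz, hxt.1.trans_le (hmono x z hx hxz), (hmono z y hz hzy).trans_lt hyt.2⟩⟩
      (fun x hx => hx.1)
      (fun x hx => ⟨h.mem x hx.1, by
        rw [← rayCurve_div hx.1.le]
        exact hηb ⟨hx.2, hIcc x hx.1⟩⟩)
      (by
        rintro x hx ⟨w, ⟨hw1, hw2⟩, hw3⟩
        refine ⟨hx, ?_⟩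
        by_contra hc
        refine hs₀b (ball_subset_ball (min_le_left _ _) hw1) ⟨x / (1 + x), ⟨hIcc x hx, hc⟩, ?_⟩
        rw [rayCurve_div hx.le, ← hw3, cayley_cayleyInv (ne_one_of_mem_ball hw2)])
      (by
        have htc : t ∈ closure (Ioo (0 : ℝ) 1) := by rwa [closure_Ioo zero_ne_one]
        obtain ⟨η', hη', hηb'⟩ := Metric.mem_nhdsWithin_iff.1
          (hc t ht (ball_mem_nhds (rayCurve e t) hspos))
        obtain ⟨t', ht'1, ht'2⟩ := mem_closure_iff_nhds.1 htc _ (ball_mem_nhds t hη')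
        refine ⟨t' / (1 - t'), div_pos ht'2.1 (by linarith [ht'2.2]), rayCurve e t',
          ⟨hηb' ⟨ht'1, Ioo_subset_Icc_self ht'2⟩, rayCurve_mem_ball h ht'2⟩, ?_⟩
        rw [rayCurve, if_pos ht'2.2, cayleyInv_cayley (ne_I_of_im_nonpos (h.im_nonpos
          (div_nonneg ht'2.1.le (by linarith [ht'2.2]))))])
    refine ⟨s, hspos, cayley '' V, hVc.image _ (continuousOn_cayley.mono fun z hz =>
      (hVs hz).2.1), ?_, ?_⟩
    · rintro _ ⟨z, hz, rfl⟩
      exact ⟨cayley_mem_discSide hs.left_subset (hVs hz).1, (hVs hz).2.2⟩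
    · rintro w ⟨hw1, hw2⟩
      exact ⟨cayleyInv w, hVsup ⟨hw1.2, w, ⟨hw2, hw1.1⟩, rfl⟩,
        cayley_cayleyInv (ne_one_of_mem_ball hw1.1)⟩
  rcases hq with ⟨t, ht, htq⟩ | ⟨hq1, hq2⟩
  · exact hcurve t ht htq
  · rcases hq2.eq_or_lt with hq2 | hq2
    · have him : q.im = 0 := by simpa [hσ] using hq2.symm
      rcases eq_one_or_neg_one hq1 him with rfl | rfl
      · exact hcurve 0 (by simp) (rayCurve_zero h)
      · exact hcurve 1 (by simp) rayCurve_one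
    · obtain ⟨s, hs0, hsb⟩ := Metric.eventually_nhds_iff_ball.1
        (eventually_mem_discSide hq1 hq2 hD)
      refine ⟨min s r, lt_min hs0 hr, ball q (min s r) ∩ ball 0 1,
        ((convex_ball _ _).inter (convex_ball _ _)).isPreconnected, ?_, ?_⟩
      · rintro w ⟨hw1, hw2⟩
        exact ⟨hsb w (ball_subset_ball (min_le_left _ _) hw1) hw2,
          ball_subset_ball (min_le_right _ _) hw1⟩
      · rintro w ⟨hw1, hw2⟩
        exact ⟨hw2, hw1.1⟩

end DiscSides

section ConeExtension

open Filter Topology Metric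

theorem IsCompact.continuousOn_of_leftInvOn {X Y : Type*} [TopologicalSpace X]
    [TopologicalSpace Y] [T2Space Y] {K : Set X} (hK : IsCompact K) {f : X → Y} {g : Y → X}
    (hf : ContinuousOn f K) (hg : LeftInvOn g f K) : ContinuousOn g (f '' K) := by
  rw [continuousOn_iff_isClosed]
  intro t ht
  refine ⟨f '' (K ∩ t), ((hK.inter_right ht).image_of_continuousOn
    (hf.mono inter_subset_left)).isClosed, ?_⟩
  ext y
  constructor
  · rintro ⟨hy, x, hx, rfl⟩
    refine ⟨⟨x, ⟨hx, ?_⟩, rfl⟩, x, hx, rfl⟩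
    rw [mem_preimage, hg hx] at hy
    exact hy
  · rintro ⟨⟨x, ⟨hx, hxt⟩, rfl⟩, -⟩
    exact ⟨by rw [mem_preimage, hg hx]; exact hxt, x, hx, rfl⟩

/-- The radial extension of a self-map of the unit circle. -/
noncomputable def radialExtension (κ : ℂ → ℂ) (w : ℂ) : ℂ := ‖w‖ • κ (‖w‖⁻¹ • w)

variable {κ : ℂ → ℂ}

theorem norm_inv_smul_mem_sphere {w : ℂ} (hw : w ≠ 0) : ‖w‖⁻¹ • w ∈ sphere (0 : ℂ) 1 := by
  rw [mem_sphere_zero_iff_norm, norm_smul, norm_inv, norm_norm,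
    inv_mul_cancel₀ (norm_ne_zero_iff.2 hw)]

theorem norm_radialExtension (hκ : MapsTo κ (sphere 0 1) (sphere 0 1)) (w : ℂ) :
    ‖radialExtension κ w‖ = ‖w‖ := by
  rcases eq_or_ne w 0 with rfl | hw
  · simp [radialExtension]
  · rw [radialExtension, norm_smul, norm_norm,
      mem_sphere_zero_iff_norm.1 (hκ (norm_inv_smul_mem_sphere hw)), mul_one]

theorem radialExtension_of_norm_eq_one {w : ℂ} (hw : ‖w‖ = 1) : radialExtension κ w = κ w := by
  simp [radialExtension, hw]

theorem continuous_radialExtension (hc : ContinuousOn κ (sphere 0 1))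
    (hκ : MapsTo κ (sphere 0 1) (sphere 0 1)) : Continuous (radialExtension κ) := by
  rw [continuous_iff_continuousAt]
  intro w
  rcases eq_or_ne w 0 with rfl | hw
  · unfold ContinuousAt
    rw [show radialExtension κ 0 = 0 by simp [radialExtension], tendsto_zero_iff_norm_tendsto_zero]
    simp only [norm_radialExtension hκ]
    exact tendsto_norm_zero
  · have h1 : ContinuousOn (radialExtension κ) {0}ᶜ := by
      have h2 : ContinuousOn (fun w : ℂ => ‖w‖⁻¹ • w) {0}ᶜ :=
        (continuous_norm.continuousOn.inv₀ fun w hw => norm_ne_zero_iff.2 hw).smul continuousOn_id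
      exact continuous_norm.continuousOn.smul
        (hc.comp h2 fun w hw => norm_inv_smul_mem_sphere hw)
    exact h1.continuousAt (isOpen_compl_singleton.mem_nhds hw)

theorem bijective_radialExtension (hκ : BijOn κ (sphere 0 1) (sphere 0 1)) :
    Function.Bijective (radialExtension κ) := by
  constructor
  · intro w w' h
    have hn : ‖w‖ = ‖w'‖ := by
      rw [← norm_radialExtension hκ.mapsTo w, h, norm_radialExtension hκ.mapsTo]
    rcases eq_or_ne w 0 with rfl | hw
    · rw [norm_zero] at hn
      exact (norm_eq_zero.1 hn.symm).symm
    · have hn0 := norm_ne_zero_iff.2 hw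
      have hw' : w' ≠ 0 := by rw [← norm_ne_zero_iff, ← hn]; exact hn0
      unfold radialExtension at h
      rw [← hn] at h
      have h1 := smul_right_injective ℂ hn0 h
      have h2 := hκ.injOn (norm_inv_smul_mem_sphere hw)
        (by rw [hn]; exact norm_inv_smul_mem_sphere hw') h1
      exact smul_right_injective ℂ (inv_ne_zero hn0) h2
  · intro w
    rcases eq_or_ne w 0 with rfl | hw
    · exact ⟨0, by simp [radialExtension]⟩
    · obtain ⟨v, hv, hvw⟩ := hκ.surjOn (norm_inv_smul_mem_sphere hw)
      have hn0 := norm_ne_zero_iff.2 hw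
      rw [mem_sphere_zero_iff_norm] at hv
      refine ⟨‖w‖ • v, ?_⟩
      have h1 : ‖‖w‖ • v‖ = ‖w‖ := by rw [norm_smul, norm_norm, hv, mul_one]
      rw [radialExtension, h1, smul_smul, inv_mul_cancel₀ hn0, one_smul, hvw, smul_smul,
        mul_inv_cancel₀ hn0, one_smul]

/-- A homeomorphism between the frontiers of two Jordan domains extends to their closures. -/
theorem exists_extension_of_bijOn_frontier {U₁ U₂ : Set ℂ} {Φ₁ Φ₂ f : ℂ → ℂ}
    (hb₁ : Bornology.IsBounded U₁) (hb₂ : Bornology.IsBounded U₂)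
    (hc₁ : ContinuousOn Φ₁ (closure U₁)) (hc₂ : ContinuousOn Φ₂ (closure U₂))
    (h₁ : BijOn Φ₁ (closure U₁) (closedBall 0 1)) (h₂ : BijOn Φ₂ (closure U₂) (closedBall 0 1))
    (hU₁ : ∀ z ∈ closure U₁, (‖Φ₁ z‖ < 1 ↔ z ∈ U₁))
    (hU₂ : ∀ z ∈ closure U₂, (‖Φ₂ z‖ < 1 ↔ z ∈ U₂))
    (hf : ContinuousOn f (closure U₁ \ U₁))
    (hfb : BijOn f (closure U₁ \ U₁) (closure U₂ \ U₂)) :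
    ∃ F : ℂ → ℂ, ContinuousOn F (closure U₁) ∧ BijOn F (closure U₁) (closure U₂) ∧
      EqOn F f (closure U₁ \ U₁) ∧ ∀ z ∈ closure U₁, F z ∈ U₂ → z ∈ U₁ := by
  have hK₁ : IsCompact (closure U₁) := hb₁.isCompact_closure
  have hK₂ : IsCompact (closure U₂) := hb₂.isCompact_closure
  set Ψ₁ := Function.invFunOn Φ₁ (closure U₁) with hΨ₁
  set Ψ₂ := Function.invFunOn Φ₂ (closure U₂) with hΨ₂
  have i₁ : InvOn Ψ₁ Φ₁ (closure U₁) (closedBall 0 1) := h₁.invOn_invFunOn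
  have i₂ : InvOn Ψ₂ Φ₂ (closure U₂) (closedBall 0 1) := h₂.invOn_invFunOn
  have m₁ : BijOn Ψ₁ (closedBall 0 1) (closure U₁) := (Set.bijOn_comm ⟨i₁.2, i₁.1⟩).1 h₁
  have m₂ : BijOn Ψ₂ (closedBall 0 1) (closure U₂) := (Set.bijOn_comm ⟨i₂.2, i₂.1⟩).1 h₂
  have cΨ₁ : ContinuousOn Ψ₁ (closedBall 0 1) := by
    rw [← h₁.image_eq]; exact hK₁.continuousOn_of_leftInvOn hc₁ i₁.1
  have cΨ₂ : ContinuousOn Ψ₂ (closedBall 0 1) := by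
    rw [← h₂.image_eq]; exact hK₂.continuousOn_of_leftInvOn hc₂ i₂.1
  have fr : ∀ {U : Set ℂ} {Φ : ℂ → ℂ}, BijOn Φ (closure U) (closedBall 0 1) →
      (∀ z ∈ closure U, (‖Φ z‖ < 1 ↔ z ∈ U)) → BijOn Φ (closure U \ U) (sphere 0 1) := by
    intro U Φ hΦ hU
    refine ⟨fun z hz => ?_, hΦ.injOn.mono sdiff_subset, fun w hw => ?_⟩
    · have h1 := hΦ.mapsTo hz.1
      rw [mem_closedBall_zero_iff] at h1
      rw [mem_sphere_zero_iff_norm]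
      exact le_antisymm h1 (not_lt.1 fun hc => hz.2 ((hU z hz.1).1 hc))
    · obtain ⟨z, hz, rfl⟩ := hΦ.surjOn (sphere_subset_closedBall hw)
      refine ⟨z, ⟨hz, fun hc => ?_⟩, rfl⟩
      have := (hU z hz).2 hc
      rw [mem_sphere_zero_iff_norm] at hw
      linarith
  have fr₁ := fr h₁ hU₁
  have fr₂ := fr h₂ hU₂
  have hsub : sphere (0 : ℂ) 1 ⊆ closedBall 0 1 := sphere_subset_closedBall
  have fΨ₁ : BijOn Ψ₁ (sphere 0 1) (closure U₁ \ U₁) :=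
    (Set.bijOn_comm ⟨i₁.2.mono hsub, i₁.1.mono sdiff_subset⟩).1 fr₁
  set κ : ℂ → ℂ := fun w => Φ₂ (f (Ψ₁ w)) with hκ
  have hκb : BijOn κ (sphere 0 1) (sphere 0 1) := fr₂.comp (hfb.comp fΨ₁)
  have hκc : ContinuousOn κ (sphere 0 1) :=
    (hc₂.mono sdiff_subset).comp (hf.comp (cΨ₁.mono hsub) fΨ₁.mapsTo)
      (hfb.mapsTo.comp fΨ₁.mapsTo)
  set g := radialExtension κ with hg
  have hgn : ∀ w, ‖g w‖ = ‖w‖ := norm_radialExtension hκb.mapsTo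
  have hgb : BijOn g (closedBall 0 1) (closedBall 0 1) := by
    have hbij := bijective_radialExtension hκb
    refine ⟨fun w hw => ?_, hbij.1.injOn, fun w hw => ?_⟩
    · rw [mem_closedBall_zero_iff] at hw ⊢
      rwa [hgn]
    · obtain ⟨v, rfl⟩ := hbij.2 w
      rw [mem_closedBall_zero_iff, hgn] at hw
      exact ⟨v, mem_closedBall_zero_iff.2 hw, rfl⟩
  refine ⟨fun z => Ψ₂ (g (Φ₁ z)), ?_, m₂.comp (hgb.comp h₁), fun z hz => ?_, fun z hz hzU => ?_⟩
  · exact cΨ₂.comp ((continuous_radialExtension hκc hκb.mapsTo).comp_continuousOn hc₁)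
      (hgb.mapsTo.comp h₁.mapsTo)
  · dsimp only
    rw [hg, radialExtension_of_norm_eq_one (mem_sphere_zero_iff_norm.1 (fr₁.mapsTo hz)), hκ]
    dsimp only
    rw [i₁.1 hz.1, i₂.1 (hfb.mapsTo hz).1]
  · have h1 := hgb.mapsTo (h₁.mapsTo hz)
    have h2 := (hU₂ _ (m₂.mapsTo h1)).2 hzU
    rw [i₂.2 h1, hgn] at h2
    exact (hU₁ z hz).1 h2

end ConeExtension

section DiscGluing

open Filter Topology Metric

/-- `U` is the part of the unit disc between the curve `c` and the half circle singled out by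
the sign `σ`, and its closure is a closed disc. -/
structure IsDiscHalf (c : ℝ → ℂ) (σ : ℝ) (U : Set ℂ) : Prop where
  isOpen : IsOpen U
  subset_ball : U ⊆ ball 0 1
  closure_diff : closure U \ U = c '' Icc 0 1 ∪ {q | ‖q‖ = 1 ∧ 0 ≤ σ * q.im}
  exists_chart : ∃ Φ : ℂ → ℂ, ContinuousOn Φ (closure U) ∧ BijOn Φ (closure U) (closedBall 0 1) ∧
    ∀ z ∈ closure U, (‖Φ z‖ < 1 ↔ z ∈ U)

theorem IsDiscHalf.of_isRaySides {e : ℂ ≃ₜ ℂ} {D E : Set ℂ} {σ : ℝ} (h : IsLowerRay e)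
    (hs : IsRaySides e D E) (hσ : σ ≠ 0)
    (hD : ∀ a : ℝ, 0 < σ * a → ∀ᶠ z in 𝓝 (a : ℂ), z ∈ lowerHalf → z ∈ D)
    (hE : ∀ a : ℝ, σ * a < 0 → ∀ᶠ z in 𝓝 (a : ℂ), z ∈ lowerHalf → z ∈ E) :
    IsDiscHalf (rayCurve e) σ (discSide D) where
  isOpen := isOpen_discSide hs.isOpen_left
  subset_ball := discSide_subset D
  closure_diff := hs.closure_diff h hσ hD hE
  exists_chart := by
    have := hs.contractibleSpace h
    exact exists_bijOn_closure_closedBall (isOpen_discSide hs.isOpen_left)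
      (isSimplyConnected_discSide hs.left_subset) (discSide_subset D)
      (hs.locallyConnectedAtFrontier h hσ hD hE)

theorem IsLowerRay.exists_isDiscHalf {e : ℂ ≃ₜ ℂ} (h : IsLowerRay e) :
    ∃ U V : Set ℂ, IsDiscHalf (rayCurve e) 1 U ∧ IsDiscHalf (rayCurve e) (-1) V ∧
      Disjoint U V ∧ ∀ q ∈ ball (0 : ℂ) 1, q ∈ U ∨ q ∈ V ∨ q ∈ rayCurve e '' Icc 0 1 := by
  obtain ⟨e', he, h', D, E, hs, hD, hE⟩ := h.exists_isRaySides
  have hc : rayCurve e = rayCurve e' := rayCurve_congr fun x => (he x).symm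
  have hc' : rayCurve e = rayCurve e'.conj := rayCurve_congr fun x => by simp [he]
  refine ⟨discSide D, discSide E, ?_, ?_, disjoint_discSide hs, fun q hq => ?_⟩
  · rw [hc]
    exact .of_isRaySides h' hs one_ne_zero (by simpa using hD) (by simpa using hE)
  · rw [hc']
    exact .of_isRaySides h'.conj hs.conj (by norm_num) (by simpa using hE) (by simpa using hD)
  · rw [hc]
    rcases hs.mem_discSide_or hq with h1 | h1 | ⟨s, hs', h1⟩
    exacts [Or.inl h1, Or.inr (Or.inl h1), Or.inr (Or.inr ⟨s, Ioo_subset_Icc_self hs', h1⟩)]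

theorem IsDiscHalf.exists_extension {c₁ c₂ : ℝ → ℂ} {σ : ℝ} {U₁ U₂ : Set ℂ} {f : ℂ → ℂ}
    (h₁ : IsDiscHalf c₁ σ U₁) (h₂ : IsDiscHalf c₂ σ U₂)
    (hf : ContinuousOn f (c₁ '' Icc 0 1 ∪ {q | 1 ≤ ‖q‖}))
    (hfi : InjOn f (c₁ '' Icc 0 1 ∪ {q | 1 ≤ ‖q‖}))
    (hfc : ∀ s ∈ Icc (0 : ℝ) 1, f (c₁ s) = c₂ s) (hf1 : ∀ q : ℂ, 1 ≤ ‖q‖ → f q = q) :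
    ∃ F : ℂ → ℂ, ContinuousOn F (closure U₁) ∧ BijOn F U₁ U₂ ∧ F '' closure U₁ = closure U₂ ∧
      EqOn F f (closure U₁ \ U₁) := by
  obtain ⟨Φ₁, hc₁, hb₁, hi₁⟩ := h₁.exists_chart
  obtain ⟨Φ₂, hc₂, hb₂, hi₂⟩ := h₂.exists_chart
  have hsub : closure U₁ \ U₁ ⊆ c₁ '' Icc 0 1 ∪ {q | 1 ≤ ‖q‖} := by
    rw [h₁.closure_diff]
    exact union_subset_union_right _ fun q hq => hq.1.ge
  have himg : f '' (closure U₁ \ U₁) = closure U₂ \ U₂ := by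
    rw [h₁.closure_diff, h₂.closure_diff, image_union, image_image]
    congr 1
    · exact image_congr hfc
    · have : EqOn f id {q : ℂ | ‖q‖ = 1 ∧ 0 ≤ σ * q.im} := fun q hq => hf1 q hq.1.ge
      rw [this.image_eq, image_id]
  have hbij : BijOn f (closure U₁ \ U₁) (closure U₂ \ U₂) := by
    rw [← himg]; exact (hfi.mono hsub).bijOn_image
  obtain ⟨F, hFc, hFb, hFf, hFU⟩ := exists_extension_of_bijOn_frontier
    (isBounded_ball.subset h₁.subset_ball) (isBounded_ball.subset h₂.subset_ball) hc₁ hc₂ hb₁ hb₂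
    hi₁ hi₂ (hf.mono hsub) hbij
  refine ⟨F, hFc, ⟨fun z hz => ?_, hFb.injOn.mono subset_closure, fun w hw => ?_⟩,
    hFb.image_eq, hFf⟩
  · by_contra hcon
    obtain ⟨q, hq, hqz⟩ := hbij.surjOn ⟨hFb.mapsTo (subset_closure hz), hcon⟩
    rw [← hFf hq] at hqz
    exact hq.2 (hFb.injOn hq.1 (subset_closure hz) hqz ▸ hz)
  · obtain ⟨z, hz, rfl⟩ := hFb.surjOn (subset_closure hw)
    exact ⟨z, hFU z hz hw, rfl⟩

open Classical in
/-- Map one curve in the disc to another one, and fix everything outside the open disc. -/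
noncomputable def curveTransport (c₁ c₂ : ℝ → ℂ) (q : ℂ) : ℂ :=
  if 1 ≤ ‖q‖ then q else c₂ (Function.invFunOn c₁ (Icc 0 1) q)

variable {e₁ e₂ : ℂ ≃ₜ ℂ}

theorem curveTransport_of_le {c₁ c₂ : ℝ → ℂ} {q : ℂ} (hq : 1 ≤ ‖q‖) :
    curveTransport c₁ c₂ q = q := if_pos hq

theorem curveTransport_rayCurve (h₁ : IsLowerRay e₁) (h₂ : IsLowerRay e₂) {s : ℝ}
    (hs : s ∈ Icc (0 : ℝ) 1) :
    curveTransport (rayCurve e₁) (rayCurve e₂) (rayCurve e₁ s) = rayCurve e₂ s := by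
  rcases hs.1.eq_or_lt with rfl | h0
  · rw [rayCurve_zero h₁, rayCurve_zero h₂, curveTransport_of_le (by simp)]
  rcases hs.2.eq_or_lt with rfl | h1
  · rw [rayCurve_one, rayCurve_one, curveTransport_of_le (by simp)]
  · have h2 := rayCurve_mem_ball h₁ ⟨h0, h1⟩
    rw [mem_ball_zero_iff] at h2
    rw [curveTransport, if_neg (not_le.2 h2), (injOn_rayCurve h₁).leftInvOn_invFunOn hs]

theorem continuousOn_curveTransport (h₁ : IsLowerRay e₁) (h₂ : IsLowerRay e₂) :
    ContinuousOn (curveTransport (rayCurve e₁) (rayCurve e₂))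
      (rayCurve e₁ '' Icc 0 1 ∪ {q | 1 ≤ ‖q‖}) := by
  have hc₁ := continuousOn_rayCurve h₁
  refine ContinuousOn.union_of_isClosed ?_ ?_ (isCompact_Icc.image_of_continuousOn hc₁).isClosed
    (isClosed_le continuous_const continuous_norm)
  · have hl := (injOn_rayCurve h₁).leftInvOn_invFunOn
    have h3 : ContinuousOn (rayCurve e₂ ∘ Function.invFunOn (rayCurve e₁) (Icc 0 1))
        (rayCurve e₁ '' Icc 0 1) := by
      refine (continuousOn_rayCurve h₂).comp
        (isCompact_Icc.continuousOn_of_leftInvOn hc₁ hl) ?_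
      rintro _ ⟨s, hs, rfl⟩
      rwa [hl hs]
    refine h3.congr ?_
    rintro _ ⟨s, hs, rfl⟩
    rw [curveTransport_rayCurve h₁ h₂ hs, Function.comp_apply, hl hs]
  · exact continuousOn_id.congr fun q hq => curveTransport_of_le hq

theorem mem_ball_of_norm_rayCurve_lt (h₁ : IsLowerRay e₁) {s : ℝ} (hs : s ∈ Icc (0 : ℝ) 1)
    (hn : ‖rayCurve e₁ s‖ < 1) : s ∈ Ioo (0 : ℝ) 1 := by
  refine ⟨hs.1.lt_of_ne' ?_, hs.2.lt_of_ne ?_⟩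
  · rintro rfl; simp [rayCurve_zero h₁] at hn
  · rintro rfl; simp [rayCurve_one] at hn

theorem injOn_curveTransport (h₁ : IsLowerRay e₁) (h₂ : IsLowerRay e₂) :
    InjOn (curveTransport (rayCurve e₁) (rayCurve e₂))
      (rayCurve e₁ '' Icc 0 1 ∪ {q | 1 ≤ ‖q‖}) := by
  have key : ∀ q ∈ rayCurve e₁ '' Icc 0 1 ∪ {q | 1 ≤ ‖q‖}, 1 ≤ ‖q‖ ∨
      ∃ s ∈ Icc (0 : ℝ) 1, rayCurve e₁ s = q ∧ ‖rayCurve e₂ s‖ < 1 := by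
    rintro q (⟨s, hs, rfl⟩ | hq)
    · rcases le_or_gt 1 ‖rayCurve e₁ s‖ with h | h
      · exact Or.inl h
      · exact Or.inr ⟨s, hs, rfl, mem_ball_zero_iff.1
          (rayCurve_mem_ball h₂ (mem_ball_of_norm_rayCurve_lt h₁ hs h))⟩
    · exact Or.inl hq
  intro q hq q' hq' heq
  rcases key q hq with h | ⟨s, hs, rfl, hn⟩ <;> rcases key q' hq' with h' | ⟨t, ht, rfl, hn'⟩
  · rwa [curveTransport_of_le h, curveTransport_of_le h'] at heq
  · rw [curveTransport_of_le h, curveTransport_rayCurve h₁ h₂ ht] at heq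
    rw [← heq] at hn'
    exact absurd hn' (not_lt.2 h)
  · rw [curveTransport_of_le h', curveTransport_rayCurve h₁ h₂ hs] at heq
    rw [heq] at hn
    exact absurd hn (not_lt.2 h')
  · rw [curveTransport_rayCurve h₁ h₂ ht, curveTransport_rayCurve h₁ h₂ hs] at heq
    rw [injOn_rayCurve h₂ hs ht heq]

/-- Any two curves in the closed disc that come from rays in the lower half plane are related by
a homeomorphism of the plane that is supported in the disc. -/
theorem exists_disc_transport (h₁ : IsLowerRay e₁) (h₂ : IsLowerRay e₂) :
    ∃ F : ℂ → ℂ, Continuous F ∧ Function.Bijective F ∧ (∀ q : ℂ, 1 ≤ ‖q‖ → F q = q) ∧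
      ∀ s ∈ Icc (0 : ℝ) 1, F (rayCurve e₁ s) = rayCurve e₂ s := by
  classical
  obtain ⟨U₁, V₁, hU₁, hV₁, hd₁, hcov₁⟩ := h₁.exists_isDiscHalf
  obtain ⟨U₂, V₂, hU₂, hV₂, hd₂, hcov₂⟩ := h₂.exists_isDiscHalf
  set f := curveTransport (rayCurve e₁) (rayCurve e₂) with hf
  have hfc := continuousOn_curveTransport h₁ h₂
  have hfi := injOn_curveTransport h₁ h₂
  have hfs : ∀ s ∈ Icc (0 : ℝ) 1, f (rayCurve e₁ s) = rayCurve e₂ s :=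
    fun s hs => curveTransport_rayCurve h₁ h₂ hs
  have hf1 : ∀ q : ℂ, 1 ≤ ‖q‖ → f q = q := fun q hq => curveTransport_of_le hq
  obtain ⟨F₁, hF₁c, hF₁b, hF₁s, hF₁f⟩ := hU₁.exists_extension hU₂ hfc hfi hfs hf1
  obtain ⟨F₂, hF₂c, hF₂b, hF₂s, hF₂f⟩ := hV₁.exists_extension hV₂ hfc hfi hfs hf1
  set F : ℂ → ℂ := fun z => if z ∈ closure U₁ then F₁ z else if z ∈ closure V₁ then F₂ z else z
    with hF
  have hnot : ∀ z ∈ closure U₁, z ∈ closure V₁ → z ∉ U₁ ∧ z ∉ V₁ := fun z h h' =>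
    ⟨fun hz => Set.disjoint_left.1 (hd₁.closure_right hU₁.isOpen) hz h',
      fun hz => Set.disjoint_left.1 (hd₁.closure_left hV₁.isOpen) h hz⟩
  have hU : EqOn F F₁ (closure U₁) := fun z hz => if_pos hz
  have hV : EqOn F F₂ (closure V₁) := by
    intro z hz
    by_cases h : z ∈ closure U₁
    · rw [hU h, hF₁f ⟨h, (hnot z h hz).1⟩, hF₂f ⟨hz, (hnot z h hz).2⟩]
    · rw [hF]; simp only [if_neg h, if_pos hz]
  have hB : EqOn F f (rayCurve e₁ '' Icc 0 1 ∪ {q | 1 ≤ ‖q‖}) := by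
    intro z hz
    by_cases h : z ∈ closure U₁ \ U₁
    · rw [hU h.1, hF₁f h]
    by_cases h' : z ∈ closure V₁ \ V₁
    · rw [hV h'.1, hF₂f h']
    have hzn : 1 ≤ ‖z‖ := hz.resolve_left fun hc => h (hU₁.closure_diff ▸ Or.inl hc)
    have hb : z ∉ ball (0 : ℂ) 1 := by rwa [mem_ball_zero_iff, not_lt]
    have hzU : z ∉ closure U₁ := fun hc => h ⟨hc, fun hc => hb (hU₁.subset_ball hc)⟩
    have hzV : z ∉ closure V₁ := fun hc => h' ⟨hc, fun hc => hb (hV₁.subset_ball hc)⟩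
    rw [hF, hf1 z hzn]
    simp only [if_neg hzU, if_neg hzV]
  have hcov : ∀ {e : ℂ ≃ₜ ℂ} {U V : Set ℂ}, (∀ q ∈ ball (0 : ℂ) 1, q ∈ U ∨ q ∈ V ∨
      q ∈ rayCurve e '' Icc 0 1) → ∀ q, q ∈ U ∨ q ∈ V ∨ q ∈ rayCurve e '' Icc 0 1 ∪ {q | 1 ≤ ‖q‖} := by
    intro e U V h q
    rcases lt_or_ge ‖q‖ 1 with h1 | h1
    · rcases h q (mem_ball_zero_iff.2 h1) with h2 | h2 | h2
      exacts [Or.inl h2, Or.inr (Or.inl h2), Or.inr (Or.inr (Or.inl h2))]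
    · exact Or.inr (Or.inr (Or.inr h1))
  have hFB : ∀ z ∈ rayCurve e₁ '' Icc 0 1 ∪ {q | 1 ≤ ‖q‖},
      F z ∈ rayCurve e₂ '' Icc 0 1 ∪ {q | 1 ≤ ‖q‖} := by
    intro z hz
    rw [hB hz]
    rcases hz with ⟨s, hs, rfl⟩ | hz
    · rw [hfs s hs]; exact Or.inl ⟨s, hs, rfl⟩
    · rw [hf1 z hz]; exact Or.inr hz
  have hdB : ∀ {e : ℂ ≃ₜ ℂ} {U : Set ℂ} {σ : ℝ}, IsDiscHalf (rayCurve e) σ U → ∀ q ∈ U,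
      q ∉ rayCurve e '' Icc 0 1 ∪ {q | 1 ≤ ‖q‖} := by
    rintro e U σ h q hq (hc | hc)
    · have : q ∈ closure U \ U := h.closure_diff ▸ Or.inl hc
      exact this.2 hq
    · exact absurd (mem_ball_zero_iff.1 (h.subset_ball hq)) (not_lt.2 hc)
  have hFU : BijOn F U₁ U₂ := hF₁b.congr fun z hz => (hU (subset_closure hz)).symm
  have hFV : BijOn F V₁ V₂ := hF₂b.congr fun z hz => (hV (subset_closure hz)).symm
  refine ⟨F, ?_, ⟨fun z z' h => ?_, fun w => ?_⟩, fun q hq => ?_, fun s hs => ?_⟩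
  · rw [← continuousOn_univ]
    have h1 : ContinuousOn F (closure U₁ ∪ closure V₁) :=
      ContinuousOn.union_of_isClosed (hF₁c.congr hU) (hF₂c.congr hV) isClosed_closure
        isClosed_closure
    have h2 : IsClosed (rayCurve e₁ '' Icc 0 1 ∪ {q | 1 ≤ ‖q‖}) :=
      (isCompact_Icc.image_of_continuousOn (continuousOn_rayCurve h₁)).isClosed.union
        (isClosed_le continuous_const continuous_norm)
    refine (h1.union_of_isClosed (hfc.congr hB) (isClosed_closure.union isClosed_closure)
      h2).mono fun z _ => ?_
    rcases hcov hcov₁ z with h | h | h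
    exacts [Or.inl (Or.inl (subset_closure h)), Or.inl (Or.inr (subset_closure h)), Or.inr h]
  · rcases hcov hcov₁ z with hz | hz | hz <;> rcases hcov hcov₁ z' with hz' | hz' | hz'
    · exact hFU.injOn hz hz' h
    · exact absurd (h ▸ hFV.mapsTo hz') (Set.disjoint_left.1 hd₂ (hFU.mapsTo hz))
    · exact absurd (h ▸ hFB _ hz') (hdB hU₂ _ (hFU.mapsTo hz))
    · exact absurd (h ▸ hFU.mapsTo hz') (Set.disjoint_right.1 hd₂ (hFV.mapsTo hz))
    · exact hFV.injOn hz hz' h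
    · exact absurd (h ▸ hFB _ hz') (hdB hV₂ _ (hFV.mapsTo hz))
    · exact absurd (h.symm ▸ hFB _ hz) (hdB hU₂ _ (hFU.mapsTo hz'))
    · exact absurd (h.symm ▸ hFB _ hz) (hdB hV₂ _ (hFV.mapsTo hz'))
    · rw [hB hz, hB hz'] at h
      exact hfi hz hz' h
  · rcases hcov hcov₂ w with hw | hw | ⟨s, hs, rfl⟩ | hw
    · obtain ⟨z, -, h⟩ := hFU.surjOn hw; exact ⟨z, h⟩
    · obtain ⟨z, -, h⟩ := hFV.surjOn hw; exact ⟨z, h⟩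
    · exact ⟨rayCurve e₁ s, by rw [hB (Or.inl ⟨s, hs, rfl⟩), hfs s hs]⟩
    · exact ⟨w, by rw [hB (Or.inr hw), hf1 w hw]⟩
  · rw [hB (Or.inr hq), hf1 q hq]
  · rw [hB (Or.inl ⟨s, hs, rfl⟩), hfs s hs]

end DiscGluing

section RayTransport

open Filter Topology Metric

theorem mapsTo_ball_of_fixes {F : ℂ → ℂ} (hF : Function.Injective F)
    (hfix : ∀ q : ℂ, 1 ≤ ‖q‖ → F q = q) {q : ℂ} (hq : ‖q‖ < 1) : ‖F q‖ < 1 := by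
  by_contra hc
  have h1 := hF (hfix _ (not_lt.1 hc))
  rw [h1] at hc
  exact hc hq

/-- A continuous bijection of the plane that fixes everything outside the open unit disc is a
homeomorphism. -/
theorem exists_homeomorph_of_fixes {F : ℂ → ℂ} (hc : Continuous F) (hF : Function.Bijective F)
    (hfix : ∀ q : ℂ, 1 ≤ ‖q‖ → F q = q) : ∃ G : ℂ ≃ₜ ℂ, ∀ z, G z = F z := by
  set E := Equiv.ofBijective F hF with hE
  have hEF : ∀ z, E z = F z := fun z => rfl
  have himg : F '' closedBall 0 1 = closedBall 0 1 := by
    ext w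
    simp only [mem_image, mem_closedBall_zero_iff]
    constructor
    · rintro ⟨z, hz, rfl⟩
      rcases hz.lt_or_eq with h | h
      · exact (mapsTo_ball_of_fixes hF.1 hfix h).le
      · rwa [hfix z h.ge]
    · intro hw
      obtain ⟨z, rfl⟩ := hF.2 w
      refine ⟨z, ?_, rfl⟩
      by_contra hz
      rw [hfix z (not_le.1 hz).le] at hw
      exact hz hw
  have h1 : ContinuousOn E.symm (closedBall 0 1) := by
    rw [← himg]
    exact (isCompact_closedBall 0 1).continuousOn_of_leftInvOn hc.continuousOn
      fun z _ => E.symm_apply_apply z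
  have h2 : ContinuousOn E.symm {q | 1 ≤ ‖q‖} := by
    refine continuousOn_id.congr fun q hq => ?_
    rw [E.symm_apply_eq, hEF, id, hfix q hq]
  have h3 : Continuous E.symm := by
    rw [← continuousOn_univ]
    refine (h1.union_of_isClosed h2 isClosed_closedBall
      (isClosed_le continuous_const continuous_norm)).mono fun q _ => ?_
    rcases le_total ‖q‖ 1 with h | h
    exacts [Or.inl (mem_closedBall_zero_iff.2 h), Or.inr h]
  exact ⟨⟨E, hc, h3⟩, fun _ => rfl⟩

open Classical in
/-- Transfer a self-map of the disc to the closed lower half plane, and extend it by the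
identity. -/
noncomputable def lowerTransfer (F : ℂ → ℂ) (z : ℂ) : ℂ :=
  if z.im ≤ 0 then cayleyInv (F (cayley z)) else z

theorem norm_cayley_eq_one {z : ℂ} (hz : z.im = 0) : ‖cayley z‖ = 1 := by
  have hI := ne_I_of_im_nonpos hz.le
  refine le_antisymm (norm_cayley_le_one hz.le) (not_lt.1 fun hc => ?_)
  have : z.im < 0 := (norm_cayley_lt_one_iff hI).1 hc
  linarith

theorem lowerTransfer_of_nonneg {F : ℂ → ℂ} (hfix : ∀ q : ℂ, 1 ≤ ‖q‖ → F q = q) {z : ℂ}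
    (hz : 0 ≤ z.im) : lowerTransfer F z = z := by
  unfold lowerTransfer
  split_ifs with h
  · have h0 := le_antisymm h hz
    rw [hfix _ (norm_cayley_eq_one h0).ge, cayleyInv_cayley (ne_I_of_im_nonpos h)]
  · rfl

theorem apply_cayley_ne_one {F : ℂ → ℂ} (hF : Function.Injective F)
    (hfix : ∀ q : ℂ, 1 ≤ ‖q‖ → F q = q) {z : ℂ} (hz : z.im ≤ 0) : F (cayley z) ≠ 1 := by
  intro h
  rw [← hfix 1 (by simp)] at h
  exact cayley_ne_one (ne_I_of_im_nonpos hz) (hF h)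

theorem continuous_lowerTransfer {F : ℂ → ℂ} (hc : Continuous F) (hF : Function.Injective F)
    (hfix : ∀ q : ℂ, 1 ≤ ‖q‖ → F q = q) : Continuous (lowerTransfer F) := by
  have h1 : ContinuousOn (lowerTransfer F) {z | z.im ≤ 0} := by
    have : ContinuousOn (fun z => cayleyInv (F (cayley z))) {z | z.im ≤ 0} := fun z hz =>
      (ContinuousAt.comp' (f := fun z => F (cayley z))
        (continuousAt_cayleyInv (apply_cayley_ne_one hF hfix hz))
        (hc.continuousAt.comp' (continuousAt_cayley (ne_I_of_im_nonpos hz)))).continuousWithinAt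
    exact this.congr fun z hz => if_pos hz
  have h2 : ContinuousOn (lowerTransfer F) {z | 0 ≤ z.im} :=
    continuousOn_id.congr fun z hz => lowerTransfer_of_nonneg hfix hz
  rw [← continuousOn_univ]
  refine (h1.union_of_isClosed h2 (isClosed_le Complex.continuous_im continuous_const)
    (isClosed_le continuous_const Complex.continuous_im)).mono fun z _ => ?_
  exact le_total z.im 0

theorem lowerTransfer_lowerTransfer {F G : ℂ → ℂ} (hF : Function.Injective F)
    (hfix : ∀ q : ℂ, 1 ≤ ‖q‖ → F q = q) (hG : ∀ q, G (F q) = q) (z : ℂ) :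
    lowerTransfer G (lowerTransfer F z) = z := by
  by_cases hz : z.im ≤ 0
  · have h1 : lowerTransfer F z = cayleyInv (F (cayley z)) := if_pos hz
    have h2 : ‖F (cayley z)‖ ≤ 1 := by
      rcases (norm_cayley_le_one hz).lt_or_eq with h | h
      · exact (mapsTo_ball_of_fixes hF hfix h).le
      · rw [hfix _ h.ge, h]
    rw [h1, lowerTransfer, if_pos (cayleyInv_im_nonpos h2),
      cayley_cayleyInv (apply_cayley_ne_one hF hfix hz), hG,
      cayleyInv_cayley (ne_I_of_im_nonpos hz)]
  · simp only [lowerTransfer, if_neg hz]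

/-- Any two rays in the lower half plane are related by a homeomorphism of the plane that fixes
the closed upper half plane. -/
theorem IsLowerRay.exists_homeomorph {e₁ e₂ : ℂ ≃ₜ ℂ} (h₁ : IsLowerRay e₁) (h₂ : IsLowerRay e₂) :
    ∃ G : ℂ ≃ₜ ℂ, (∀ z : ℂ, 0 ≤ z.im → G z = z) ∧
      ∀ x : ℝ, 0 ≤ x → G (e₁.symm x) = e₂.symm x := by
  obtain ⟨F₀, hc, hb, hfix₀, hF₀⟩ := exists_disc_transport h₁ h₂
  obtain ⟨F, hF⟩ := exists_homeomorph_of_fixes hc hb hfix₀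
  have hfix : ∀ q : ℂ, 1 ≤ ‖q‖ → F q = q := fun q hq => by rw [hF, hfix₀ q hq]
  have hfix' : ∀ q : ℂ, 1 ≤ ‖q‖ → F.symm q = q := fun q hq => by
    rw [F.symm_apply_eq, hfix q hq]
  refine ⟨⟨⟨lowerTransfer F, lowerTransfer F.symm,
    lowerTransfer_lowerTransfer F.injective hfix F.symm_apply_apply,
    lowerTransfer_lowerTransfer F.symm.injective hfix' F.apply_symm_apply⟩,
    continuous_lowerTransfer F.continuous F.injective hfix,
    continuous_lowerTransfer F.symm.continuous F.symm.injective hfix'⟩,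
    fun z hz => lowerTransfer_of_nonneg hfix hz, fun x hx => ?_⟩
  change lowerTransfer F (e₁.symm x) = _
  have hs : x / (1 + x) ∈ Icc (0 : ℝ) 1 :=
    ⟨by positivity, (div_le_one (by linarith)).2 (by linarith)⟩
  rw [lowerTransfer, if_pos (h₁.im_nonpos hx), ← rayCurve_div hx, hF, hF₀ _ hs, rayCurve_div hx,
    cayleyInv_cayley (ne_I_of_im_nonpos (h₂.im_nonpos hx))]

end RayTransport

section PairOfLines

open Filter Topology Metric

/-- The homeomorphism `(x, y) ↦ (x, c * y + f x)` of the plane. -/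
noncomputable def verticalShear (c : ℝ) (hc : c ≠ 0) (f : ℝ → ℝ) (hf : Continuous f) : ℂ ≃ₜ ℂ where
  toFun z := (z.re : ℂ) + ((c * z.im + f z.re : ℝ) : ℂ) * Complex.I
  invFun z := (z.re : ℂ) + ((c⁻¹ * (z.im - f z.re) : ℝ) : ℂ) * Complex.I
  left_inv z := by apply Complex.ext <;> simp [hc]
  right_inv z := by apply Complex.ext <;> simp [hc]
  continuous_toFun := by fun_prop
  continuous_invFun := by fun_prop

/-- The homeomorphism `(x, y) ↦ (x + f y, y)` of the plane. -/
noncomputable def horizontalShear (f : ℝ → ℝ) (hf : Continuous f) : ℂ ≃ₜ ℂ where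
  toFun z := z + (f z.im : ℂ)
  invFun z := z - (f z.im : ℂ)
  left_inv z := by simp
  right_inv z := by simp
  continuous_toFun := by fun_prop
  continuous_invFun := by fun_prop

theorem verticalShear_apply (c : ℝ) (hc : c ≠ 0) (f : ℝ → ℝ) (hf : Continuous f) (z : ℂ) :
    verticalShear c hc f hf z = (z.re : ℂ) + ((c * z.im + f z.re : ℝ) : ℂ) * Complex.I := rfl

theorem horizontalShear_apply (f : ℝ → ℝ) (hf : Continuous f) (z : ℂ) :
    horizontalShear f hf z = z + (f z.im : ℂ) := rfl

@[simp] theorem verticalShear_re (c : ℝ) (hc : c ≠ 0) (f : ℝ → ℝ) (hf : Continuous f) (z : ℂ) :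
    (verticalShear c hc f hf z).re = z.re := by simp [verticalShear_apply]

@[simp] theorem verticalShear_im (c : ℝ) (hc : c ≠ 0) (f : ℝ → ℝ) (hf : Continuous f) (z : ℂ) :
    (verticalShear c hc f hf z).im = c * z.im + f z.re := by simp [verticalShear_apply]

@[simp] theorem horizontalShear_re (f : ℝ → ℝ) (hf : Continuous f) (z : ℂ) :
    (horizontalShear f hf z).re = z.re + f z.im := by simp [horizontalShear_apply]

@[simp] theorem horizontalShear_im (f : ℝ → ℝ) (hf : Continuous f) (z : ℂ) :
    (horizontalShear f hf z).im = z.im := by simp [horizontalShear_apply]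

/-- The reflection `(x, y) ↦ (-x, y)`. -/
noncomputable def reflectRe : ℂ ≃ₜ ℂ := Complex.conjCLE.toHomeomorph.trans (Homeomorph.neg ℂ)

@[simp] theorem reflectRe_re (z : ℂ) : (reflectRe z).re = -z.re := by simp [reflectRe]

@[simp] theorem reflectRe_im (z : ℂ) : (reflectRe z).im = z.im := by simp [reflectRe]

@[simp] theorem reflectRe_reflectRe (z : ℂ) : reflectRe (reflectRe z) = z := by
  apply Complex.ext <;> simp

@[simp] theorem reflectRe_symm (z : ℂ) : reflectRe.symm z = reflectRe z := by
  rw [reflectRe.symm_apply_eq, reflectRe_reflectRe]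

/-- Some homeomorphism fixing the origin carries the real axis onto `S` and the line straightened
by `e` onto `T`. -/
def IsNormalizable (S T : Set ℂ) (e : ℂ ≃ₜ ℂ) : Prop :=
  ∃ E : ℂ ≃ₜ ℂ, E 0 = 0 ∧ (∀ z, z.im = 0 ↔ E z ∈ S) ∧ ∀ z, (e z).im = 0 ↔ E z ∈ T

variable {S T : Set ℂ} {e : ℂ ≃ₜ ℂ}

theorem IsNormalizable.of_trans (G : ℂ ≃ₜ ℂ) (h0 : G 0 = 0) (hG : ∀ z, (G z).im = 0 ↔ z.im = 0)
    (h : IsNormalizable S T (G.trans e)) : IsNormalizable S T e := by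
  obtain ⟨E, hE0, hS, hT⟩ := h
  refine ⟨G.symm.trans E, ?_, fun z => ?_, fun z => ?_⟩
  · rw [Homeomorph.trans_apply, (G.symm_apply_eq).2 h0.symm, hE0]
  · rw [Homeomorph.trans_apply, ← hS, ← hG (G.symm z), G.apply_symm_apply]
  · rw [Homeomorph.trans_apply, ← hT, Homeomorph.trans_apply, G.apply_symm_apply]

theorem IsNormalizable.of_neg (h : IsNormalizable S T (e.trans (Homeomorph.neg ℂ))) :
    IsNormalizable S T e := by
  obtain ⟨E, hE0, hS, hT⟩ := h
  exact ⟨E, hE0, hS, fun z => by rw [← hT]; simp⟩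

theorem im_eq_zero_iff_of_param {E : ℂ ≃ₜ ℂ} {γ : ℝ → ℂ} (h : ∀ x : ℝ, E (e.symm x) = γ x) (z : ℂ) :
    (e z).im = 0 ↔ E z ∈ range γ := by
  constructor
  · intro hz
    refine ⟨(e z).re, ?_⟩
    rw [← h, show (((e z).re : ℝ) : ℂ) = e z from Complex.ext (by simp) (by simp [hz]),
      e.symm_apply_apply]
  · rintro ⟨x, hx⟩
    rw [← h] at hx
    rw [← E.injective hx, e.apply_symm_apply, Complex.ofReal_im]

theorem isNormalizable_of_param {E : ℂ ≃ₜ ℂ} {γ δ : ℝ → ℂ} (h0 : E 0 = 0)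
    (hγ : ∀ x : ℝ, E x = γ x) (hδ : ∀ x : ℝ, E (e.symm x) = δ x) (hS : range γ = S)
    (hT : range δ = T) : IsNormalizable S T e :=
  ⟨E, h0, fun z => by
      rw [← hS]; exact im_eq_zero_iff_of_param (e := Homeomorph.refl ℂ) hγ z,
    fun z => by rw [← hT]; exact im_eq_zero_iff_of_param hδ z⟩

theorem im_eq_zero_iff_of_fixes {G : ℂ ≃ₜ ℂ} (hG : ∀ z : ℂ, 0 ≤ z.im → G z = z) (z : ℂ) :
    (G z).im = 0 ↔ z.im = 0 := by
  constructor
  · intro h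
    rw [← G.injective (hG _ h.ge)]; exact h
  · intro h; rw [hG z h.ge, h]

theorem im_neg_of_fixes {G : ℂ ≃ₜ ℂ} (hG : ∀ z : ℂ, 0 ≤ z.im → G z = z) {z : ℂ} (hz : z.im < 0) :
    (G z).im < 0 := by
  by_contra hc
  rw [G.injective (hG _ (not_lt.1 hc))] at hc
  exact hc hz

/-- The ray `t ↦ t * w`. -/
noncomputable def straightRay (w : ℂ) (hw : w ≠ 0) : ℂ ≃ₜ ℂ := (Homeomorph.mulRight₀ w hw).symm

theorem isLowerRay_straightRay {w : ℂ} (hw : w ≠ 0) (him : w.im < 0) :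
    IsLowerRay (straightRay w hw) where
  zero := by simp [straightRay]
  mem x hx := by
    change ((x : ℂ) * w).im < 0
    rw [Complex.im_ofReal_mul]
    exact mul_neg_of_pos_of_neg hx him

theorem straightRay_symm_apply {w : ℂ} (hw : w ≠ 0) (z : ℂ) :
    (straightRay w hw).symm z = z * w := rfl

theorem IsPreconnected.forall_neg_or_forall_pos {s : Set ℝ} (hs : IsPreconnected s) {f : ℝ → ℝ}
    (hf : ContinuousOn f s) (hne : ∀ x ∈ s, f x ≠ 0) :
    (∀ x ∈ s, f x < 0) ∨ ∀ x ∈ s, 0 < f x := by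
  by_contra! h
  obtain ⟨⟨x, hx, hx0⟩, y, hy, hy0⟩ := h
  obtain ⟨z, hz, hz0⟩ := hs.intermediate_value hy hx hf ⟨hy0, hx0⟩
  exact hne z hz hz0

theorem isNormalizable_cross (h0 : e 0 = 0) (hneg : ∀ x : ℝ, 0 < x → (e.symm x).im < 0)
    (hpos : ∀ x : ℝ, x < 0 → 0 < (e.symm x).im) :
    IsNormalizable {z | z.im = 0} {z | z.re = 0} e := by
  have hI : -Complex.I ≠ 0 := neg_ne_zero.2 Complex.I_ne_zero
  have hs := isLowerRay_straightRay hI (by simp)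
  have hes : e.symm 0 = 0 := by rw [e.symm_apply_eq, h0]
  obtain ⟨G, hG, hGe⟩ := IsLowerRay.exists_homeomorph (e₁ := e) ⟨h0, hneg⟩ hs
  obtain ⟨K, hK, hKe⟩ := IsLowerRay.exists_homeomorph
    (e₁ := Complex.conjCLE.toHomeomorph.trans (e.trans (Homeomorph.neg ℂ)))
    ⟨by simp [h0], fun x hx => by
      have := hpos (-x) (by linarith)
      change ((starRingEnd ℂ) (e.symm (-(x : ℂ)))).im < 0
      rw [Complex.conj_im]
      push_cast at this
      linarith⟩ hs
  set C := Complex.conjCLE.toHomeomorph with hC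
  have hCC : ∀ z, C (C z) = z := fun z => Complex.conj_conj z
  have hCim : ∀ z, (C z).im = -z.im := fun z => Complex.conj_im z
  refine isNormalizable_of_param (E := G.trans (C.trans (K.trans C))) (γ := fun x => x)
    (δ := fun x => (x : ℂ) * -Complex.I) ?_ (fun x => ?_) (fun x => ?_) ?_ ?_
  · have : C 0 = 0 := map_zero (starRingEnd ℂ)
    simp only [Homeomorph.trans_apply]
    rw [hG 0 le_rfl, this, hK 0 le_rfl, this]
  · simp only [Homeomorph.trans_apply]
    rw [hG _ (by simp), hK _ (by rw [hCim]; simp), hCC]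
  · simp only [Homeomorph.trans_apply]
    rcases le_or_gt 0 x with hx | hx
    · rw [hGe x hx, straightRay_symm_apply, hK _ (by rw [hCim]; simpa using hx), hCC]
    · rw [hG _ (hpos x hx).le]
      have h1 : K (C (e.symm (-((-x : ℝ) : ℂ)))) = ((-x : ℝ) : ℂ) * -Complex.I :=
        hKe (-x) (by linarith)
      rw [show -((-x : ℝ) : ℂ) = (x : ℂ) by push_cast; ring] at h1
      rw [h1]
      change (starRingEnd ℂ) _ = _
      simp
  · ext z
    simp only [mem_range, mem_ofPred_eq]
    exact ⟨fun ⟨x, hx⟩ => by rw [← hx]; simp,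
      fun h => ⟨z.re, Complex.ext (by simp) (by simp [h])⟩⟩
  · ext z
    simp only [mem_range, mem_ofPred_eq]
    exact ⟨fun ⟨x, hx⟩ => by rw [← hx]; simp,
      fun h => ⟨-z.im, Complex.ext (by simp [h]) (by simp)⟩⟩

theorem isNormalizable_touch_of_quadrant (h0 : e 0 = 0)
    (hray : ∀ x : ℝ, 0 ≤ x → e.symm x = (x : ℂ) * -Complex.I)
    (hq : ∀ x : ℝ, x < 0 → (e.symm x).im < 0 ∧ 0 < (e.symm x).re) :
    IsNormalizable {z | z.im = |z.re|} {z | z.im = -|z.re|} e := by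
  set φ := horizontalShear (fun y => min y 0) (by fun_prop) with hφ
  set g := verticalShear 1 one_ne_zero (fun x => -min x 0) (by fun_prop) with hg
  set k := verticalShear 2 two_ne_zero (fun x => |x|) (by fun_prop) with hk
  have hw : (1 - Complex.I) ≠ 0 := fun h => by simpa using congrArg Complex.re h
  have hes : e.symm 0 = 0 := by rw [e.symm_apply_eq, h0]
  have hφ0 : φ 0 = 0 := by simp [hφ, horizontalShear_apply]
  have hg0 : g 0 = 0 := by simp [hg, verticalShear_apply]
  obtain ⟨G, hG, hGe⟩ := IsLowerRay.exists_homeomorph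
    (e₁ := (φ.trans g).symm.trans (e.trans (Homeomorph.neg ℂ)))
    (e₂ := straightRay _ hw)
    ⟨by
      have : (φ.trans g).symm 0 = 0 := by
        rw [(φ.trans g).symm_apply_eq, Homeomorph.trans_apply, hφ0, hg0]
      rw [Homeomorph.trans_apply, this]
      simp [h0], fun x hx => by
      change (g (φ (e.symm (-(x : ℂ))))).im < 0
      have := hq (-x) (by linarith)
      push_cast at this
      simp only [hg, hφ, verticalShear_im, horizontalShear_re, horizontalShear_im,
        min_eq_left this.1.le]
      rcases min_cases ((e.symm (-(x : ℂ))).re + (e.symm (-(x : ℂ))).im) 0 with h | h <;>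
        linarith [h.1, this.1, this.2]⟩ (isLowerRay_straightRay hw (by simp))
  refine isNormalizable_of_param (E := φ.trans (g.trans (G.trans (g.symm.trans k))))
    (γ := fun x => (x : ℂ) + (|x| : ℝ) * Complex.I)
    (δ := fun x => -(x : ℂ) - (|x| : ℝ) * Complex.I) ?_ (fun x => ?_) (fun x => ?_) ?_ ?_
  · simp only [Homeomorph.trans_apply]
    rw [hφ0, hg0, hG 0 le_rfl, (g.symm_apply_eq).2 hg0.symm]
    simp [hk, verticalShear_apply]
  · simp only [Homeomorph.trans_apply]
    have h1 : φ x = x := by simp [hφ, horizontalShear_apply]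
    rw [h1, hG _ (by simp [hg]), g.symm_apply_apply]
    simp [hk, verticalShear_apply]
  · simp only [Homeomorph.trans_apply]
    rcases le_or_gt 0 x with hx | hx
    · have h1 : φ (e.symm x) = -(x : ℂ) - (x : ℂ) * Complex.I := by
        rw [hray x hx]
        apply Complex.ext <;> simp [hφ, hx]
      have h2 : (g (-(x : ℂ) - (x : ℂ) * Complex.I)).im = 0 := by simp [hg, hx]
      rw [h1, hG _ h2.ge, g.symm_apply_apply]
      apply Complex.ext <;> simp [hk, abs_of_nonneg hx]
      ring
    · have h1 : G (g (φ (e.symm (-((-x : ℝ) : ℂ))))) = ((-x : ℝ) : ℂ) * (1 - Complex.I) :=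
        hGe (-x) (by linarith)
      rw [show -((-x : ℝ) : ℂ) = (x : ℂ) by push_cast; ring] at h1
      have h2 : g (((-x : ℝ) : ℂ) * (1 - Complex.I)) = ((-x : ℝ) : ℂ) * (1 - Complex.I) := by
        apply Complex.ext <;> simp [hg, hx.le]
      rw [h1, (g.symm_apply_eq).2 h2.symm]
      apply Complex.ext <;> simp [hk, abs_of_neg hx]
      ring
  · ext z
    simp only [mem_range, mem_ofPred_eq]
    exact ⟨fun ⟨x, hx⟩ => by rw [← hx]; simp,
      fun h => ⟨z.re, Complex.ext (by simp) (by simp [h])⟩⟩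
  · ext z
    simp only [mem_range, mem_ofPred_eq]
    exact ⟨fun ⟨x, hx⟩ => by rw [← hx]; simp,
      fun h => ⟨-z.re, Complex.ext (by simp) (by simp [h])⟩⟩

theorem isNormalizable_touch (h0 : e 0 = 0) (hneg : ∀ x : ℝ, x ≠ 0 → (e.symm x).im < 0) :
    IsNormalizable {z | z.im = |z.re|} {z | z.im = -|z.re|} e := by
  have hI : -Complex.I ≠ 0 := neg_ne_zero.2 Complex.I_ne_zero
  obtain ⟨G, hG, hGe⟩ := IsLowerRay.exists_homeomorph (e₁ := e) ⟨h0, fun x hx => hneg x hx.ne'⟩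
    (isLowerRay_straightRay hI (by simp))
  have hGs0 : G.symm 0 = 0 := by rw [G.symm_apply_eq, hG 0 le_rfl]
  refine .of_trans G.symm hGs0 (fun z => ?_) ?_
  · rw [← im_eq_zero_iff_of_fixes hG (G.symm z), G.apply_symm_apply]
  set f := G.symm.trans e with hf
  have hfs : ∀ x : ℂ, f.symm x = G (e.symm x) := fun _ => rfl
  have hf0 : f 0 = 0 := by rw [hf, Homeomorph.trans_apply, hGs0, h0]
  have hray : ∀ x : ℝ, 0 ≤ x → f.symm x = (x : ℂ) * -Complex.I := hGe
  have hlow : ∀ x : ℝ, x < 0 → (f.symm x).im < 0 := fun x hx => im_neg_of_fixes hG (hneg x hx.ne)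
  have hre : ∀ x ∈ Iio (0 : ℝ), (f.symm x).re ≠ 0 := by
    intro x hx hc
    have h1 := hlow x hx
    have h2 : f.symm x = f.symm ((-(f.symm x).im : ℝ) : ℂ) := by
      rw [hray (-(f.symm x).im) (by linarith)]
      apply Complex.ext <;> simp [hc]
    have h3 := Complex.ofReal_injective (f.symm.injective h2)
    have h4 : x < 0 := hx
    linarith
  rcases isPreconnected_Iio.forall_neg_or_forall_pos (f := fun x : ℝ => (f.symm x).re)
    (by fun_prop) hre with h | h
  · refine .of_trans reflectRe (Complex.ext (by simp) (by simp)) (fun z => by simp) ?_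
    refine isNormalizable_touch_of_quadrant ?_ (fun x hx => ?_) fun x hx => ?_
    · rw [Homeomorph.trans_apply, show reflectRe 0 = 0 from Complex.ext (by simp) (by simp), hf0]
    · change reflectRe.symm (f.symm x) = _
      rw [hray x hx, reflectRe_symm]
      apply Complex.ext <;> simp
    · change (reflectRe.symm (f.symm x)).im < 0 ∧ 0 < (reflectRe.symm (f.symm x)).re
      rw [reflectRe_symm, reflectRe_re, reflectRe_im]
      exact ⟨hlow x hx, by linarith [h x hx]⟩
  · exact isNormalizable_touch_of_quadrant hf0 hray fun x hx => ⟨hlow x hx, h x hx⟩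

theorem isNormalizable_cross_or_touch (h0 : e 0 = 0) (hne : ∀ x : ℝ, x ≠ 0 → (e.symm x).im ≠ 0) :
    IsNormalizable {z | z.im = 0} {z | z.re = 0} e ∨
      IsNormalizable {z | z.im = |z.re|} {z | z.im = -|z.re|} e := by
  have hc : Continuous fun x : ℝ => (e.symm x).im := by fun_prop
  have hp := isPreconnected_Ioi.forall_neg_or_forall_pos hc.continuousOn
    fun x (hx : x ∈ Ioi (0 : ℝ)) => hne x hx.ne'
  have hn := isPreconnected_Iio.forall_neg_or_forall_pos hc.continuousOn
    fun x (hx : x ∈ Iio (0 : ℝ)) => hne x hx.ne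
  rcases hp with hp | hp <;> rcases hn with hn | hn
  · exact Or.inr (isNormalizable_touch h0 fun x hx => hx.lt_or_gt.elim (hn x) (hp x))
  · exact Or.inl (isNormalizable_cross h0 hp hn)
  · refine Or.inl (.of_neg (isNormalizable_cross (by simp [h0]) (fun x hx => ?_) fun x hx => ?_))
    · change (e.symm (-(x : ℂ))).im < 0
      exact_mod_cast hn (-x) (by simpa using hx)
    · change 0 < (e.symm (-(x : ℂ))).im
      exact_mod_cast hp (-x) (by simpa using hx)
  · refine Or.inr (.of_trans Complex.conjCLE.toHomeomorph (by simp) (fun z => by simp)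
      (isNormalizable_touch (by simp [h0]) fun x hx => ?_))
    change ((starRingEnd ℂ) (e.symm x)).im < 0
    rw [Complex.conj_im, neg_lt_zero]
    exact hx.lt_or_gt.elim (hn x) (hp x)

end PairOfLines

section Topolines

open Filter Topology Metric

/-- A topological line in the plane. -/
def IsTopoline (A : Set ℂ) : Prop := ∃ e : ℂ ≃ₜ ℂ, A = {z | (e z).im = 0}

/-- `L` lies in the closure of a single side of `M`. -/
def IsOneSided (L M : Set ℂ) : Prop := ∃ S, IsPreconnected S ∧ L \ M ⊆ S ∧ Disjoint S M

/-- Two topological lines that meet in a point without crossing there. -/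
def IsTouching (A B : Set ℂ) : Prop :=
  ∃ E : ℂ ≃ₜ ℂ, A = {z | (E z).im = |(E z).re|} ∧ B = {z | (E z).im = -|(E z).re|}

variable {A B L M : Set ℂ}

theorem IsTopoline.preimage (h : IsTopoline A) (g : ℂ ≃ₜ ℂ) : IsTopoline (g ⁻¹' A) := by
  obtain ⟨e, rfl⟩ := h
  exact ⟨g.trans e, rfl⟩

theorem IsOneSided.preimage (h : IsOneSided L M) (g : ℂ ≃ₜ ℂ) :
    IsOneSided (g ⁻¹' L) (g ⁻¹' M) := by
  obtain ⟨S, hS, hLS, hSM⟩ := h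
  refine ⟨g ⁻¹' S, ?_, fun z hz => hLS hz, hSM.preimage g⟩
  rw [← g.image_symm]
  exact hS.image _ g.symm.continuous.continuousOn

theorem IsTouching.preimage (h : IsTouching A B) (g : ℂ ≃ₜ ℂ) :
    IsTouching (g ⁻¹' A) (g ⁻¹' B) := by
  obtain ⟨E, rfl, rfl⟩ := h
  exact ⟨g.trans E, rfl, rfl⟩

theorem isTouching_preimage_iff (g : ℂ ≃ₜ ℂ) :
    IsTouching (g ⁻¹' A) (g ⁻¹' B) ↔ IsTouching A B := by
  refine ⟨fun h => ?_, fun h => h.preimage g⟩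
  have := h.preimage g.symm
  rwa [← preimage_comp, ← preimage_comp, g.self_comp_symm, preimage_id, preimage_id] at this

theorem IsTouching.symm (h : IsTouching A B) : IsTouching B A := by
  obtain ⟨E, rfl, rfl⟩ := h
  refine ⟨E.trans Complex.conjCLE.toHomeomorph, ?_, ?_⟩ <;> ext z <;>
    simp [neg_eq_iff_eq_neg]

theorem IsTouching.ne (h : IsTouching A B) : A ≠ B := by
  obtain ⟨E, rfl, rfl⟩ := h
  intro hc
  have : E.symm (1 + Complex.I) ∈ {z | (E z).im = |(E z).re|} := by simp
  rw [hc] at this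
  simp at this
  norm_num at this

/-- Two topological lines that meet in one point look like the coordinate axes, or like the graphs
of `|x|` and `-|x|`. -/
theorem exists_homeomorph_of_inter_eq_singleton (hA : IsTopoline A) (hB : IsTopoline B) {p : ℂ}
    (hp : A ∩ B = {p}) :
    (∃ E : ℂ ≃ₜ ℂ, A = {z | (E z).im = 0} ∧ B = {z | (E z).re = 0}) ∨ IsTouching A B := by
  obtain ⟨a, rfl⟩ := hA
  obtain ⟨b, rfl⟩ := hB
  have hpab : (a p).im = 0 ∧ (b p).im = 0 := by
    have : p ∈ ({p} : Set ℂ) := rfl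
    rwa [← hp] at this
  set a' := a.trans (Homeomorph.subRight (a p)) with ha'
  set b' := b.trans (Homeomorph.subRight (b p)) with hb'
  have ha0 : a' p = 0 := by simp [ha']
  have hb0 : b' p = 0 := by simp [hb']
  have haim : ∀ z, (a' z).im = (a z).im := fun z => by simp [ha', hpab.1]
  have hbim : ∀ z, (b' z).im = (b z).im := fun z => by simp [hb', hpab.2]
  have ha0' : a'.symm 0 = p := by rw [a'.symm_apply_eq, ha0]
  have key : ∀ {S T : Set ℂ}, IsNormalizable S T (a'.symm.trans b') →
      ∃ E : ℂ ≃ₜ ℂ, {z | (a z).im = 0} = E ⁻¹' S ∧ {z | (b z).im = 0} = E ⁻¹' T := by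
    rintro S T ⟨E, -, hS, hT⟩
    refine ⟨a'.trans E, ?_, ?_⟩ <;> ext z
    · rw [mem_preimage, Homeomorph.trans_apply, ← hS, haim]; rfl
    · rw [mem_preimage, Homeomorph.trans_apply, ← hT, Homeomorph.trans_apply,
        a'.symm_apply_apply, hbim]; rfl
  refine (isNormalizable_cross_or_touch (e := a'.symm.trans b') ?_ fun x hx hc => ?_).imp key key
  · rw [Homeomorph.trans_apply, ha0', hb0]
  · have h1 : b'.symm x ∈ ({p} : Set ℂ) := by
      rw [← hp]
      refine ⟨?_, ?_⟩
      · change (a _).im = 0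
        rw [← haim]; exact hc
      · change (b _).im = 0
        rw [← hbim, b'.apply_symm_apply, Complex.ofReal_im]
    rw [mem_singleton_iff, b'.symm_apply_eq, hb0] at h1
    exact hx (by exact_mod_cast h1)

theorem isPreconnected_strictEpigraph {f : ℝ → ℝ} (hf : Continuous f) :
    IsPreconnected {z : ℂ | f z.re < z.im} := by
  set k := verticalShear 1 one_ne_zero (fun x => -f x) (by fun_prop) with hk
  have : {z : ℂ | f z.re < z.im} = k ⁻¹' {z | 0 < z.im} := by
    ext z; simp [hk]
  rw [this, ← k.image_symm]
  exact (convex_halfSpace_im_gt 0).isPreconnected.image _ k.symm.continuous.continuousOn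

theorem isPreconnected_strictHypograph {f : ℝ → ℝ} (hf : Continuous f) :
    IsPreconnected {z : ℂ | z.im < f z.re} := by
  set k := verticalShear 1 one_ne_zero (fun x => -f x) (by fun_prop) with hk
  have : {z : ℂ | z.im < f z.re} = k ⁻¹' {z | z.im < 0} := by
    ext z; simp [hk]
  rw [this, ← k.image_symm]
  exact (convex_halfSpace_im_lt 0).isPreconnected.image _ k.symm.continuous.continuousOn

theorem isOneSided_graph_of_forall {f : ℝ → ℝ} (hf : Continuous f)
    (h : (∀ z ∈ L \ {z | z.im = f z.re}, f z.re < z.im) ∨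
      ∀ z ∈ L \ {z | z.im = f z.re}, z.im < f z.re) : IsOneSided L {z | z.im = f z.re} := by
  rcases h with h | h
  · exact ⟨_, isPreconnected_strictEpigraph hf, h,
      Set.disjoint_left.2 fun z (h1 : _ < _) (h2 : _ = _) => h1.ne' h2⟩
  · exact ⟨_, isPreconnected_strictHypograph hf, h,
      Set.disjoint_left.2 fun z (h1 : _ < _) (h2 : _ = _) => h1.ne h2⟩

theorem IsOneSided.forall_pos_or_forall_neg {u : ℂ → ℝ} (hu : Continuous u)
    (h : IsOneSided L {z | u z = 0}) :
    (∀ z ∈ L \ {z | u z = 0}, 0 < u z) ∨ ∀ z ∈ L \ {z | u z = 0}, u z < 0 := by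
  obtain ⟨S, hS, hLS, hSM⟩ := h
  by_contra! hc
  obtain ⟨⟨x, hx, hx0⟩, y, hy, hy0⟩ := hc
  obtain ⟨z, hz, hz0⟩ := hS.intermediate_value (hLS hx) (hLS hy) hu.continuousOn ⟨hx0, hy0⟩
  exact Set.disjoint_left.1 hSM hz hz0

theorem IsTouching.isOneSided (h : IsTouching A B) : IsOneSided A B := by
  obtain ⟨E, rfl, rfl⟩ := h
  have := isOneSided_graph_of_forall (L := {z : ℂ | z.im = |z.re|}) (f := fun x => -|x|)
    (by fun_prop) (Or.inl fun z hz => by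
      have h1 : z.im = |z.re| := hz.1
      have h2 : z.im ≠ -|z.re| := hz.2
      refine lt_of_le_of_ne ?_ h2.symm
      linarith [abs_nonneg z.re])
  exact this.preimage E

theorem IsTouching.nonempty (h : IsTouching A B) : (A ∩ B).Nonempty := by
  obtain ⟨E, rfl, rfl⟩ := h
  exact ⟨E.symm 0, by simp, by simp⟩

theorem not_isOneSided_re_im : ¬ IsOneSided {z | z.im = 0} {z : ℂ | z.re = 0} := by
  intro h
  rcases h.forall_pos_or_forall_neg Complex.continuous_re with h | h
  · have := h (-1) (by simp)
    norm_num at this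
  · have := h 1 (by simp)
    norm_num at this

theorem isTouching_iff (hA : IsTopoline A) (hB : IsTopoline B) (h : (A ∩ B).Subsingleton) :
    IsTouching A B ↔ (A ∩ B).Nonempty ∧ IsOneSided A B := by
  refine ⟨fun h => ⟨h.nonempty, h.isOneSided⟩, fun ⟨⟨p, hp⟩, h1⟩ => ?_⟩
  refine (exists_homeomorph_of_inter_eq_singleton hA hB
    (h.eq_singleton_of_mem hp)).resolve_left ?_
  rintro ⟨E, rfl, rfl⟩
  refine not_isOneSided_re_im ?_
  have := h1.preimage E.symm
  simpa using this

end Topolines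

section Uncrossing

open Filter Topology Metric

variable {L : Set ℂ}

theorem IsTopoline.isPreconnected (hL : IsTopoline L) : IsPreconnected L := by
  obtain ⟨e, rfl⟩ := hL
  have : {z | (e z).im = 0} = e ⁻¹' {z | z.im = 0} := rfl
  rw [this, ← e.image_symm]
  exact (convex_hyperplane Complex.imLm.isLinear 0).isPreconnected.image _
    e.symm.continuous.continuousOn

theorem IsTopoline.pos_of_eventuallyEq (hL : IsTopoline L) {u w : ℂ → ℝ} {q : ℂ}
    (hw : Continuous w) (hq : q ∈ L) (hu0 : ∀ z ∈ L, z ≠ q → 0 < u z)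
    (hw0 : ∀ z ∈ L, z ≠ q → w z ≠ 0) (huw : ∀ᶠ z in 𝓝 q, u z = w z) :
    ∀ z ∈ L, z ≠ q → 0 < w z := by
  obtain ⟨e, rfl⟩ := hL
  have hreal : ∀ z, (e z).im = 0 → e.symm ((e z).re : ℂ) = z := fun z hz => by
    rw [e.symm_apply_eq]
    exact Complex.ext (by simp) (by simp [hz])
  have hmem : ∀ x : ℝ, e.symm x ∈ {z | (e z).im = 0} := fun x => by simp
  set s := (e q).re with hs
  have hsq : e.symm (s : ℂ) = q := hreal q hq
  have hne : ∀ x : ℝ, x ≠ s → e.symm x ≠ q := fun x hx hc => by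
    rw [← hsq] at hc
    exact hx (Complex.ofReal_injective (e.symm.injective hc))
  have hcont : Continuous fun x : ℝ => w (e.symm x) := by fun_prop
  have hev : ∀ᶠ x : ℝ in 𝓝 s, u (e.symm x) = w (e.symm x) := by
    have h1 : Tendsto (fun x : ℝ => e.symm x) (𝓝 s) (𝓝 q) := by
      rw [← hsq]
      exact (by fun_prop : Continuous fun x : ℝ => e.symm x).tendsto s
    exact h1.eventually huw
  have hp : ∀ x ∈ Ioi s, 0 < w (e.symm x) := by
    refine (isPreconnected_Ioi.forall_neg_or_forall_pos hcont.continuousOn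
      fun x hx => hw0 _ (hmem x) (hne x (ne_of_gt hx))).resolve_left fun hn => ?_
    obtain ⟨x, hx, hxs⟩ := ((hev.filter_mono nhdsWithin_le_nhds).and
      (self_mem_nhdsWithin : ∀ᶠ x in 𝓝[>] s, x ∈ Ioi s)).exists
    have h1 := hu0 _ (hmem x) (hne x (ne_of_gt hxs))
    linarith [hn x hxs]
  have hn : ∀ x ∈ Iio s, 0 < w (e.symm x) := by
    refine (isPreconnected_Iio.forall_neg_or_forall_pos hcont.continuousOn
      fun x hx => hw0 _ (hmem x) (hne x (ne_of_lt hx))).resolve_left fun hn => ?_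
    obtain ⟨x, hx, hxs⟩ := ((hev.filter_mono nhdsWithin_le_nhds).and
      (self_mem_nhdsWithin : ∀ᶠ x in 𝓝[<] s, x ∈ Iio s)).exists
    have h1 := hu0 _ (hmem x) (hne x (ne_of_lt hxs))
    linarith [hn x hxs]
  intro z hz hzq
  rw [← hreal z hz]
  rcases lt_trichotomy (e z).re s with h | h | h
  · exact hn _ h
  · rw [← hreal z hz, h, hsq] at hzq
    exact absurd rfl hzq
  · exact hp _ h

theorem IsTopoline.pos_or_neg_of_eventuallyEq (hL : IsTopoline L) {u w : ℂ → ℝ} {q : ℂ}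
    (hu : Continuous u) (hw : Continuous w) (hq : q ∈ L) (huq : ∀ z ∈ L, u z = 0 → z = q)
    (hwq : ∀ z ∈ L, w z = 0 → z = q) (huw : ∀ᶠ z in 𝓝 q, u z = w z)
    (h : IsOneSided L {z | u z = 0}) :
    (∀ z ∈ L, z ≠ q → 0 < w z) ∨ ∀ z ∈ L, z ≠ q → w z < 0 := by
  have hw0 : ∀ z ∈ L, z ≠ q → w z ≠ 0 := fun z hz hzq hc => hzq (hwq z hz hc)
  have hm : ∀ z ∈ L, z ≠ q → z ∈ L \ {z | u z = 0} := fun z hz hzq =>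
    ⟨hz, fun hc => hzq (huq z hz hc)⟩
  refine (h.forall_pos_or_forall_neg hu).imp (fun h => ?_) fun h => ?_
  · exact hL.pos_of_eventuallyEq hw hq (fun z hz hzq => h z (hm z hz hzq)) hw0 huw
  · have := hL.pos_of_eventuallyEq (u := fun z => -u z) (w := fun z => -w z) hw.neg hq
      (fun z hz hzq => neg_pos.2 (h z (hm z hz hzq))) (fun z hz hzq => neg_ne_zero.2 (hw0 z hz hzq))
      (huw.mono fun z hz => by rw [hz])
    exact fun z hz hzq => neg_pos.1 (this z hz hzq)

/-- The graph of the absolute value. -/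
def upperVee : Set ℂ := {z | z.im = |z.re|}

/-- The graph of minus the absolute value. -/
def lowerVee : Set ℂ := {z | z.im = -|z.re|}

/-- The diagonal line. -/
def diagLine : Set ℂ := {z | z.im = z.re}

/-- The antidiagonal line. -/
def antidiagLine : Set ℂ := {z | z.im = -z.re}

theorem isTopoline_graph {f : ℝ → ℝ} (hf : Continuous f) : IsTopoline {z : ℂ | z.im = f z.re} := by
  refine ⟨verticalShear 1 one_ne_zero (fun x => -f x) (by fun_prop), ?_⟩
  ext z
  simp [add_neg_eq_zero]

theorem isTopoline_upperVee : IsTopoline upperVee :=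
  isTopoline_graph (f := fun x => |x|) (by fun_prop)

theorem isTopoline_lowerVee : IsTopoline lowerVee :=
  isTopoline_graph (f := fun x => -|x|) (by fun_prop)

theorem isTopoline_diagLine : IsTopoline diagLine :=
  isTopoline_graph (f := fun x => x) (by fun_prop)

theorem isTopoline_antidiagLine : IsTopoline antidiagLine :=
  isTopoline_graph (f := fun x => -x) (by fun_prop)

theorem upperVee_union_lowerVee : upperVee ∪ lowerVee = diagLine ∪ antidiagLine := by
  ext z
  change z.im = |z.re| ∨ z.im = -|z.re| ↔ z.im = z.re ∨ z.im = -z.re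
  rcases abs_choice z.re with h | h <;> rw [h]
  rw [neg_neg, or_comm]

theorem upperVee_inter_lowerVee : upperVee ∩ lowerVee = {0} := by
  ext z
  change z.im = |z.re| ∧ z.im = -|z.re| ↔ z = 0
  constructor
  · rintro ⟨h1, h2⟩
    have h3 : |z.re| = 0 := by linarith
    exact Complex.ext (abs_eq_zero.1 h3) (by rw [h1, h3]; rfl)
  · rintro rfl; simp

theorem diagonal_inter_antidiagonal : diagLine ∩ antidiagLine = {0} := by
  ext z
  change z.im = z.re ∧ z.im = -z.re ↔ z = 0
  constructor
  · rintro ⟨h1, h2⟩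
    have h3 : z.re = 0 := by linarith
    exact Complex.ext h3 (by rw [h1, h3]; rfl)
  · rintro rfl; simp

theorem reflectRe_preimage_upperVee : reflectRe ⁻¹' upperVee = upperVee := by
  ext z; simp [upperVee]

theorem reflectRe_preimage_lowerVee : reflectRe ⁻¹' lowerVee = lowerVee := by
  ext z; simp [lowerVee]

theorem reflectRe_preimage_diagonal : reflectRe ⁻¹' diagLine = antidiagLine := by
  ext z; simp [diagLine, antidiagLine]

theorem not_isTouching_diagonal_antidiagonal : ¬ IsTouching diagLine antidiagLine := by
  intro h
  have h1 : IsOneSided diagLine {z : ℂ | z.im + z.re = 0} := by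
    have := h.isOneSided
    simpa only [antidiagLine, eq_neg_iff_add_eq_zero] using this
  rcases h1.forall_pos_or_forall_neg (u := fun z => z.im + z.re) (by fun_prop) with h | h
  · have := h (-1 - Complex.I) (by simp [diagLine])
    norm_num at this
  · have := h (1 + Complex.I) (by simp [diagLine])
    norm_num at this

theorem mem_upperVee_of_nonneg {z : ℂ} (h : z ∈ diagLine) (h0 : 0 ≤ z.re) : z ∈ upperVee := by
  change z.im = |z.re|
  rw [abs_of_nonneg h0]; exact h

theorem mem_lowerVee_of_nonpos {z : ℂ} (h : z ∈ diagLine) (h0 : z.re ≤ 0) : z ∈ lowerVee := by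
  change z.im = -|z.re|
  rw [abs_of_nonpos h0, neg_neg]; exact h

theorem mem_lowerVee_of_nonneg {z : ℂ} (h : z ∈ antidiagLine) (h0 : 0 ≤ z.re) : z ∈ lowerVee := by
  change z.im = -|z.re|
  rw [abs_of_nonneg h0]; exact h

theorem mem_upperVee_of_nonpos {z : ℂ} (h : z ∈ antidiagLine) (h0 : z.re ≤ 0) : z ∈ upperVee := by
  change z.im = |z.re|
  rw [abs_of_nonpos h0]; exact h

theorem subsingleton_inter_diagonal (hL : IsTopoline L)
    (hV : (L ∩ upperVee).Subsingleton) (hW : (L ∩ lowerVee).Subsingleton) :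
    (L ∩ diagLine).Subsingleton := by
  have key : ∀ a ∈ L ∩ diagLine, ∀ b ∈ L ∩ diagLine, 0 < a.re → b.re < 0 → False := by
    rintro a ⟨haL, ha⟩ b ⟨hbL, hb⟩ ha0 hb0
    have ha1 : a.im = a.re := ha
    have hb1 : b.im = b.re := hb
    obtain ⟨z, hz, hz0⟩ := hL.isPreconnected.intermediate_value (f := fun z => z.im + z.re) hbL haL
      (by fun_prop) (show (0 : ℝ) ∈ _ from ⟨by linarith, by linarith⟩)
    have hz1 : z.im + z.re = 0 := hz0
    have hzA : z ∈ antidiagLine := eq_neg_of_add_eq_zero_left hz1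
    rcases le_total 0 z.re with h | h
    · have := hW ⟨hz, mem_lowerVee_of_nonneg hzA h⟩ ⟨hbL, mem_lowerVee_of_nonpos hb hb0.le⟩
      subst this; linarith
    · have := hV ⟨hz, mem_upperVee_of_nonpos hzA h⟩ ⟨haL, mem_upperVee_of_nonneg ha ha0.le⟩
      subst this; linarith
  rintro a ⟨haL, ha⟩ b ⟨hbL, hb⟩
  rcases le_or_gt 0 a.re with h | h <;> rcases le_or_gt 0 b.re with h' | h'
  · exact hV ⟨haL, mem_upperVee_of_nonneg ha h⟩ ⟨hbL, mem_upperVee_of_nonneg hb h'⟩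
  · rcases h.eq_or_lt with h0 | h0
    · exact hW ⟨haL, mem_lowerVee_of_nonpos ha h0.ge⟩ ⟨hbL, mem_lowerVee_of_nonpos hb h'.le⟩
    · exact (key a ⟨haL, ha⟩ b ⟨hbL, hb⟩ h0 h').elim
  · rcases h'.eq_or_lt with h0 | h0
    · exact hW ⟨haL, mem_lowerVee_of_nonpos ha h.le⟩ ⟨hbL, mem_lowerVee_of_nonpos hb h0.ge⟩
    · exact (key b ⟨hbL, hb⟩ a ⟨haL, ha⟩ h0 h).elim
  · exact hW ⟨haL, mem_lowerVee_of_nonpos ha h.le⟩ ⟨hbL, mem_lowerVee_of_nonpos hb h'.le⟩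

theorem isTouching_of_diagonal_of_ne_zero (hL : IsTopoline L)
    (hV : (L ∩ upperVee).Subsingleton) (hW : (L ∩ lowerVee).Subsingleton)
    (h0 : (0 : ℂ) ∉ L) (h : IsTouching L diagLine) :
    ∃ q ∈ L ∩ diagLine, q ∈ upperVee ∧ IsTouching L upperVee ∨
      q ∈ lowerVee ∧ IsTouching L lowerVee := by
  obtain ⟨q, hqL, hqD⟩ := h.nonempty
  have hs := subsingleton_inter_diagonal hL hV hW
  refine ⟨q, ⟨hqL, hqD⟩, ?_⟩
  have hq0 : q.re ≠ 0 := fun hc => h0 <| by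
    have : q = 0 := Complex.ext hc (by rw [show q.im = q.re from hqD, hc]; rfl)
    rwa [← this]
  have h1 : IsOneSided L {z : ℂ | z.im - z.re = 0} := by
    simpa only [diagLine, sub_eq_zero] using h.isOneSided
  have huq : ∀ z ∈ L, z.im - z.re = 0 → z = q := fun z hz hz0 =>
    hs ⟨hz, sub_eq_zero.1 hz0⟩ ⟨hqL, hqD⟩
  have hev : ∀ {U : Set ℝ}, U ∈ 𝓝 q.re → ∀ᶠ z : ℂ in 𝓝 q, z.re ∈ U := fun hU =>
    Complex.continuous_re.continuousAt.eventually_mem hU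
  rcases hq0.lt_or_gt with hlt | hgt
  · right
    have hqW := mem_lowerVee_of_nonpos hqD hlt.le
    refine ⟨hqW, (isTouching_iff hL isTopoline_lowerVee hW).2 ⟨⟨q, hqL, hqW⟩, ?_⟩⟩
    refine isOneSided_graph_of_forall (f := fun x => -|x|) (by fun_prop) ?_
    have hm : ∀ z ∈ L \ {z : ℂ | z.im = -|z.re|}, z ≠ q := by
      rintro z hz rfl; exact hz.2 hqW
    refine (hL.pos_or_neg_of_eventuallyEq (u := fun z => z.im - z.re)
      (w := fun z => z.im - -|z.re|) (by fun_prop) (by fun_prop) hqL huq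
      (fun z hz hz0 => hW ⟨hz, sub_eq_zero.1 hz0⟩ ⟨hqL, hqW⟩) ?_ h1).imp
      (fun h z hz => sub_pos.1 (h z hz.1 (hm z hz))) fun h z hz => sub_neg.1 (h z hz.1 (hm z hz))
    filter_upwards [hev (Iio_mem_nhds hlt)] with z hz
    rw [abs_of_neg hz, neg_neg]
  · left
    have hqV := mem_upperVee_of_nonneg hqD hgt.le
    refine ⟨hqV, (isTouching_iff hL isTopoline_upperVee hV).2 ⟨⟨q, hqL, hqV⟩, ?_⟩⟩
    refine isOneSided_graph_of_forall (f := fun x => |x|) (by fun_prop) ?_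
    have hm : ∀ z ∈ L \ {z : ℂ | z.im = |z.re|}, z ≠ q := by
      rintro z hz rfl; exact hz.2 hqV
    refine (hL.pos_or_neg_of_eventuallyEq (u := fun z => z.im - z.re)
      (w := fun z => z.im - |z.re|) (by fun_prop) (by fun_prop) hqL huq
      (fun z hz hz0 => hV ⟨hz, sub_eq_zero.1 hz0⟩ ⟨hqL, hqV⟩) ?_ h1).imp
      (fun h z hz => sub_pos.1 (h z hz.1 (hm z hz))) fun h z hz => sub_neg.1 (h z hz.1 (hm z hz))
    filter_upwards [hev (Ioi_mem_nhds hgt)] with z hz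
    rw [abs_of_pos hz]

theorem forall_lt_or_forall_gt_of_zero_mem (hL : IsTopoline L)
    (hV : (L ∩ upperVee).Subsingleton) (hW : (L ∩ lowerVee).Subsingleton)
    (h0 : (0 : ℂ) ∈ L) (h : IsTouching L diagLine) :
    (∀ z ∈ L, z ≠ 0 → z.re < z.im) ∨ ∀ z ∈ L, z ≠ 0 → z.im < z.re := by
  have hs := subsingleton_inter_diagonal hL hV hW
  have h1 : IsOneSided L {z : ℂ | z.im - z.re = 0} := by
    simpa only [diagLine, sub_eq_zero] using h.isOneSided
  have hm : ∀ z ∈ L, z ≠ 0 → z ∈ L \ {z : ℂ | z.im - z.re = 0} := fun z hz hz0 =>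
    ⟨hz, fun hc => hz0 (hs ⟨hz, sub_eq_zero.1 hc⟩ ⟨h0, show (0 : ℂ).im = (0 : ℂ).re from rfl⟩)⟩
  exact (h1.forall_pos_or_forall_neg (by fun_prop)).imp
    (fun h z hz hz0 => sub_pos.1 (h z (hm z hz hz0)))
    fun h z hz hz0 => sub_neg.1 (h z (hm z hz hz0))

theorem isTouching_upperVee_of_zero_mem (hL : IsTopoline L)
    (hV : (L ∩ upperVee).Subsingleton) (h0 : (0 : ℂ) ∈ L)
    (h : (∀ z ∈ L, z ≠ 0 → |z.re| < z.im) ∨ ∀ z ∈ L, z ≠ 0 → z.im < |z.re|) :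
    IsTouching L upperVee := by
  have hm : ∀ z ∈ L \ {z : ℂ | z.im = |z.re|}, z ≠ 0 := by
    rintro z hz rfl; exact hz.2 (by simp)
  exact (isTouching_iff hL isTopoline_upperVee hV).2
    ⟨⟨0, h0, by simp [upperVee]⟩, isOneSided_graph_of_forall (f := fun x => |x|) (by fun_prop)
      (h.imp (fun h z hz => h z hz.1 (hm z hz)) fun h z hz => h z hz.1 (hm z hz))⟩

theorem isTouching_lowerVee_of_zero_mem (hL : IsTopoline L)
    (hW : (L ∩ lowerVee).Subsingleton) (h0 : (0 : ℂ) ∈ L)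
    (h : (∀ z ∈ L, z ≠ 0 → -|z.re| < z.im) ∨ ∀ z ∈ L, z ≠ 0 → z.im < -|z.re|) :
    IsTouching L lowerVee := by
  have hm : ∀ z ∈ L \ {z : ℂ | z.im = -|z.re|}, z ≠ 0 := by
    rintro z hz rfl; exact hz.2 (by simp)
  exact (isTouching_iff hL isTopoline_lowerVee hW).2
    ⟨⟨0, h0, by simp [lowerVee]⟩, isOneSided_graph_of_forall (f := fun x => -|x|) (by fun_prop)
      (h.imp (fun h z hz => h z hz.1 (hm z hz)) fun h z hz => h z hz.1 (hm z hz))⟩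

theorem isTouching_of_diagonal (hL : IsTopoline L)
    (hV : (L ∩ upperVee).Subsingleton) (hW : (L ∩ lowerVee).Subsingleton)
    (h : IsTouching L diagLine) :
    IsTouching L upperVee ∨ IsTouching L lowerVee := by
  by_cases h0 : (0 : ℂ) ∈ L
  · rcases forall_lt_or_forall_gt_of_zero_mem hL hV hW h0 h with h1 | h1
    · exact Or.inr (isTouching_lowerVee_of_zero_mem hL hW h0 (Or.inl fun z hz hz0 =>
        (neg_abs_le z.re).trans_lt (h1 z hz hz0)))
    · exact Or.inl (isTouching_upperVee_of_zero_mem hL hV h0 (Or.inr fun z hz hz0 =>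
        (h1 z hz hz0).trans_le (le_abs_self z.re)))
  · obtain ⟨q, -, h1⟩ := isTouching_of_diagonal_of_ne_zero hL hV hW h0 h
    exact h1.imp And.right And.right

theorem reflectRe_preimage_preimage (S : Set ℂ) : reflectRe ⁻¹' (reflectRe ⁻¹' S) = S := by
  ext z; simp

theorem reflectRe_preimage_antidiagonal : reflectRe ⁻¹' antidiagLine = diagLine := by
  rw [← reflectRe_preimage_diagonal, reflectRe_preimage_preimage]

theorem subsingleton_reflectRe_inter_upperVee (hV : (L ∩ upperVee).Subsingleton) :
    ((reflectRe ⁻¹' L) ∩ upperVee).Subsingleton := by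
  rw [← reflectRe_preimage_upperVee, ← preimage_inter]
  exact hV.preimage reflectRe.injective

theorem subsingleton_reflectRe_inter_lowerVee (hW : (L ∩ lowerVee).Subsingleton) :
    ((reflectRe ⁻¹' L) ∩ lowerVee).Subsingleton := by
  rw [← reflectRe_preimage_lowerVee, ← preimage_inter]
  exact hW.preimage reflectRe.injective

theorem isTouching_reflectRe_iff {S T : Set ℂ} (hST : reflectRe ⁻¹' S = T) :
    IsTouching (reflectRe ⁻¹' L) T ↔ IsTouching L S := by
  rw [← hST, isTouching_preimage_iff]

theorem subsingleton_inter_antidiagonal (hL : IsTopoline L)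
    (hV : (L ∩ upperVee).Subsingleton) (hW : (L ∩ lowerVee).Subsingleton) :
    (L ∩ antidiagLine).Subsingleton := by
  have := (subsingleton_inter_diagonal (hL.preimage reflectRe)
    (subsingleton_reflectRe_inter_upperVee hV)
    (subsingleton_reflectRe_inter_lowerVee hW)).preimage reflectRe.injective
  rwa [preimage_inter, reflectRe_preimage_preimage, reflectRe_preimage_diagonal] at this

theorem isTouching_of_antidiagonal (hL : IsTopoline L)
    (hV : (L ∩ upperVee).Subsingleton) (hW : (L ∩ lowerVee).Subsingleton)
    (h : IsTouching L antidiagLine) :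
    IsTouching L upperVee ∨ IsTouching L lowerVee := by
  rw [← isTouching_reflectRe_iff reflectRe_preimage_antidiagonal] at h
  rw [← isTouching_reflectRe_iff reflectRe_preimage_upperVee,
    ← isTouching_reflectRe_iff reflectRe_preimage_lowerVee]
  exact isTouching_of_diagonal (hL.preimage reflectRe) (subsingleton_reflectRe_inter_upperVee hV)
    (subsingleton_reflectRe_inter_lowerVee hW) h

theorem isTouching_of_diagonal_of_antidiagonal (hL : IsTopoline L)
    (hV : (L ∩ upperVee).Subsingleton) (hW : (L ∩ lowerVee).Subsingleton)
    (h : IsTouching L diagLine)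
    (h' : IsTouching L antidiagLine) : IsTouching L upperVee ∧ IsTouching L lowerVee := by
  have hL' := hL.preimage reflectRe
  have hV' := subsingleton_reflectRe_inter_upperVee hV
  have hW' := subsingleton_reflectRe_inter_lowerVee hW
  rw [← isTouching_reflectRe_iff reflectRe_preimage_antidiagonal] at h'
  by_cases h0 : (0 : ℂ) ∈ L
  · have h0' : (0 : ℂ) ∈ reflectRe ⁻¹' L := by
      rwa [mem_preimage, show reflectRe 0 = 0 from Complex.ext (by simp) (by simp)]
    have hr : ∀ z ∈ L, z ≠ 0 → reflectRe z ∈ reflectRe ⁻¹' L ∧ reflectRe z ≠ 0 := by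
      refine fun z hz hz0 => ⟨by simpa using hz, fun hc => hz0 ?_⟩
      rw [← reflectRe_reflectRe z, hc]
      exact Complex.ext (by simp) (by simp)
    have k1 := forall_lt_or_forall_gt_of_zero_mem hL hV hW h0 h
    have k2 : (∀ z ∈ L, z ≠ 0 → -z.re < z.im) ∨ ∀ z ∈ L, z ≠ 0 → z.im < -z.re :=
      (forall_lt_or_forall_gt_of_zero_mem hL' hV' hW' h0' h').imp
        (fun h z hz hz0 => by simpa using h _ (hr z hz hz0).1 (hr z hz hz0).2)
        fun h z hz hz0 => by simpa using h _ (hr z hz hz0).1 (hr z hz hz0).2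
    constructor
    · refine isTouching_upperVee_of_zero_mem hL hV h0 ?_
      rcases k1 with k1 | k1
      · rcases k2 with k2 | k2
        · exact Or.inl fun z hz hz0 => abs_lt.2 ⟨by linarith [k2 z hz hz0], k1 z hz hz0⟩
        · exact Or.inr fun z hz hz0 => (k2 z hz hz0).trans_le (neg_le_abs z.re)
      · exact Or.inr fun z hz hz0 => (k1 z hz hz0).trans_le (le_abs_self z.re)
    · refine isTouching_lowerVee_of_zero_mem hL hW h0 ?_
      rcases k1 with k1 | k1
      · exact Or.inl fun z hz hz0 => (neg_abs_le z.re).trans_lt (k1 z hz hz0)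
      · rcases k2 with k2 | k2
        · refine Or.inl fun z hz hz0 => lt_of_le_of_lt ?_ (k2 z hz hz0)
          linarith [le_abs_self z.re]
        · refine Or.inr fun z hz hz0 => ?_
          rw [lt_neg, abs_lt]
          exact ⟨by linarith [k1 z hz hz0], by linarith [k2 z hz hz0]⟩
  · have h0' : (0 : ℂ) ∉ reflectRe ⁻¹' L := by
      rwa [mem_preimage, show reflectRe 0 = 0 from Complex.ext (by simp) (by simp)]
    obtain ⟨q, ⟨hqL, hq⟩, k1⟩ := isTouching_of_diagonal_of_ne_zero hL hV hW h0 h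
    obtain ⟨r', ⟨hrL', hr'⟩, k2⟩ := isTouching_of_diagonal_of_ne_zero hL' hV' hW' h0' h'
    rw [isTouching_reflectRe_iff reflectRe_preimage_upperVee,
      isTouching_reflectRe_iff reflectRe_preimage_lowerVee] at k2
    rw [← reflectRe_preimage_antidiagonal] at hr'
    set r := reflectRe r' with hr
    have hrV : r' ∈ upperVee ↔ r ∈ upperVee := by
      rw [hr, ← mem_preimage, reflectRe_preimage_upperVee]
    have hrW : r' ∈ lowerVee ↔ r ∈ lowerVee := by
      rw [hr, ← mem_preimage, reflectRe_preimage_lowerVee]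
    rw [hrV, hrW] at k2
    have hne : q ≠ r := by
      intro hc
      have : q ∈ ({0} : Set ℂ) := by
        rw [← diagonal_inter_antidiagonal]; exact ⟨hq, hc ▸ hr'⟩
      rw [mem_singleton_iff] at this
      exact h0 (this ▸ hqL)
    rcases k1 with ⟨a1, b1⟩ | ⟨a1, b1⟩ <;> rcases k2 with ⟨a2, b2⟩ | ⟨a2, b2⟩
    · exact absurd (hV ⟨hqL, a1⟩ ⟨hrL', a2⟩) hne
    · exact ⟨b1, b2⟩
    · exact ⟨b2, b1⟩
    · exact absurd (hW ⟨hqL, a1⟩ ⟨hrL', a2⟩) hne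

end Uncrossing

section Families

open Filter Topology Metric
open scoped Classical

/-- The points lying on at least two distinct members of a family of sets. -/
def doublePoints {α : Type*} (𝓢 : Set (Set α)) : Set α :=
  {x | ∃ A ∈ 𝓢, ∃ B ∈ 𝓢, A ≠ B ∧ x ∈ A ∧ x ∈ B}

theorem doublePoints_insert_insert_subset {α : Type*} {A B X Y : Set α} {R : Set (Set α)}
    (hu : A ∪ B ⊆ X ∪ Y) (hi : A ∩ B ⊆ X ∩ Y) (hXY : X ≠ Y) (hX : X ∉ R) (hY : Y ∉ R) :
    doublePoints (insert A (insert B R)) ⊆ doublePoints (insert X (insert Y R)) := by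
  have key : ∀ x, x ∈ A ∪ B → ∀ L ∈ R, x ∈ L → x ∈ doublePoints (insert X (insert Y R)) := by
    intro x hx L hL hxL
    have hL' : L ∈ insert X (insert Y R) := by simp [hL]
    rcases hu hx with h | h
    · exact ⟨X, by simp, L, hL', fun hc => hX (hc ▸ hL), h, hxL⟩
    · exact ⟨Y, by simp, L, hL', fun hc => hY (hc ▸ hL), h, hxL⟩
  have hAB : ∀ x, x ∈ A → x ∈ B → x ∈ doublePoints (insert X (insert Y R)) := fun x h1 h2 =>
    ⟨X, by simp, Y, by simp, hXY, hi ⟨h1, h2⟩⟩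
  rintro x ⟨U, hU, V, hV, hUV, hxU, hxV⟩
  rcases hU with rfl | rfl | hU <;> rcases hV with rfl | rfl | hV
  · exact absurd rfl hUV
  · exact hAB x hxU hxV
  · exact key x (Or.inl hxU) V hV hxV
  · exact hAB x hxV hxU
  · exact absurd rfl hUV
  · exact key x (Or.inr hxU) V hV hxV
  · exact key x (Or.inl hxV) U hU hxU
  · exact key x (Or.inr hxV) U hU hxU
  · exact ⟨U, by simp [hU], V, by simp [hV], hUV, hxU, hxV⟩

theorem sum_sum_insert_insert {α : Type*} [DecidableEq α] (f : α → α → ℕ) (hf : ∀ u v, f u v = f v u)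
    {a b : α} {R : Finset α} (hab : a ≠ b) (ha : a ∉ R) (hb : b ∉ R) :
    ∑ u ∈ insert a (insert b R), ∑ v ∈ insert a (insert b R), f u v =
      f a a + f b b + 2 * f a b + 2 * ∑ v ∈ R, (f v a + f v b) + ∑ u ∈ R, ∑ v ∈ R, f u v := by
  have ha' : a ∉ insert b R := by simp [hab, ha]
  simp only [Finset.sum_insert ha', Finset.sum_insert hb, Finset.sum_add_distrib]
  rw [Finset.sum_congr rfl fun v _ => hf a v, Finset.sum_congr rfl fun v _ => hf b v, hf b a]
  ring

/-- A family of topolines any two of which meet in at most one point. -/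
def IsPseudolineFamily (𝓢 : Set (Set ℂ)) : Prop :=
  (∀ A ∈ 𝓢, IsTopoline A) ∧ 𝓢.Pairwise fun A B => (A ∩ B).Subsingleton

/-- The number of ordered pairs of touching members of a family. -/
noncomputable def touchCount (𝓢 : Finset (Set ℂ)) : ℕ :=
  ∑ u ∈ 𝓢, ∑ v ∈ 𝓢, if IsTouching u v then 1 else 0

theorem nontrivial_diagLine_inter_upperVee : (diagLine ∩ upperVee).Nontrivial := by
  refine ⟨0, ⟨by simp [diagLine], by simp [upperVee]⟩, 1 + Complex.I,
    ⟨by simp [diagLine], by simp [upperVee]⟩, fun h => ?_⟩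
  simpa using congrArg Complex.re h

theorem nontrivial_antidiagLine_inter_lowerVee : (antidiagLine ∩ lowerVee).Nontrivial := by
  refine ⟨0, ⟨by simp [antidiagLine], by simp [lowerVee]⟩, 1 - Complex.I,
    ⟨by simp [antidiagLine], by simp [lowerVee]⟩, fun h => ?_⟩
  simpa using congrArg Complex.re h

theorem diagLine_ne_antidiagLine : diagLine ≠ antidiagLine := by
  intro h
  have : (1 + Complex.I) ∈ antidiagLine := h ▸ (by simp [diagLine])
  simp [antidiagLine] at this
  norm_num at this

theorem not_isTouching_self (A : Set ℂ) : ¬ IsTouching A A := fun h => h.ne rfl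

theorem exists_touchCount_lt {𝓢 : Finset (Set ℂ)} (h𝓢 : IsPseudolineFamily 𝓢) {A B : Set ℂ}
    (hA : A ∈ 𝓢) (hB : B ∈ 𝓢) (hAB : IsTouching A B) :
    ∃ 𝓣 : Finset (Set ℂ), IsPseudolineFamily 𝓣 ∧ touchCount 𝓣 < touchCount 𝓢 ∧
      ⋃₀ (𝓣 : Set (Set ℂ)) = ⋃₀ 𝓢 ∧ doublePoints (𝓣 : Set (Set ℂ)) = doublePoints 𝓢 := by
  have hne := hAB.ne
  obtain ⟨E, hAE, hBE⟩ := id hAB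
  replace hAE : A = E ⁻¹' upperVee := hAE
  replace hBE : B = E ⁻¹' lowerVee := hBE
  set X := E ⁻¹' diagLine with hX
  set Y := E ⁻¹' antidiagLine with hY
  set R := (𝓢.erase A).erase B with hR
  have hAR : A ∉ R := by simp [hR]
  have hBR : B ∉ R := by simp [hR]
  have h𝓢R : 𝓢 = insert A (insert B R) := by
    rw [hR, Finset.insert_erase (Finset.mem_erase.2 ⟨hne.symm, hB⟩), Finset.insert_erase hA]
  have hmem : ∀ L ∈ R, L ∈ 𝓢 ∧ L ≠ A ∧ L ≠ B := fun L hL => by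
    simp only [hR, Finset.mem_erase] at hL
    exact ⟨hL.2.2, hL.2.1, hL.1⟩
  have hLA : ∀ L ∈ R, (L ∩ A).Subsingleton := fun L hL =>
    h𝓢.2 (hmem L hL).1 hA (hmem L hL).2.1
  have hLB : ∀ L ∈ R, (L ∩ B).Subsingleton := fun L hL =>
    h𝓢.2 (hmem L hL).1 hB (hmem L hL).2.2
  have hpre : ∀ L : Set ℂ, L = E ⁻¹' (E.symm ⁻¹' L) := fun L => by
    ext z; simp
  have hpre' : ∀ S : Set ℂ, E.symm ⁻¹' (E ⁻¹' S) = S := fun S => by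
    ext z; simp
  have htop : ∀ L ∈ R, IsTopoline (E.symm ⁻¹' L) := fun L hL =>
    (h𝓢.1 L (hmem L hL).1).preimage E.symm
  have hsub : ∀ L S : Set ℂ, (L ∩ E ⁻¹' S).Subsingleton ↔ (E.symm ⁻¹' L ∩ S).Subsingleton := by
    intro L S
    conv_lhs => rw [hpre L, ← preimage_inter]
    refine ⟨fun h => ?_, fun h => h.preimage E.injective⟩
    have := h.preimage E.symm.injective
    rwa [hpre'] at this
  have htouch : ∀ L S : Set ℂ, IsTouching L (E ⁻¹' S) ↔ IsTouching (E.symm ⁻¹' L) S := by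
    intro L S
    conv_lhs => rw [hpre L, isTouching_preimage_iff]
  have hV : ∀ L ∈ R, (E.symm ⁻¹' L ∩ upperVee).Subsingleton := fun L hL =>
    (hsub L _).1 (hAE ▸ hLA L hL)
  have hW : ∀ L ∈ R, (E.symm ⁻¹' L ∩ lowerVee).Subsingleton := fun L hL =>
    (hsub L _).1 (hBE ▸ hLB L hL)
  have hLX : ∀ L ∈ R, (L ∩ X).Subsingleton := fun L hL =>
    (hsub L _).2 (subsingleton_inter_diagonal (htop L hL) (hV L hL) (hW L hL))
  have hLY : ∀ L ∈ R, (L ∩ Y).Subsingleton := fun L hL =>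
    (hsub L _).2 (subsingleton_inter_antidiagonal (htop L hL) (hV L hL) (hW L hL))
  have hXR : X ∉ R := fun h => by
    have h1 := (hsub X _).1 (hAE ▸ hLA X h)
    rw [hX, hpre'] at h1
    exact nontrivial_diagLine_inter_upperVee.not_subsingleton h1
  have hYR : Y ∉ R := fun h => by
    have h1 := (hsub Y _).1 (hBE ▸ hLB Y h)
    rw [hY, hpre'] at h1
    exact nontrivial_antidiagLine_inter_lowerVee.not_subsingleton h1
  have hXY : X ≠ Y := fun h => diagLine_ne_antidiagLine (E.surjective.preimage_injective h)
  have hU : A ∪ B = X ∪ Y := by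
    rw [hAE, hBE, hX, hY, ← preimage_union, ← preimage_union, upperVee_union_lowerVee]
  have hI : A ∩ B = X ∩ Y := by
    rw [hAE, hBE, hX, hY, ← preimage_inter, ← preimage_inter, upperVee_inter_lowerVee,
      diagonal_inter_antidiagonal]
  have hXYs : (X ∩ Y).Subsingleton := hI ▸ h𝓢.2 hA hB hne
  refine ⟨insert X (insert Y R), ⟨?_, ?_⟩, ?_, ?_, ?_⟩
  · intro L hL
    simp only [Finset.coe_insert, mem_insert_iff, Finset.mem_coe] at hL
    rcases hL with rfl | rfl | hL
    · exact isTopoline_diagLine.preimage E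
    · exact isTopoline_antidiagLine.preimage E
    · exact h𝓢.1 L (hmem L hL).1
  · have hsymm : ∀ {A B : Set ℂ}, (A ∩ B).Subsingleton → (B ∩ A).Subsingleton := fun h => by
      rwa [inter_comm]
    have : Std.Symm fun A B : Set ℂ => (A ∩ B).Subsingleton := ⟨fun _ _ h => hsymm h⟩
    rw [Finset.coe_insert, Finset.coe_insert, pairwise_insert_of_symm, pairwise_insert_of_symm]
    refine ⟨⟨fun L hL M hM hLM => h𝓢.2 (hmem L hL).1 (hmem M hM).1 hLM,
      fun L hL _ => hsymm (hLY L hL)⟩, fun L hL _ => ?_⟩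
    rcases hL with rfl | hL
    · exact hXYs
    · exact hsymm (hLX L hL)
  · have hs : ∀ u v : Set ℂ, (if IsTouching u v then 1 else 0 : ℕ) =
        if IsTouching v u then 1 else 0 := fun u v =>
      if_congr ⟨IsTouching.symm, IsTouching.symm⟩ rfl rfl
    have hnXY : ¬ IsTouching X Y := fun h => not_isTouching_diagonal_antidiagonal
      ((isTouching_preimage_iff E).1 h)
    have h1 := sum_sum_insert_insert _ hs hXY hXR hYR
    have h2 := sum_sum_insert_insert _ hs hne hAR hBR
    rw [← touchCount] at h1 h2
    rw [h𝓢R, h1, h2]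
    simp only [not_isTouching_self, hnXY, hAB, if_true, if_false]
    have : ∑ v ∈ R, ((if IsTouching v X then 1 else 0) + if IsTouching v Y then 1 else 0) ≤
        ∑ v ∈ R, ((if IsTouching v A then 1 else 0) + if IsTouching v B then 1 else 0) := by
      refine Finset.sum_le_sum fun L hL => ?_
      rw [hAE, hBE, hX, hY]
      simp only [htouch]
      have h1 := isTouching_of_diagonal (htop L hL) (hV L hL) (hW L hL)
      have h2 := isTouching_of_antidiagonal (htop L hL) (hV L hL) (hW L hL)
      have h3 := isTouching_of_diagonal_of_antidiagonal (htop L hL) (hV L hL) (hW L hL)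
      split_ifs <;> first | omega | tauto
    omega
  · rw [h𝓢R]
    simp only [Finset.coe_insert, sUnion_insert, ← union_assoc, hU]
  · rw [h𝓢R]
    simp only [Finset.coe_insert]
    exact Subset.antisymm
      (doublePoints_insert_insert_subset hU.ge hI.ge hne hAR hBR)
      (doublePoints_insert_insert_subset hU.le hI.le hXY hXR hYR)

theorem IsPseudolineFamily.exists_not_isTouching {𝓢 : Finset (Set ℂ)} (h𝓢 : IsPseudolineFamily 𝓢) :
    ∃ 𝓣 : Finset (Set ℂ), IsPseudolineFamily 𝓣 ∧ (∀ A ∈ 𝓣, ∀ B ∈ 𝓣, ¬ IsTouching A B) ∧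
      ⋃₀ (𝓣 : Set (Set ℂ)) = ⋃₀ 𝓢 ∧ doublePoints (𝓣 : Set (Set ℂ)) = doublePoints 𝓢 := by
  induction hn : touchCount 𝓢 using Nat.strong_induction_on generalizing 𝓢 with
  | _ n ih =>
    by_cases h : ∀ A ∈ 𝓢, ∀ B ∈ 𝓢, ¬ IsTouching A B
    · exact ⟨𝓢, h𝓢, h, rfl, rfl⟩
    · push Not at h
      obtain ⟨A, hA, B, hB, hAB⟩ := h
      obtain ⟨𝓣, h1, h2, h3, h4⟩ := exists_touchCount_lt h𝓢 hA hB hAB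
      obtain ⟨𝓤, k1, k2, k3, k4⟩ := ih _ (hn ▸ h2) h1 rfl
      exact ⟨𝓤, k1, k2, k3.trans h3, k4.trans h4⟩

theorem IsPseudolineFamily.exists_cross {𝓢 : Set (Set ℂ)} (hf : 𝓢.Finite)
    (h𝓢 : IsPseudolineFamily 𝓢) :
    ∃ 𝓣 : Set (Set ℂ), 𝓣.Finite ∧ IsPseudolineFamily 𝓣 ∧
      (∀ A ∈ 𝓣, ∀ B ∈ 𝓣, A ≠ B → A ∩ B = ∅ ∨
        ∃ E : ℂ ≃ₜ ℂ, A = {z | (E z).im = 0} ∧ B = {z | (E z).re = 0}) ∧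
      ⋃₀ 𝓣 = ⋃₀ 𝓢 ∧ doublePoints 𝓣 = doublePoints 𝓢 := by
  lift 𝓢 to Finset (Set ℂ) using hf
  obtain ⟨𝓣, h1, h2, h3, h4⟩ := h𝓢.exists_not_isTouching
  refine ⟨𝓣, 𝓣.finite_toSet, h1, fun A hA B hB hAB => ?_, h3, h4⟩
  rcases (h1.2 hA hB hAB).eq_empty_or_singleton with h | ⟨p, hp⟩
  · exact Or.inl h
  · exact Or.inr ((exists_homeomorph_of_inter_eq_singleton (h1.1 A hA) (h1.1 B hB) hp).resolve_right
      (h2 A hA B hB))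

end Families

section Translation

open Filter Topology Metric

theorem mem_coordHyp_iff {n i : ℕ} (hi : i < n) {x : Fin n → ℝ} :
    x ∈ coordHyp n i ↔ x ⟨i, hi⟩ = 0 :=
  ⟨fun h => h hi, fun h _ => h⟩

theorem image_eq_iff_forall_mem {X Y : Type*} [TopologicalSpace X] [TopologicalSpace Y]
    (e : X ≃ₜ Y) {S : Set X} {T : Set Y} : e '' S = T ↔ ∀ x, x ∈ S ↔ e x ∈ T := by
  rw [e.image_eq_preimage_symm]
  constructor
  · rintro rfl x; simp
  · intro h; ext y; simp [h]

/-- The plane `ℝ²` as the complex plane, with the first coordinate as imaginary part. -/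
def planeHomeomorph : (Fin 2 → ℝ) ≃ₜ ℂ where
  toFun x := ⟨x 1, x 0⟩
  invFun z := ![z.im, z.re]
  left_inv x := by ext i; fin_cases i <;> rfl
  right_inv z := rfl
  continuous_toFun := Complex.equivRealProdCLM.symm.continuous.comp
    ((continuous_apply 1).prodMk (continuous_apply 0) : Continuous fun x : Fin 2 → ℝ => (x 1, x 0))
  continuous_invFun := by fun_prop

@[simp] theorem planeHomeomorph_re (x : Fin 2 → ℝ) : (planeHomeomorph x).re = x 1 := rfl

@[simp] theorem planeHomeomorph_im (x : Fin 2 → ℝ) : (planeHomeomorph x).im = x 0 := rfl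

@[simp] theorem planeHomeomorph_symm_zero (z : ℂ) : planeHomeomorph.symm z 0 = z.im := rfl

@[simp] theorem planeHomeomorph_symm_one (z : ℂ) : planeHomeomorph.symm z 1 = z.re := rfl

theorem IsTopoplane.isTopoline {H : Set (Fin 2 → ℝ)} (hH : IsTopoplane H) :
    IsTopoline (planeHomeomorph.symm ⁻¹' H) := by
  obtain ⟨e, he⟩ := hH
  rw [image_eq_iff_forall_mem] at he
  refine ⟨planeHomeomorph.symm.trans (e.trans planeHomeomorph), ?_⟩
  ext z
  simp [he, mem_coordHyp_iff]

theorem IsTopoline.isTopoplane {A : Set ℂ} (hA : IsTopoline A) :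
    IsTopoplane (planeHomeomorph ⁻¹' A) := by
  obtain ⟨e, rfl⟩ := hA
  refine ⟨planeHomeomorph.trans (e.trans planeHomeomorph.symm), ?_⟩
  rw [image_eq_iff_forall_mem]
  intro x
  simp [mem_coordHyp_iff]

theorem crosses_of_homeomorph (E : ℂ ≃ₜ ℂ) :
    Crosses (planeHomeomorph ⁻¹' {z | (E z).im = 0}) (planeHomeomorph ⁻¹' {z | (E z).re = 0}) := by
  refine ⟨planeHomeomorph.trans (E.trans planeHomeomorph.symm), ?_, ?_⟩ <;>
  · rw [image_eq_iff_forall_mem]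
    intro x
    simp [mem_coordHyp_iff]

theorem IsTopoplane.exists_homeomorph_real {H : Set (Fin 2 → ℝ)} (hH : IsTopoplane H) :
    Nonempty (H ≃ₜ ℝ) := by
  obtain ⟨e, he⟩ := hH
  rw [image_eq_iff_forall_mem] at he
  simp only [mem_coordHyp_iff (Nat.succ_pos 1)] at he
  refine ⟨⟨⟨fun x => e x 1, fun t => ⟨e.symm ![0, t], (he _).2 (by simp)⟩, fun x => ?_,
    fun t => by simp⟩, by fun_prop, by fun_prop⟩⟩
  rw [Subtype.ext_iff, e.symm_apply_eq]
  ext i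
  fin_cases i
  · exact ((he x).1 x.2).symm
  · rfl

theorem eq_one_of_homeomorph_real {d : ℕ} (hd : 1 ≤ d) (g : ℝ ≃ₜ (Fin d → ℝ)) : d = 1 := by
  by_contra hne
  have hrank : 1 < Module.rank ℝ (Fin d → ℝ) := by
    rw [rank_fin_fun]
    exact_mod_cast lt_of_le_of_ne hd (Ne.symm hne)
  have h := (isConnected_compl_singleton_of_one_lt_rank hrank (g 0)).isPreconnected.image g.symm
    g.symm.continuous.continuousOn
  have hmem : ∀ t : ℝ, t ∈ g.symm '' {g 0}ᶜ ↔ t ≠ 0 := fun t => by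
    simp [g.image_symm]
  have := h.Icc_subset ((hmem (-1)).2 (by norm_num)) ((hmem 1).2 one_ne_zero)
    (show (0 : ℝ) ∈ Icc (-1) 1 by norm_num)
  exact (hmem 0).1 this rfl

theorem IsRelTopoplane.subsingleton {n : ℕ} {Y Z : Set (Fin n → ℝ)} (h : IsRelTopoplane Y Z)
    (ψ : Y ≃ₜ ℝ) : Z.Subsingleton := by
  obtain ⟨hZY, d, hd, φ, hφ⟩ := h
  obtain rfl := eq_one_of_homeomorph_real hd (ψ.symm.trans φ)
  rw [image_eq_iff_forall_mem] at hφ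
  have hz : ∀ x (hx : x ∈ Z), φ ⟨x, hZY hx⟩ = 0 := fun x hx => by
    have := (mem_coordHyp_iff Nat.one_pos).1 ((hφ ⟨x, hZY hx⟩).1 hx)
    ext i
    rw [Subsingleton.elim i ⟨0, Nat.one_pos⟩, this]
    rfl
  intro x hx y hy
  exact congrArg Subtype.val (φ.injective ((hz x hx).trans (hz y hy).symm))

theorem isRelTopoplane_singleton {n : ℕ} {Y : Set (Fin n → ℝ)} (ψ : Y ≃ₜ ℝ) {p : Fin n → ℝ}
    (hp : p ∈ Y) : IsRelTopoplane Y {p} := by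
  refine ⟨singleton_subset_iff.2 hp, 1, le_rfl, (ψ.trans (Homeomorph.addRight (-ψ ⟨p, hp⟩))).trans
    (Homeomorph.funUnique (Fin 1) ℝ).symm, ?_⟩
  rw [image_eq_iff_forall_mem]
  intro x
  simp [mem_coordHyp_iff, add_neg_eq_zero, Subtype.ext_iff]

theorem isRelTopoplane_univ {n : ℕ} (hn : 1 ≤ n) {H : Set (Fin n → ℝ)} (hH : IsTopoplane H) :
    IsRelTopoplane univ H := by
  obtain ⟨e, he⟩ := hH
  rw [image_eq_iff_forall_mem] at he
  refine ⟨subset_univ _, n, hn, (Homeomorph.Set.univ _).trans e, ?_⟩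
  rw [image_eq_iff_forall_mem]
  exact fun x => he x

theorem IsTopoplane.nonempty {H : Set (Fin 2 → ℝ)} (hH : IsTopoplane H) : H.Nonempty := by
  obtain ⟨ψ⟩ := hH.exists_homeomorph_real
  exact ⟨ψ.symm 0, (ψ.symm 0).2⟩

theorem IsArrangement.pairwise_subsingleton {𝓗 : Set (Set (Fin 2 → ℝ))} (h𝓗 : IsArrangement 𝓗) :
    𝓗.Pairwise fun A B => (A ∩ B).Subsingleton := by
  obtain ⟨-, htop, hflat⟩ := h𝓗
  have key : ∀ A ∈ 𝓗, ∀ B ∈ 𝓗, B ⊆ A ∨ (A ∩ B).Subsingleton := fun A hA B hB => by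
    rcases hflat A hA B ⟨⟨{B}, singleton_subset_iff.2 hB, (sInter_singleton B).symm⟩,
      (htop B hB).nonempty⟩ with h | h | h
    · exact Or.inl h
    · exact Or.inr (h ▸ subsingleton_empty)
    · obtain ⟨ψ⟩ := (htop B hB).exists_homeomorph_real
      exact Or.inr (h.subsingleton ψ)
  intro A hA B hB hAB
  rcases key A hA B hB with h | h
  · rcases key B hB A hA with h' | h'
    · exact absurd (h'.antisymm h) hAB
    · exact inter_comm B A ▸ h'
  · exact h

theorem isArrangement_of_pairwise_subsingleton {𝓗 : Set (Set (Fin 2 → ℝ))} (hf : 𝓗.Finite)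
    (htop : ∀ H ∈ 𝓗, IsTopoplane H) (hs : 𝓗.Pairwise fun A B => (A ∩ B).Subsingleton) :
    IsArrangement 𝓗 := by
  refine ⟨hf, htop, ?_⟩
  rintro H hH Y ⟨⟨𝓢, h𝓢, rfl⟩, -⟩
  rcases 𝓢.eq_empty_or_nonempty with rfl | ⟨A, hA⟩
  · right; right
    rw [sInter_empty, inter_univ]
    exact isRelTopoplane_univ one_le_two (htop H hH)
  by_cases hsing : 𝓢 = {A}
  · subst hsing
    rw [sInter_singleton]
    by_cases hHA : H = A
    · exact Or.inl hHA.ge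
    right
    rcases (hs hH (h𝓢 hA) hHA).eq_empty_or_singleton with h | ⟨p, hp⟩
    · exact Or.inl h
    · right
      obtain ⟨ψ⟩ := (htop A (h𝓢 hA)).exists_homeomorph_real
      rw [hp]
      exact isRelTopoplane_singleton ψ (hp.ge rfl).2
  · obtain ⟨B, hB, hBA⟩ : ∃ B ∈ 𝓢, B ≠ A := by
      by_contra! h
      exact hsing (Subset.antisymm h (singleton_subset_iff.2 hA))
    have hsub : (⋂₀ 𝓢).Subsingleton := (hs (h𝓢 hA) (h𝓢 hB) hBA.symm).anti
      (subset_inter (sInter_subset_of_mem hA) (sInter_subset_of_mem hB))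
    rcases (H ∩ ⋂₀ 𝓢).eq_empty_or_nonempty with h | ⟨x, hxH, hx⟩
    · exact Or.inr (Or.inl h)
    · exact Or.inl fun y hy => hsub hx hy ▸ hxH

theorem sUnion_image_preimage {X Y : Type*} (f : X → Y) (𝓢 : Set (Set Y)) :
    ⋃₀ ((f ⁻¹' ·) '' 𝓢) = f ⁻¹' ⋃₀ 𝓢 := by
  ext x; simp

theorem doublePoints_image_preimage {X Y : Type*} {f : X → Y} (hf : Function.Surjective f)
    (𝓢 : Set (Set Y)) : doublePoints ((f ⁻¹' ·) '' 𝓢) = f ⁻¹' doublePoints 𝓢 := by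
  ext x
  simp [doublePoints, hf.preimage_injective.eq_iff]

end Translation

/-- for every arrangement of topolines `𝓗` in `ℝ²` there is an affine
arrangement of topolines `𝓐` with the same faces: `⋃𝓐 = ⋃𝓗`, and the set of points on
at least two distinct members of `𝓐` equals the set of points on at least two distinct
members of `𝓗`. -/
theorem statement8 (𝓗 : Set (Set (Fin 2 → ℝ))) (h𝓗 : IsArrangement 𝓗) :
    ∃ 𝓐 : Set (Set (Fin 2 → ℝ)), IsArrangement 𝓐 ∧ PairwiseAffine 𝓐 ∧
      ⋃₀ 𝓐 = ⋃₀ 𝓗 ∧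
      {x | ∃ A ∈ 𝓐, ∃ B ∈ 𝓐, A ≠ B ∧ x ∈ A ∧ x ∈ B} =
        {x | ∃ A ∈ 𝓗, ∃ B ∈ 𝓗, A ≠ B ∧ x ∈ A ∧ x ∈ B} := by
  set κ := planeHomeomorph
  have hκ : ∀ S : Set (Fin 2 → ℝ), κ ⁻¹' (κ.symm ⁻¹' S) = S := fun S => by ext x; simp
  have hfam : IsPseudolineFamily ((κ.symm ⁻¹' ·) '' 𝓗) := by
    refine ⟨forall_mem_image.2 fun H hH => (h𝓗.2.1 H hH).isTopoline, ?_⟩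
    rintro _ ⟨A, hA, rfl⟩ _ ⟨B, hB, rfl⟩ hAB
    exact (h𝓗.pairwise_subsingleton hA hB fun h => hAB (by rw [h])).preimage κ.symm.injective
  obtain ⟨𝓣, hf, h𝓣, hcross, hU, hD⟩ := hfam.exists_cross (h𝓗.1.image _)
  refine ⟨(κ ⁻¹' ·) '' 𝓣, isArrangement_of_pairwise_subsingleton (hf.image _)
    (forall_mem_image.2 fun A hA => (h𝓣.1 A hA).isTopoplane) ?_, ?_, ?_, ?_⟩
  · rintro _ ⟨A, hA, rfl⟩ _ ⟨B, hB, rfl⟩ hAB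
    exact (h𝓣.2 hA hB fun h => hAB (by rw [h])).preimage κ.injective
  · rintro _ ⟨A, hA, rfl⟩ _ ⟨B, hB, rfl⟩ hAB
    rcases hcross A hA B hB fun h => hAB (by rw [h]) with h | ⟨E, rfl, rfl⟩
    · left
      rw [← preimage_inter, h, preimage_empty]
    · exact Or.inr (crosses_of_homeomorph E)
  · rw [sUnion_image_preimage, hU, sUnion_image_preimage, hκ]
  · change doublePoints _ = doublePoints _
    rw [doublePoints_image_preimage κ.surjective, hD,
      doublePoints_image_preimage κ.symm.surjective, hκ]
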